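/- Let Φ : V^{⊗n} → W̃_{z₁,…,zₙ} be composable with m vertex operators, and let p, q ∈ ℤ₊ with p + q ≤ m, l₁,…,lₙ ∈ ℤ₊ with l₁+⋯+lₙ = p+n, and k₁,…,k_{p+n} ∈ ℤ₊ with k₁+⋯+k_{p+n} = q+p+n. Then (Φ∘(E^{(l₁)}_{V;1}⊗⋯⊗E^{(lₙ)}_{V;1}))∘(E^{(k₁)}_{V;1}⊗⋯⊗E^{(k_{p+n})}_{V;1}) = Φ∘(E^{(k₁+⋯+k_{l₁})}_{V;1}⊗⋯⊗E^{(k_{l₁+⋯+l_{n−1}+1}+⋯+k_{p+n})}_{V;1}). -/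

import Mathlib

open scoped BigOperators Classical

noncomputable section VertexCohomology

/-! ## Rational functions with prescribed poles -/

/-- A function of `n` complex variables (restricted to the configuration space of
pairwise distinct points) which is a rational function with the only possible poles
on the diagonals `z i = z j`, `i ≠ j`. -/
def RatDiag (n : ℕ) (f : (Fin n → ℂ) → ℂ) : Prop :=
  ∃ (P : MvPolynomial (Fin n) ℂ) (N : ℕ),
    ∀ z : Fin n → ℂ, (∀ i j : Fin n, i ≠ j → z i ≠ z j) →
      f z * ∏ i : Fin n, ∏ j : Fin n, (if i < j then (z i - z j) ^ N else 1)
        = MvPolynomial.eval z P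

/-- A rational function of `n` variables with the only possible poles at
`z i = z j` (`i ≠ j`) and `z i = 0`. -/
def RatFull (n : ℕ) (f : (Fin n → ℂ) → ℂ) : Prop :=
  ∃ (P : MvPolynomial (Fin n) ℂ) (N : ℕ),
    ∀ z : Fin n → ℂ, (∀ i, z i ≠ 0) → (∀ i j : Fin n, i ≠ j → z i ≠ z j) →
      f z * ((∏ i : Fin n, z i ^ N) *
        ∏ i : Fin n, ∏ j : Fin n, (if i < j then (z i - z j) ^ N else 1))
        = MvPolynomial.eval z P

/-- A rational function of `n` variables with the only possible poles at
`z i = z j` (`i ≠ j`), the pole at `z i = z j` being of order at most `Nb i j`. -/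
def RatDiagBnd (n : ℕ) (Nb : Fin n → Fin n → ℕ) (f : (Fin n → ℂ) → ℂ) : Prop :=
  ∃ P : MvPolynomial (Fin n) ℂ,
    ∀ z : Fin n → ℂ, (∀ i j : Fin n, i ≠ j → z i ≠ z j) →
      f z * ∏ i : Fin n, ∏ j : Fin n, (if i < j then (z i - z j) ^ (Nb i j) else 1)
        = MvPolynomial.eval z P

/-- A rational function of one variable with the only possible pole at `0`. -/
def RatOne (f : ℂ → ℂ) : Prop :=
  ∃ (P : Polynomial ℂ) (N : ℕ), ∀ z : ℂ, z ≠ 0 → f z * z ^ N = Polynomial.eval z P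

/-! ## Graded duals -/

/-- A linear functional on a `ℤ`-graded space belonging to the graded (restricted) dual:
it is nonzero on only finitely many homogeneous subspaces. -/
def GradedFunctionalZ {V : Type} [AddCommGroup V] [Module ℂ V]
    (grading : ℤ → Submodule ℂ V) (f : V →ₗ[ℂ] ℂ) : Prop :=
  {k : ℤ | ∃ v ∈ grading k, f v ≠ 0}.Finite

/-- A linear functional on a `ℂ`-graded space belonging to the graded (restricted) dual. -/
def GradedFunctionalC {W : Type} [AddCommGroup W] [Module ℂ W]
    (grading : ℂ → Submodule ℂ W) (f : W →ₗ[ℂ] ℂ) : Prop :=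
  {c : ℂ | ∃ w ∈ grading c, f w ≠ 0}.Finite

/-! ## Grading-restricted vertex algebras and modules -/

variable (V : Type) [AddCommGroup V] [Module ℂ V]
variable (W : Type) [AddCommGroup W] [Module ℂ W]

/-- A grading-restricted vertex algebra structure on `V`, with the duality property
(for products and iterates of two vertex operators) as the main axiom.
`Y u v k` denotes the coefficient `(Y_V)_k(u)v` of `x^{-k-1}` in `Y_V(u,x)v`. -/
structure GRVA where
  grading : ℤ → Submodule ℂ V
  decomp : DirectSum.Decomposition grading
  finiteDim : ∀ k : ℤ, Module.Finite ℂ (grading k)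
  lower_bounded : ∃ N : ℤ, ∀ k : ℤ, k < N → grading k = ⊥
  Y : V →ₗ[ℂ] V →ₗ[ℂ] (ℤ → V)
  vacuum : V
  vacuum_mem : vacuum ∈ grading 0
  trunc : ∀ u v : V, ∃ N : ℤ, ∀ k : ℤ, N ≤ k → Y u v k = 0
  identity : ∀ (v : V) (k : ℤ), Y vacuum v k = if k = -1 then v else 0
  creation : ∀ (u : V) (k : ℤ), 0 ≤ k → Y u vacuum k = 0
  creation_lim : ∀ u : V, Y u vacuum (-1) = u
  L0 : Module.End ℂ V
  L0_eq : ∀ (k : ℤ) (v : V), v ∈ grading k → L0 v = (k : ℂ) • v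
  Lm1 : Module.End ℂ V
  Lm1_eq : ∀ v : V, Lm1 v = Y v vacuum (-2)
  L0_bracket : ∀ (u v : V) (k : ℤ), L0 (Y u v k)
      = Y (L0 u) v k + Y u (L0 v) k + ((-k - 1 : ℤ) : ℂ) • Y u v k
  Lm1_deriv : ∀ (u v : V) (k : ℤ), Y (Lm1 u) v k = (-k : ℂ) • Y u v (k - 1)
  Lm1_bracket : ∀ (u v : V) (k : ℤ),
      Lm1 (Y u v k) - Y u (Lm1 v) k = (-k : ℂ) • Y u v (k - 1)
  duality : ∀ (u₁ u₂ v : V) (v' : V →ₗ[ℂ] ℂ), GradedFunctionalZ grading v' →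
    ∃ f : (Fin 2 → ℂ) → ℂ, RatFull 2 f ∧
      (∀ z₁ z₂ : ℂ, ‖z₁‖ > ‖z₂‖ → z₂ ≠ 0 →
        HasSum (fun k : ℤ × ℤ =>
          v' (Y u₁ (Y u₂ v k.2) k.1) * z₁ ^ (-k.1 - 1) * z₂ ^ (-k.2 - 1)) (f ![z₁, z₂])) ∧
      (∀ z₁ z₂ : ℂ, ‖z₂‖ > ‖z₁‖ → z₁ ≠ 0 →
        HasSum (fun k : ℤ × ℤ =>
          v' (Y u₂ (Y u₁ v k.1) k.2) * z₁ ^ (-k.1 - 1) * z₂ ^ (-k.2 - 1)) (f ![z₁, z₂])) ∧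
      (∀ z₁ z₂ : ℂ, ‖z₂‖ > ‖z₁ - z₂‖ → z₁ ≠ z₂ → z₂ ≠ 0 →
        HasSum (fun k : ℤ × ℤ =>
          v' (Y (Y u₁ u₂ k.1) v k.2) * (z₁ - z₂) ^ (-k.1 - 1) * z₂ ^ (-k.2 - 1))
          (f ![z₁, z₂]))

/-- A grading-restricted generalized module structure on `W` for a
grading-restricted vertex algebra structure `A` on `V`. -/
structure GRMod (A : GRVA V) where
  grading : ℂ → Submodule ℂ W
  decomp : DirectSum.Decomposition grading
  lower_trunc : ∃ N : ℝ, ∀ c : ℂ, c.re < N → grading c = ⊥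
  Y : V →ₗ[ℂ] W →ₗ[ℂ] (ℤ → W)
  trunc : ∀ (u : V) (w : W), ∃ N : ℤ, ∀ k : ℤ, N ≤ k → Y u w k = 0
  identity : ∀ (w : W) (k : ℤ), Y A.vacuum w k = if k = -1 then w else 0
  L0 : Module.End ℂ W
  Lm1 : Module.End ℂ W
  L0_mem : ∀ (c : ℂ) (w : W), w ∈ grading c → L0 w ∈ grading c
  Lm1_mem : ∀ (c : ℂ) (w : W), w ∈ grading c → Lm1 w ∈ grading (c + 1)
  L0_bracket : ∀ (u : V) (w : W) (k : ℤ), L0 (Y u w k)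
      = Y (A.L0 u) w k + Y u (L0 w) k + ((-k - 1 : ℤ) : ℂ) • Y u w k
  L0_nilpotent : ∀ (c : ℂ) (w : W), w ∈ grading c →
      ∃ K : ℕ, ((L0 - c • 1) ^ K) w = 0
  Lm1_deriv : ∀ (u : V) (w : W) (k : ℤ), Y (A.Lm1 u) w k = (-k : ℂ) • Y u w (k - 1)
  Lm1_bracket : ∀ (u : V) (w : W) (k : ℤ),
      Lm1 (Y u w k) - Y u (Lm1 w) k = (-k : ℂ) • Y u w (k - 1)
  duality : ∀ (u₁ u₂ : V) (w : W) (w' : W →ₗ[ℂ] ℂ), GradedFunctionalC grading w' →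
    ∃ f : (Fin 2 → ℂ) → ℂ, RatFull 2 f ∧
      (∀ z₁ z₂ : ℂ, ‖z₁‖ > ‖z₂‖ → z₂ ≠ 0 →
        HasSum (fun k : ℤ × ℤ =>
          w' (Y u₁ (Y u₂ w k.2) k.1) * z₁ ^ (-k.1 - 1) * z₂ ^ (-k.2 - 1)) (f ![z₁, z₂])) ∧
      (∀ z₁ z₂ : ℂ, ‖z₂‖ > ‖z₁‖ → z₁ ≠ 0 →
        HasSum (fun k : ℤ × ℤ =>
          w' (Y u₂ (Y u₁ w k.1) k.2) * z₁ ^ (-k.1 - 1) * z₂ ^ (-k.2 - 1)) (f ![z₁, z₂])) ∧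
      (∀ z₁ z₂ : ℂ, ‖z₂‖ > ‖z₁ - z₂‖ → z₁ ≠ z₂ → z₂ ≠ 0 →
        HasSum (fun k : ℤ × ℤ =>
          w' (Y (A.Y u₁ u₂ k.1) w k.2) * (z₁ - z₂) ^ (-k.1 - 1) * z₂ ^ (-k.2 - 1))
          (f ![z₁, z₂]))

variable {V W}

/-! ## Algebraic completions -/

/-- The algebraic completion `W̄ = ∏_{c ∈ ℂ} W_(c)` of a `ℂ`-graded module. -/
abbrev WbarT {A : GRVA V} (M : GRMod V W A) : Type := ∀ c : ℂ, M.grading c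

/-- The algebraic completion `V̄ = ∏_{k ∈ ℤ} V_(k)`. -/
abbrev VbarT (A : GRVA V) : Type := ∀ k : ℤ, A.grading k

/-- The pairing `⟨w', ω⟩` of an element `w'` of the graded dual `W'` with an
element `ω` of the algebraic completion `W̄`. -/
def pairBar {A : GRVA V} {M : GRMod V W A} (w' : W →ₗ[ℂ] ℂ) (ω : WbarT M) : ℂ :=
  ∑ᶠ c : ℂ, w' (ω c : W)

/-- The pairing of an element of the graded dual `V'` with an element of `V̄`. -/
def pairBarV {A : GRVA V} (v' : V →ₗ[ℂ] ℂ) (ω : VbarT A) : ℂ :=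
  ∑ᶠ k : ℤ, v' (ω k : V)

/-- The homogeneous component `P_r ω ∈ V` of `ω ∈ V̄` for `r ∈ ℂ`
(zero when `r` is not an integer). -/
def VbarComp {A : GRVA V} (ω : VbarT A) (r : ℂ) : V :=
  if h : ∃ k : ℤ, (k : ℂ) = r then (ω h.choose : V) else 0

/-! ## Iterated vertex operators -/

/-- `applyList Yop v k L w` applies the coefficients `(Yop (v t)) · (k t)` of the
vertex operators at the positions listed in `L` (head outermost) to `w`. -/
def applyList {X : Type} [AddCommGroup X] [Module ℂ X] {n : ℕ}
    (Yop : V →ₗ[ℂ] X →ₗ[ℂ] (ℤ → X)) (v : Fin n → V) (k : Fin n → ℤ) :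
    List (Fin n) → X → X
  | [], w => w
  | t :: ts, w => Yop (v t) (applyList Yop v k ts w) (k t)

/-- The coefficient of `z^{-p-1}` in `Y^W_{WV}(w, z)v = e^{zL_W(-1)} Y_W(v, -z)w`. -/
def YWVcoef {A : GRVA V} (M : GRMod V W A) (w : W) (v : V) (p : ℤ) : W :=
  ∑ᶠ m : ℕ, (((m.factorial : ℂ))⁻¹ * (-1 : ℂ) ^ ((m : ℤ) - p)) •
    ((M.Lm1 ^ m) (M.Y v w ((m : ℤ) - p - 1)))

/-! ## The `E`-families: products of vertex operators with values in completions -/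

/-- `IsEVFam A EV` says that `EV l v z ∈ V̄` realizes
`(E^{(l)}_V(v₁ ⊗ ⋯ ⊗ v_l; 𝟏))(z₁, …, z_l) = E(Y_V(v₁,z₁) ⋯ Y_V(v_l,z_l)𝟏)`:
its pairing with every graded functional `v'` is the rational extension (with only
possible poles on the diagonals) of the series of products of `l` vertex operators
acting on the vacuum, which converges in the region `|z₁| > ⋯ > |z_l| > 0`. -/
def IsEVFam (A : GRVA V) (EV : ∀ l : ℕ, (Fin l → V) → (Fin l → ℂ) → VbarT A) : Prop :=
  ∀ (l : ℕ) (v : Fin l → V) (v' : V →ₗ[ℂ] ℂ), GradedFunctionalZ A.grading v' →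
    ∃ f : (Fin l → ℂ) → ℂ, RatDiag l f ∧
      (∀ z : Fin l → ℂ, (List.finRange l).Chain' (fun s t => ‖z s‖ > ‖z t‖) →
          (∀ t, z t ≠ 0) →
        HasSum (fun k : Fin l → ℤ =>
          v' (applyList A.Y v k (List.finRange l) A.vacuum) *
            ∏ t, z t ^ (-(k t) - 1)) (f z)) ∧
      (∀ z, (∀ s t, s ≠ t → z s ≠ z t) → pairBarV v' (EV l v z) = f z)

/-- `IsEWFam A M EW` says that `EW m v u z ∈ W̄` realizes
`(E^{(m)}_W(v₁ ⊗ ⋯ ⊗ v_m; u))(z₁, …, z_m) = E(Y_W(v₁,z₁) ⋯ Y_W(v_m,z_m)u)`: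
its pairing with every graded functional `w'` is the rational extension (with only
possible poles at `z i = z j` and `z i = 0`) of the series of products of `m` module
vertex operators acting on `u`, convergent for `|z₁| > ⋯ > |z_m| > 0`. -/
def IsEWFam {A : GRVA V} (M : GRMod V W A)
    (EW : ∀ m : ℕ, (Fin m → V) → W → (Fin m → ℂ) → WbarT M) : Prop :=
  ∀ (m : ℕ) (v : Fin m → V) (u : W) (w' : W →ₗ[ℂ] ℂ), GradedFunctionalC M.grading w' →
    ∃ f : (Fin m → ℂ) → ℂ, RatFull m f ∧
      (∀ z : Fin m → ℂ, (List.finRange m).Chain' (fun s t => ‖z s‖ > ‖z t‖) →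
          (∀ t, z t ≠ 0) →
        HasSum (fun k : Fin m → ℤ =>
          w' (applyList M.Y v k (List.finRange m) u) *
            ∏ t, z t ^ (-(k t) - 1)) (f z)) ∧
      (∀ z, (∀ s t, s ≠ t → z s ≠ z t) → (∀ t, z t ≠ 0) →
        pairBar w' (EW m v u z) = f z)

/-- `IsEWV1Fam A M G` says that `G m u v ζz ∈ W̄` realizes
`(E^{W;(1,m)}_{WV}(u; v₁ ⊗ ⋯ ⊗ v_m))(ζ, z₁, …, z_m)
  = E(Y^W_{WV}(u,ζ) Y_V(v₁,z₁) ⋯ Y_V(v_m,z_m)𝟏)`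
(first variable is the `ζ`-slot of `Y^W_{WV}`): its pairing with every graded
functional is the rational extension (poles only on diagonals) of the corresponding
series, convergent for `|ζ| > |z₁| > ⋯ > |z_m| > 0`. -/
def IsEWV1Fam {A : GRVA V} (M : GRMod V W A)
    (G : ∀ m : ℕ, W → (Fin m → V) → (Fin (m + 1) → ℂ) → WbarT M) : Prop :=
  ∀ (m : ℕ) (u : W) (v : Fin m → V) (w' : W →ₗ[ℂ] ℂ), GradedFunctionalC M.grading w' →
    ∃ f : (Fin (m + 1) → ℂ) → ℂ, RatDiag (m + 1) f ∧
      (∀ z : Fin (m + 1) → ℂ,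
          (List.finRange (m + 1)).Chain' (fun s t => ‖z s‖ > ‖z t‖) →
          (∀ t, z t ≠ 0) →
        HasSum (fun k : Fin (m + 1) → ℤ =>
          w' (YWVcoef M u
              (applyList A.Y v (fun t => k t.succ) (List.finRange m) A.vacuum) (k 0)) *
            ∏ t, z t ^ (-(k t) - 1)) (f z)) ∧
      (∀ z, (∀ s t, s ≠ t → z s ≠ z t) → pairBar w' (G m u v z) = f z)

/-- `IsEn1Fam A M E` says that `E m v u zζ ∈ W̄` realizes
`(E^{(m,1)}_W(v₁ ⊗ ⋯ ⊗ v_m; u))(z₁, …, z_m, ζ)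
  = E(Y_W(v₁,z₁) ⋯ Y_W(v_m,z_m) Y^W_{WV}(u,ζ)𝟏)`
(the last variable is the `ζ`-slot): its pairing with every graded functional is
the rational extension (poles only on diagonals) of the corresponding series,
convergent for `|z₁| > ⋯ > |z_m| > |ζ| > 0`. -/
def IsEn1Fam {A : GRVA V} (M : GRMod V W A)
    (E : ∀ m : ℕ, (Fin m → V) → W → (Fin (m + 1) → ℂ) → WbarT M) : Prop :=
  ∀ (m : ℕ) (v : Fin m → V) (u : W) (w' : W →ₗ[ℂ] ℂ), GradedFunctionalC M.grading w' →
    ∃ f : (Fin (m + 1) → ℂ) → ℂ, RatDiag (m + 1) f ∧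
      (∀ z : Fin (m + 1) → ℂ,
          (List.finRange (m + 1)).Chain' (fun s t => ‖z s‖ > ‖z t‖) →
          (∀ t, z t ≠ 0) →
        HasSum (fun k : Fin (m + 1) → ℤ =>
          w' (applyList M.Y v (fun t => k t.castSucc) (List.finRange m)
              (YWVcoef M u A.vacuum (k (Fin.last m)))) *
            ∏ t, z t ^ (-(k t) - 1)) (f z)) ∧
      (∀ z, (∀ s t, s ≠ t → z s ≠ z t) → pairBar w' (E m v u z) = f z)

/-! ## Cochains -/

/-- The space of `n`-cochains: linear maps from `V^{⊗n}` to the space of functions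
from `n`-tuples of complex numbers to `W̄` (only the restriction to the configuration
space `F_nℂ` is relevant; `W̄`-valued rationality is imposed separately). -/
abbrev Cochain {A : GRVA V} (M : GRMod V W A) (n : ℕ) :=
  MultilinearMap ℂ (fun _ : Fin n => V) ((Fin n → ℂ) → WbarT M)

/-- `Φ` takes values in `W̄`-valued rational functions with the only possible poles
at `z i = z j`, `i ≠ j` (i.e. in `W̃_{z₁,…,zₙ}`). -/
def TakesRatValues {A : GRVA V} {M : GRMod V W A} {n : ℕ} (Φ : Cochain M n) : Prop :=
  ∀ (v : Fin n → V) (w' : W →ₗ[ℂ] ℂ), GradedFunctionalC M.grading w' →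
    RatDiag n (fun z => pairBar w' (Φ v z))

/-- Pre-composition of the complex variables with an equivalence, as a linear map. -/
def precompZ {X : Type} [AddCommGroup X] [Module ℂ X] {a b : ℕ} (e : Fin a ≃ Fin b) :
    ((Fin a → ℂ) → X) →ₗ[ℂ] ((Fin b → ℂ) → X) where
  toFun f := fun zb => f (fun i => zb (e i))
  map_add' _ _ := rfl
  map_smul' _ _ := rfl

/-- Transport of a cochain along an identification of index sets; for `e = σ ∈ Sₙ`
this is the action `(σ(Φ))(v₁ ⊗ ⋯ ⊗ vₙ) = σ(Φ(v_{σ(1)} ⊗ ⋯ ⊗ v_{σ(n)}))`,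
i.e. `(transport σ Φ) v z = Φ (v ∘ σ) (z ∘ σ)`. -/
def transport {A : GRVA V} {M : GRMod V W A} {a b : ℕ} (e : Fin a ≃ Fin b)
    (Φ : Cochain M a) : Cochain M b :=
  (precompZ e).compMultilinearMap (MultilinearMap.domDomCongr e Φ)
/-! ## Operators on the algebraic completion -/

lemma Lm1_pow_mem {A : GRVA V} (M : GRMod V W A) (m : ℕ) (c : ℂ) (w : W)
    (h : w ∈ M.grading c) : (M.Lm1 ^ m) w ∈ M.grading (c + m) := by
  induction m generalizing c w with
  | zero => simpa using h
  | succ K ih =>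
    have h1 : (M.Lm1 ^ (K + 1)) w = (M.Lm1 ^ K) (M.Lm1 w) := by
      rw [pow_succ]; rfl
    have h2 := ih (c + 1) (M.Lm1 w) (M.Lm1_mem c w h)
    have h3 : c + 1 + (K : ℂ) = c + ((K : ℕ) + 1 : ℕ) := by push_cast; ring
    rw [h1]
    rw [h3] at h2
    exact h2

/-- The extension of `L_W(-1)` to the algebraic completion `W̄`. -/
def Lm1bar {A : GRVA V} (M : GRMod V W A) (ω : WbarT M) : WbarT M := fun c =>
  ⟨M.Lm1 (ω (c - 1) : W), by
    have h := M.Lm1_mem (c - 1) _ (ω (c - 1)).2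
    have h2 : c - 1 + 1 = c := by ring
    rwa [h2] at h⟩

/-- The operator `e^{ζ L_W(-1)}` on the algebraic completion `W̄`, well defined
componentwise thanks to the shift of weights and lower truncation. -/
def expLm1 {A : GRVA V} (M : GRMod V W A) (ζ : ℂ) (ω : WbarT M) : WbarT M := fun c =>
  ∑ᶠ m : ℕ, ((ζ ^ m * ((m.factorial : ℂ))⁻¹) •
    (⟨(M.Lm1 ^ m) (ω (c - m) : W), by
        have h := Lm1_pow_mem M m (c - m) _ (ω (c - m)).2
        have h2 : c - (m : ℂ) + m = c := by ring
        rwa [h2] at h⟩ : M.grading c))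

lemma L0nil_mem {A : GRVA V} (M : GRMod V W A) (K : ℕ) (c : ℂ) (w : W)
    (h : w ∈ M.grading c) : ((M.L0 - c • 1) ^ K) w ∈ M.grading c := by
  induction K generalizing w with
  | zero => simpa using h
  | succ K ih =>
    have h1 : ((M.L0 - c • 1) ^ (K + 1)) w = ((M.L0 - c • 1) ^ K) ((M.L0 - c • 1) w) := by
      rw [pow_succ]; rfl
    rw [h1]
    apply ih
    have h2 : (M.L0 - c • 1) w = M.L0 w - c • w := by
      simp [LinearMap.sub_apply]
    rw [h2]
    exact Submodule.sub_mem _ (M.L0_mem c w h) (Submodule.smul_mem _ c h)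

/-- The operator `z^{L_W(0)} = e^{(log z)(L_W(0))_s} e^{(log z)(L_W(0)-(L_W(0))_s)}`
on the algebraic completion `W̄`, defined using the semisimple part (which acts on
`W_(c)` as multiplication by `c`) and the locally nilpotent part of `L_W(0)`. -/
def zL0bar {A : GRVA V} (M : GRMod V W A) (z : ℂ) (ω : WbarT M) : WbarT M := fun c =>
  Complex.exp (Complex.log z * c) •
    ∑ᶠ K : ℕ, (((Complex.log z) ^ K * ((K.factorial : ℂ))⁻¹) •
      (⟨((M.L0 - c • 1) ^ K) (ω c : W), L0nil_mem M K c _ (ω c).2⟩ : M.grading c))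

/-- The operator `z^{L_V(0)}` on `V` (semisimple, integral weights). -/
def zL0V (A : GRVA V) (z : ℂ) (v : V) : V :=
  letI := A.decomp
  ∑ᶠ k : ℤ, (z ^ k) • ((DirectSum.decompose A.grading v k : V))

/-! ## The `L(-1)`-derivative and `L(0)`-conjugation properties -/

/-- The `L(-1)`-derivative property for a cochain `Φ`. -/
def HasL1D {A : GRVA V} {M : GRMod V W A} {n : ℕ} (Φ : Cochain M n) : Prop :=
  (∀ (v : Fin n → V) (w' : W →ₗ[ℂ] ℂ), GradedFunctionalC M.grading w' →
    ∀ (i : Fin n) (z : Fin n → ℂ), (∀ s t, s ≠ t → z s ≠ z t) →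
      HasDerivAt (fun t => pairBar w' (Φ v (Function.update z i t)))
        (pairBar w' (Φ (Function.update v i (A.Lm1 (v i))) z)) (z i)) ∧
  (∀ (v : Fin n → V) (w' : W →ₗ[ℂ] ℂ), GradedFunctionalC M.grading w' →
    ∀ z : Fin n → ℂ, (∀ s t, s ≠ t → z s ≠ z t) →
      ∑ i : Fin n, pairBar w' (Φ (Function.update v i (A.Lm1 (v i))) z)
        = pairBar w' (Lm1bar M (Φ v z)))

/-- The `L(0)`-conjugation property for a cochain `Φ`. -/
def HasL0conj {A : GRVA V} {M : GRMod V W A} {n : ℕ} (Φ : Cochain M n) : Prop :=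
  ∀ (v : Fin n → V) (w' : W →ₗ[ℂ] ℂ), GradedFunctionalC M.grading w' →
    ∀ (z : ℂ) (zs : Fin n → ℂ), z ≠ 0 → (∀ s t, s ≠ t → zs s ≠ zs t) →
      pairBar w' (zL0bar M z (Φ v zs))
        = pairBar w' (Φ (fun i => zL0V A z (v i)) (fun i => z * zs i))
/-! ## Block embeddings -/

/-- Starting index of the `i`-th block of sizes `l`. -/
def blockStart {n : ℕ} (l : Fin n → ℕ) (i : Fin n) : ℕ :=
  ∑ j ∈ Finset.univ.filter (fun j => j < i), l j

lemma blockEmb_lt {n m : ℕ} (l : Fin n → ℕ) (hsum : ∑ i, l i = m) (i : Fin n)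
    (p : Fin (l i)) : blockStart l i + (p : ℕ) < m := by
  have hp : (p : ℕ) < l i := p.2
  have h2 : blockStart l i + l i ≤ m := by
    rw [← hsum]
    have hnotin : i ∉ Finset.univ.filter (fun j => j < i) := by simp
    have : blockStart l i + l i = ∑ j ∈ insert i (Finset.univ.filter (fun j => j < i)), l j := by
      rw [Finset.sum_insert hnotin, Nat.add_comm]; rfl
    rw [this]
    exact Finset.sum_le_sum_of_subset (by intro x _; simp)
  omega

/-- The embedding of the `p`-th position of the `i`-th block into `Fin m`,
where the blocks have sizes `l 0, …, l (n-1)` with `∑ l = m`. -/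
def blockEmb {n m : ℕ} (l : Fin n → ℕ) (hsum : ∑ i, l i = m) (i : Fin n)
    (p : Fin (l i)) : Fin m :=
  ⟨blockStart l i + (p : ℕ), blockEmb_lt l hsum i p⟩

/-! ## Composability with vertex operators -/

/-- `Φ : V^{⊗n} → W̃` is composable with `m` vertex operators (Definition 3.3):
the two families of series obtained by substituting products of vertex operators
acting on the vacuum into the arguments of `Φ` (condition 1) and by applying `m`
module vertex operators to the value of `Φ` (condition 2) converge absolutely in
the indicated regions to rational functions with only possible poles at
`z i = z j` of orders bounded by positive integers `N(v i, v j)` depending only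
on `v i` and `v j`.  The auxiliary `V̄`- and `W̄`-valued products are encoded by
families `EV`, `EW` satisfying `IsEVFam`, `IsEWFam`. -/
def Composable {A : GRVA V} {M : GRMod V W A}
    (EV : ∀ l : ℕ, (Fin l → V) → (Fin l → ℂ) → VbarT A)
    (EW : ∀ m : ℕ, (Fin m → V) → W → (Fin m → ℂ) → WbarT M)
    {n : ℕ} (m : ℕ) (Φ : Cochain M n) : Prop :=
  (∃ Nb : V → V → ℕ, (∀ a b, 0 < Nb a b) ∧
    ∀ (l : Fin n → ℕ), (∀ i, 0 < l i) → ∀ (hsum : ∑ i, l i = m + n)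
      (v : Fin (m + n) → V) (w' : W →ₗ[ℂ] ℂ), GradedFunctionalC M.grading w' →
    ∃ f : (Fin (m + n) → ℂ) → ℂ,
      RatDiagBnd (m + n) (fun s t => Nb (v s) (v t)) f ∧
      ∀ (ζ : Fin n → ℂ) (z : Fin (m + n) → ℂ),
        (∀ i j : Fin n, i ≠ j → ζ i ≠ ζ j) →
        (∀ i j : Fin n, i ≠ j → ∀ (p : Fin (l i)) (q : Fin (l j)),
          ‖z (blockEmb l hsum i p) - ζ i‖ + ‖z (blockEmb l hsum j q) - ζ j‖
            < ‖ζ i - ζ j‖) →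
        (∀ (i : Fin n) (p q : Fin (l i)), p ≠ q →
          z (blockEmb l hsum i p) ≠ z (blockEmb l hsum i q)) →
        HasSum (fun r : Fin n → ℤ =>
          pairBar w' (Φ (fun i =>
            ((EV (l i) (fun p => v (blockEmb l hsum i p))
              (fun p => z (blockEmb l hsum i p) - ζ i)) (r i) : V)) ζ)) (f z)) ∧
  (∃ Nb : V → V → ℕ, (∀ a b, 0 < Nb a b) ∧
    ∀ (v : Fin (m + n) → V) (w' : W →ₗ[ℂ] ℂ), GradedFunctionalC M.grading w' →
    ∃ f : (Fin (m + n) → ℂ) → ℂ,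
      RatDiagBnd (m + n) (fun s t => Nb (v s) (v t)) f ∧
      ∀ z : Fin (m + n) → ℂ, (∀ s t, s ≠ t → z s ≠ z t) →
        (∀ (i : Fin m) (j : Fin n), ‖z (Fin.castAdd n i)‖ > ‖z (Fin.natAdd m j)‖) →
        (∀ j : Fin n, z (Fin.natAdd m j) ≠ 0) →
        HasSum (fun q : ℂ =>
          pairBar w' (EW m (fun i => v (Fin.castAdd n i))
            ((Φ (fun j => v (Fin.natAdd m j)) (fun j => z (Fin.natAdd m j)) q : W))
            (fun i => z (Fin.castAdd n i)))) (f z))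

/-- `Ψ` realizes the composition `Φ ∘ (E^{(l₁)}_{V;𝟏} ⊗ ⋯ ⊗ E^{(lₙ)}_{V;𝟏})`,
defined through the absolutely convergent series of condition 1 of composability
and rational extension. -/
def IsCompE {A : GRVA V} {M : GRMod V W A}
    (EV : ∀ l : ℕ, (Fin l → V) → (Fin l → ℂ) → VbarT A)
    {n : ℕ} (Φ : Cochain M n) (m' : ℕ) (l : Fin n → ℕ) (hsum : ∑ i, l i = m')
    (Ψ : Cochain M m') : Prop :=
  ∀ (v : Fin m' → V) (w' : W →ₗ[ℂ] ℂ), GradedFunctionalC M.grading w' →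
    RatDiag m' (fun z => pairBar w' (Ψ v z)) ∧
    ∀ (ζ : Fin n → ℂ) (z : Fin m' → ℂ),
      (∀ i j : Fin n, i ≠ j → ζ i ≠ ζ j) →
      (∀ s t : Fin m', s ≠ t → z s ≠ z t) →
      (∀ i j : Fin n, i ≠ j → ∀ (p : Fin (l i)) (q : Fin (l j)),
        ‖z (blockEmb l hsum i p) - ζ i‖ + ‖z (blockEmb l hsum j q) - ζ j‖
          < ‖ζ i - ζ j‖) →
      HasSum (fun r : Fin n → ℤ =>
        pairBar w' (Φ (fun i =>
          ((EV (l i) (fun p => v (blockEmb l hsum i p))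
            (fun p => z (blockEmb l hsum i p) - ζ i)) (r i) : V)) ζ))
        (pairBar w' (Ψ v z))

/-- `Ψ` realizes the composition `E^{(p)}_W ∘_{p+1} Φ` (applying `p` module vertex
operators to the left of the value of `Φ`), defined through the absolutely
convergent series of condition 2 of composability and rational extension. -/
def IsCompW {A : GRVA V} {M : GRMod V W A}
    (EW : ∀ m : ℕ, (Fin m → V) → W → (Fin m → ℂ) → WbarT M)
    {n : ℕ} (Φ : Cochain M n) (p : ℕ) (Ψ : Cochain M (p + n)) : Prop :=
  ∀ (v : Fin (p + n) → V) (w' : W →ₗ[ℂ] ℂ), GradedFunctionalC M.grading w' →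
    RatDiag (p + n) (fun z => pairBar w' (Ψ v z)) ∧
    ∀ z : Fin (p + n) → ℂ, (∀ s t, s ≠ t → z s ≠ z t) →
      (∀ (i : Fin p) (j : Fin n), ‖z (Fin.castAdd n i)‖ > ‖z (Fin.natAdd p j)‖) →
      (∀ j : Fin n, z (Fin.natAdd p j) ≠ 0) →
      HasSum (fun q : ℂ =>
        pairBar w' (EW p (fun i => v (Fin.castAdd n i))
          ((Φ (fun j => v (Fin.natAdd p j)) (fun j => z (Fin.natAdd p j)) q : W))
          (fun i => z (Fin.castAdd n i)))) (pairBar w' (Ψ v z))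

/-- `Ψ` realizes the composition `E^{W;(m)}_{WV} ∘₀ Φ` (substituting the value of
`Φ` into the `W`-argument of `E^{W;(m)}_{WV} = E^{W;(1,m)}_{WV}(·)(0, ·)`). -/
def IsCompWV {A : GRVA V} {M : GRMod V W A}
    (G : ∀ m : ℕ, W → (Fin m → V) → (Fin (m + 1) → ℂ) → WbarT M)
    {n : ℕ} (Φ : Cochain M n) (m : ℕ) (Ψ : Cochain M (n + m)) : Prop :=
  ∀ (v : Fin (n + m) → V) (w' : W →ₗ[ℂ] ℂ), GradedFunctionalC M.grading w' →
    RatDiag (n + m) (fun z => pairBar w' (Ψ v z)) ∧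
    ∀ z : Fin (n + m) → ℂ, (∀ s t, s ≠ t → z s ≠ z t) →
      (∀ (j : Fin m) (i : Fin n), ‖z (Fin.natAdd n j)‖ > ‖z (Fin.castAdd m i)‖) →
      (∀ i : Fin n, z (Fin.castAdd m i) ≠ 0) →
      HasSum (fun q : ℂ =>
        pairBar w' (G m
          ((Φ (fun i => v (Fin.castAdd m i)) (fun i => z (Fin.castAdd m i)) q : W))
          (fun j => v (Fin.natAdd n j))
          (Fin.cons 0 (fun j => z (Fin.natAdd n j)))))
        (pairBar w' (Ψ v z))
/-! ## Shuffles -/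

/-- `σ ∈ J_{n;p}`: `σ` preserves the order of the first `p` positions and of the
last `n - p` positions (0-indexed). -/
def IsShuffle {n : ℕ} (p : ℕ) (σ : Equiv.Perm (Fin n)) : Prop :=
  (∀ s t : Fin n, s < t → (t : ℕ) < p → σ s < σ t) ∧
  (∀ s t : Fin n, s < t → p ≤ (s : ℕ) → σ s < σ t)

/-- The shuffle condition defining the subcomplex `C^n_•(V,W)`: for every
`1 ≤ p ≤ n-1` the signed sum over shuffles of the permuted cochains vanishes
on the configuration space. -/
def ShuffleVanish {A : GRVA V} {M : GRMod V W A} {n : ℕ} (Φ : Cochain M n) : Prop :=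
  ∀ p : ℕ, 1 ≤ p → p ≤ n - 1 →
    ∀ (v : Fin n → V) (z : Fin n → ℂ), (∀ s t, s ≠ t → z s ≠ z t) →
      ∑ σ ∈ Finset.univ.filter (fun σ : Equiv.Perm (Fin n) => IsShuffle p σ),
        ((Equiv.Perm.sign σ : ℤ) : ℂ) • (transport σ Φ) v z = 0

/-! ## The coboundary operator -/

lemma sum_delta_block (n : ℕ) (i : Fin n) :
    ∑ j : Fin n, (if j = i then 2 else 1) = n + 1 := by
  have h : ∀ j : Fin n, (if j = i then 2 else 1) = (if j = i then 1 else 0) + 1 := by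
    intro j; split <;> rfl
  simp only [h, Finset.sum_add_distrib, Finset.sum_ite_eq' Finset.univ i (fun _ => 1)]
  simp [Nat.add_comm]

/-- `Θ` is a realization of the coboundary
`δ̂ⁿ(Φ) = E^{(1)}_W ∘₂ Φ + ∑_{i=1}^n (-1)^i Φ ∘ᵢ E^{(2)}_{V;𝟏}
          + (-1)^{n+1} E^{W;(1)}_{WV} ∘₀ Φ`
on the configuration space, where the three kinds of compositions are encoded by
the predicates `IsCompW`, `IsCompE`, `IsCompWV`. -/
def IsDelta {A : GRVA V} {M : GRMod V W A}
    (EV : ∀ l : ℕ, (Fin l → V) → (Fin l → ℂ) → VbarT A)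
    (EW : ∀ m : ℕ, (Fin m → V) → W → (Fin m → ℂ) → WbarT M)
    (G : ∀ m : ℕ, W → (Fin m → V) → (Fin (m + 1) → ℂ) → WbarT M)
    {n : ℕ} (Φ : Cochain M n) (Θ : Cochain M (n + 1)) : Prop :=
  ∃ (Aw : Cochain M (1 + n)) (B : Fin n → Cochain M (n + 1)) (Cw : Cochain M (n + 1)),
    IsCompW EW Φ 1 Aw ∧
    (∀ i : Fin n, IsCompE EV Φ (n + 1) (fun j => if j = i then 2 else 1)
      (sum_delta_block n i) (B i)) ∧
    IsCompWV G Φ 1 Cw ∧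
    (∀ (v : Fin (n + 1) → V) (z : Fin (n + 1) → ℂ), (∀ s t, s ≠ t → z s ≠ z t) →
      Θ v z = (transport (finCongr (Nat.add_comm 1 n)) Aw) v z
        + (∑ i : Fin n, ((-1 : ℂ) ^ ((i : ℕ) + 1)) • B i) v z
        + (((-1 : ℂ) ^ (n + 1)) • Cw) v z)

/-- Membership in `Ĉⁿₘ(V,W)` (before imposing the shuffle condition):
`W̃`-valued rationality, the `L(-1)`-derivative and `L(0)`-conjugation properties,
and composability with `m` vertex operators. -/
def HatCmem {A : GRVA V} {M : GRMod V W A}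
    (EV : ∀ l : ℕ, (Fin l → V) → (Fin l → ℂ) → VbarT A)
    (EW : ∀ m : ℕ, (Fin m → V) → W → (Fin m → ℂ) → WbarT M)
    {n : ℕ} (m : ℕ) (Φ : Cochain M n) : Prop :=
  TakesRatValues Φ ∧ HasL1D Φ ∧ HasL0conj Φ ∧ Composable EV EW m Φ

/-- Membership in `Cⁿₘ(V,W)`: membership in `Ĉⁿₘ(V,W)` together with the
vanishing of all shuffle sums. -/
def Cmem {A : GRVA V} {M : GRMod V W A}
    (EV : ∀ l : ℕ, (Fin l → V) → (Fin l → ℂ) → VbarT A)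
    (EW : ∀ m : ℕ, (Fin m → V) → W → (Fin m → ℂ) → WbarT M)
    {n : ℕ} (m : ℕ) (Φ : Cochain M n) : Prop :=
  HatCmem EV EW m Φ ∧ ShuffleVanish Φ
/-! ## The extra second coboundary `δ̂²_{1/2}` -/

/-- The data of the two combined absolutely convergent series (and their rational
extensions `f`, `g`) entering the definition of `Ĉ²_{1/2}(V,W)` and of
`δ̂²_{1/2}` for a 2-cochain `Φ`, for fixed `v₁,v₂,v₃` and `w'`. -/
def HalfDeltaData {A : GRVA V} {M : GRMod V W A}
    (EV : ∀ l : ℕ, (Fin l → V) → (Fin l → ℂ) → VbarT A)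
    (En1 : ∀ m : ℕ, (Fin m → V) → W → (Fin (m + 1) → ℂ) → WbarT M)
    (G : ∀ m : ℕ, W → (Fin m → V) → (Fin (m + 1) → ℂ) → WbarT M)
    (Φ : Cochain M 2) (v : Fin 3 → V) (w' : W →ₗ[ℂ] ℂ)
    (f g : (Fin 3 → ℂ) → ℂ) : Prop :=
  RatFull 3 f ∧ RatFull 3 g ∧
  (∀ z₁ z₂ z₃ ζ : ℂ, ‖z₁ - ζ‖ > ‖z₂ - ζ‖ → ‖z₁ - ζ‖ > ‖z₃ - ζ‖ →
      z₂ ≠ ζ → z₃ ≠ ζ → z₂ ≠ z₃ → z₁ ≠ ζ →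
    HasSum (fun r : ℂ =>
      pairBar w' (En1 1 ![v 0] ((Φ ![v 1, v 2] ![z₂ - ζ, z₃ - ζ]) r : W) ![z₁, ζ])
      + pairBar w' (Φ ![v 0, VbarComp (EV 2 ![v 1, v 2] ![z₂ - ζ, z₃ - ζ]) r] ![z₁, ζ]))
      (f ![z₁, z₂, z₃])) ∧
  (∀ z₁ z₂ z₃ ζ : ℂ, ‖ζ - z₃‖ > ‖z₁ - ζ‖ → ‖ζ - z₃‖ > ‖z₂ - ζ‖ →
      z₁ ≠ ζ → z₂ ≠ ζ → z₁ ≠ z₂ → ζ ≠ z₃ →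
    HasSum (fun r : ℂ =>
      pairBar w' (Φ ![VbarComp (EV 2 ![v 0, v 1] ![z₁ - ζ, z₂ - ζ]) r, v 2] ![ζ, z₃])
      + pairBar w' (G 1 ((Φ ![v 0, v 1] ![z₁ - ζ, z₂ - ζ]) r : W) ![v 2] ![ζ, z₃]))
      (g ![z₁, z₂, z₃]))

/-- Membership in `Ĉ²_{1/2}(V,W)`: the two combined series converge absolutely to
rational functions with the only possible poles at `zᵢ = zⱼ` and `zᵢ = 0`. -/
def HalfComposable {A : GRVA V} {M : GRMod V W A}
    (EV : ∀ l : ℕ, (Fin l → V) → (Fin l → ℂ) → VbarT A)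
    (En1 : ∀ m : ℕ, (Fin m → V) → W → (Fin (m + 1) → ℂ) → WbarT M)
    (G : ∀ m : ℕ, W → (Fin m → V) → (Fin (m + 1) → ℂ) → WbarT M)
    (Φ : Cochain M 2) : Prop :=
  ∀ (v : Fin 3 → V) (w' : W →ₗ[ℂ] ℂ), GradedFunctionalC M.grading w' →
    ∃ f g : (Fin 3 → ℂ) → ℂ, HalfDeltaData EV En1 G Φ v w' f g

/-- `Ξ` realizes `δ̂²_{1/2}(Φ)`: the difference of the rational extensions of
the two combined series. -/
def IsDeltaHalf {A : GRVA V} {M : GRMod V W A}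
    (EV : ∀ l : ℕ, (Fin l → V) → (Fin l → ℂ) → VbarT A)
    (En1 : ∀ m : ℕ, (Fin m → V) → W → (Fin (m + 1) → ℂ) → WbarT M)
    (G : ∀ m : ℕ, W → (Fin m → V) → (Fin (m + 1) → ℂ) → WbarT M)
    (Φ : Cochain M 2) (Ξ : Cochain M 3) : Prop :=
  ∀ (v : Fin 3 → V) (w' : W →ₗ[ℂ] ℂ), GradedFunctionalC M.grading w' →
    ∃ f g : (Fin 3 → ℂ) → ℂ, HalfDeltaData EV En1 G Φ v w' f g ∧
      ∀ z : Fin 3 → ℂ, (∀ s t, s ≠ t → z s ≠ z t) →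
        pairBar w' (Ξ v z) = f z - g z

/-! ## Cocycles and coboundaries -/

/-- `Φ ∈ C^n_m(V,W)` is a cocycle: every realization of `δ̂ⁿₘ(Φ)` vanishes on the
configuration space. -/
def IsCocycle {A : GRVA V} {M : GRMod V W A}
    (EV : ∀ l : ℕ, (Fin l → V) → (Fin l → ℂ) → VbarT A)
    (EW : ∀ m : ℕ, (Fin m → V) → W → (Fin m → ℂ) → WbarT M)
    (G : ∀ m : ℕ, W → (Fin m → V) → (Fin (m + 1) → ℂ) → WbarT M)
    {n : ℕ} (m : ℕ) (Φ : Cochain M n) : Prop :=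
  Cmem EV EW m Φ ∧
    ∀ Θ : Cochain M (n + 1), IsDelta EV EW G Φ Θ →
      ∀ (v : Fin (n + 1) → V) (z : Fin (n + 1) → ℂ),
        (∀ s t, s ≠ t → z s ≠ z t) → Θ v z = 0

/-- `Φ` is a coboundary at level `m`: it agrees on the configuration space with a
realization of `δ̂ⁿ_{m+1}(Ψ)` for some `Ψ ∈ Cⁿ_{m+1}(V,W)`. -/
def IsCobound {A : GRVA V} {M : GRMod V W A}
    (EV : ∀ l : ℕ, (Fin l → V) → (Fin l → ℂ) → VbarT A)
    (EW : ∀ m : ℕ, (Fin m → V) → W → (Fin m → ℂ) → WbarT M)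
    (G : ∀ m : ℕ, W → (Fin m → V) → (Fin (m + 1) → ℂ) → WbarT M)
    {n : ℕ} (m : ℕ) (Φ : Cochain M (n + 1)) : Prop :=
  ∃ Ψ : Cochain M n, Cmem EV EW (m + 1) Ψ ∧
    ∃ Θ : Cochain M (n + 1), IsDelta EV EW G Ψ Θ ∧
      ∀ (v : Fin (n + 1) → V) (z : Fin (n + 1) → ℂ),
        (∀ s t, s ≠ t → z s ≠ z t) → Θ v z = Φ v z

section Torus
variable {ι : Type} [Fintype ι]

/-- The measure on the torus used in Mathlib for `mFourierLp`. -/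
abbrev torusMeasure (ι : Type) [Fintype ι] : MeasureTheory.Measure (UnitAddTorus ι) :=
  (@MeasureTheory.MeasureSpace.pi ι _ (fun _ => UnitAddCircle)
    fun _ => instMeasureSpaceUnitAddCircle).volume

instance : MeasureTheory.IsFiniteMeasure (torusMeasure ι) :=
  inferInstanceAs (MeasureTheory.IsFiniteMeasure
    (MeasureTheory.Measure.pi fun _ : ι => (AddCircle.haarAddCircle : MeasureTheory.Measure UnitAddCircle)))

theorem mFourier_coeff_eq_zero_of_hasSum (c : (ι → ℤ) → ℂ)
    (h : ∀ θ : UnitAddTorus ι, HasSum (fun k => c k * UnitAddTorus.mFourier k θ) 0) : c = 0 := by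
  have hs : Summable (fun k => ‖c k‖) := by
    have := (h 0).summable.norm
    simpa [UnitAddTorus.mFourier] using this
  have hs2 : Summable (fun k => c k • UnitAddTorus.mFourier (d := ι) k) := by
    apply Summable.of_norm
    simpa [norm_smul, UnitAddTorus.mFourier_norm] using hs
  obtain ⟨f, hf⟩ := hs2
  have hf0 : f = 0 := by
    ext θ
    have h1 := (ContinuousMap.evalCLM ℂ θ).hasSum hf
    have h2 := h θ
    exact h1.unique (by simpa [Function.comp_def] using h2)
  subst hf0
  have h1 := (ContinuousMap.toLp (E := ℂ) 2 (torusMeasure ι) ℂ).hasSum hf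
  funext m
  have h2 := h1.mapL (innerSL ℂ (UnitAddTorus.mFourierLp (d := ι) 2 m))
  have h3 := (UnitAddTorus.orthonormal_mFourier (d := ι))
  rw [orthonormal_iff_ite] at h3
  have h4 : ∀ k, (innerSL ℂ (UnitAddTorus.mFourierLp (d := ι) 2 m))
     ((ContinuousMap.toLp (E := ℂ) 2 (torusMeasure ι) ℂ)
       (c k • UnitAddTorus.mFourier k)) = if k = m then c m else 0 := by
    intro k
    rw [map_smul, map_smul]
    have := h3 m k
    unfold UnitAddTorus.mFourierLp at this
    simp only [innerSL_apply_apply]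
    unfold UnitAddTorus.mFourierLp
    rw [this]
    by_cases hk : m = k
    · subst hk; simp
    · simp [hk, Ne.symm hk]
  simp only [h4] at h2
  have h5 := h2.unique (hasSum_ite_eq m (c m))
  simpa using h5.symm

/-- The monomial `∏ z_t ^ k_t` with integer exponents. -/
def zmon (z : ι → ℂ) (k : ι → ℤ) : ℂ := ∏ t, z t ^ k t

lemma zmon_add (z : ι → ℂ) (hz : ∀ t, z t ≠ 0) (k l : ι → ℤ) :
    zmon z (k + l) = zmon z k * zmon z l := by
  simp [zmon, zpow_add₀ (hz _), Finset.prod_mul_distrib]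

lemma zmon_natCast (z : ι → ℂ) (k : ι → ℕ) :
    zmon z (fun t => (k t : ℤ)) = ∏ t, z t ^ k t := by
  simp [zmon]

theorem laurent_coeff_eq_zero (ρ : ι → ℝ) (hρ : ∀ t, 0 < ρ t) (c : (ι → ℤ) → ℂ)
    (h : ∀ z : ι → ℂ, (∀ t, ‖z t‖ = ρ t) → HasSum (fun k => c k * zmon z k) 0) : c = 0 := by
  have key : (fun k => c k * zmon (fun t => (ρ t : ℂ)) k) = 0 := by
    apply mFourier_coeff_eq_zero_of_hasSum
    intro θ
    have := h (fun t => ρ t * fourier 1 (θ t)) (by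
      intro t
      simp [abs_of_pos (hρ t), Circle.norm_coe])
    convert this using 2 with k
    rw [mul_assoc]
    congr 1
    simp only [zmon, mul_zpow, Finset.prod_mul_distrib]
    congr 1
    simp only [UnitAddTorus.mFourier, ContinuousMap.coe_mk]
    refine Finset.prod_congr rfl fun t _ => ?_
    simp [fourier_apply, AddCircle.toCircle_zsmul]
  funext k
  have h1 := congrFun key k
  have h2 : zmon (fun t => (ρ t : ℂ)) k ≠ 0 := by
    simp only [zmon]
    exact Finset.prod_ne_zero_iff.mpr fun t _ => zpow_ne_zero _ (by simpa using (hρ t).ne')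
  simpa [h2] using h1

/-- Comparison of Laurent coefficients in a finite linear relation, with monomial coefficients,
between convergent multivariable Laurent series. -/
theorem laurent_coeff_relation (ρ : ι → ℝ) (hρ : ∀ t, 0 < ρ t) {α β : Type}
    (s : Finset α) (a : α → ℂ) (e : α → ι → ℤ) (F : α → (ι → ℂ) → ℂ) (c : α → (ι → ℤ) → ℂ)
    (hF : ∀ i ∈ s, ∀ z : ι → ℂ, (∀ t, ‖z t‖ = ρ t) → HasSum (fun k => c i k * zmon z k) (F i z))
    (s' : Finset β) (b : β → ℂ) (e' : β → ι → ℤ)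
    (hrel : ∀ z : ι → ℂ, (∀ t, ‖z t‖ = ρ t) →
      ∑ i ∈ s, a i * zmon z (e i) * F i z = ∑ j ∈ s', b j * zmon z (e' j)) (n : ι → ℤ) :
    ∑ i ∈ s, a i * c i (n - e i) = ∑ j ∈ s', if e' j = n then b j else 0 := by
  have key : (fun n => ∑ i ∈ s, a i * c i (n - e i) - ∑ j ∈ s', if e' j = n then b j else 0)
      = (0 : (ι → ℤ) → ℂ) := by
    apply laurent_coeff_eq_zero ρ hρ
    intro z hz
    have hz0 : ∀ t, z t ≠ 0 := fun t ht => by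
      have := hz t; rw [ht, norm_zero] at this; exact (hρ t).ne this
    have h1 : HasSum (fun n => ∑ i ∈ s, (a i * c i (n - e i)) * zmon z n)
        (∑ i ∈ s, a i * zmon z (e i) * F i z) := by
      apply hasSum_sum
      intro i hi
      have := (hF i hi z hz).mul_left (a i * zmon z (e i))
      rw [← (Equiv.subRight (e i)).hasSum_iff] at this
      refine this.congr_fun fun n => ?_
      have h2 : zmon z n = zmon z (n - e i) * zmon z (e i) := by
        rw [← zmon_add z hz0, sub_add_cancel]
      simp only [Function.comp, Equiv.subRight_apply]
      rw [h2]; ring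
    have h2 : HasSum (fun n => ∑ j ∈ s', (if e' j = n then b j else 0) * zmon z n)
        (∑ j ∈ s', b j * zmon z (e' j)) := by
      apply hasSum_sum
      intro j hj
      have := hasSum_ite_eq (e' j) (b j * zmon z (e' j))
      convert this using 2 with n
      by_cases hn : e' j = n
      · subst hn; simp
      · simp [hn, Ne.symm hn]
    have h3 := h1.sub h2
    rw [hrel z hz, sub_self] at h3
    have h4 : (fun n => (∑ i ∈ s, a i * c i (n - e i) - ∑ j ∈ s', if e' j = n then b j else 0)
        * zmon z n) = fun n => ∑ i ∈ s, (a i * c i (n - e i)) * zmon z n -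
        ∑ j ∈ s', (if e' j = n then b j else 0) * zmon z n := by
      funext n
      rw [sub_mul, Finset.sum_mul, Finset.sum_mul]
    rw [h4]
    exact h3
  exact sub_eq_zero.mp (congrFun key n)

end Torus

section Formal
variable {ι : Type}

/-- The exponent vector of a monomial, with integer entries. -/
def zexp (d : ι →₀ ℕ) : ι → ℤ := fun t => (d t : ℤ)

lemma zexp_add (d e : ι →₀ ℕ) : zexp (d + e) = zexp d + zexp e := by
  funext t; simp [zexp]

@[simp] lemma zexp_zero : zexp (0 : ι →₀ ℕ) = 0 := by funext t; simp [zexp]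

lemma zexp_injective : Function.Injective (zexp (ι := ι)) := by
  intro d e h; ext t; simpa [zexp] using congrFun h t

/-- The action of polynomials on formal distributions, given by their coefficients. -/
def mop (D : MvPolynomial ι ℂ) (C : (ι → ℤ) → ℂ) : (ι → ℤ) → ℂ := fun n =>
  ∑ d ∈ D.support, D.coeff d * C (n - zexp d)

lemma mop_eq_sum (D : MvPolynomial ι ℂ) (C : (ι → ℤ) → ℂ) (n : ι → ℤ) {s : Finset (ι →₀ ℕ)}
    (hs : D.support ⊆ s) : mop D C n = ∑ d ∈ s, D.coeff d * C (n - zexp d) := by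
  refine Finset.sum_subset hs fun d _ hd => ?_
  rw [MvPolynomial.notMem_support_iff.mp hd, zero_mul]

lemma mop_add_left (D E : MvPolynomial ι ℂ) (C : (ι → ℤ) → ℂ) :
    mop (D + E) C = mop D C + mop E C := by
  funext n
  rw [Pi.add_apply, mop_eq_sum (D + E) C n MvPolynomial.support_add,
    mop_eq_sum D C n Finset.subset_union_left, mop_eq_sum E C n Finset.subset_union_right,
    ← Finset.sum_add_distrib]
  simp [add_mul]

lemma mop_add_right (D : MvPolynomial ι ℂ) (C C' : (ι → ℤ) → ℂ) :
    mop D (C + C') = mop D C + mop D C' := by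
  funext n
  simp [mop, mul_add, Finset.sum_add_distrib]

lemma mop_sub_right (D : MvPolynomial ι ℂ) (C C' : (ι → ℤ) → ℂ) :
    mop D (C - C') = mop D C - mop D C' := by
  funext n
  simp [mop, mul_sub, Finset.sum_sub_distrib]

@[simp] lemma mop_zero_right (D : MvPolynomial ι ℂ) : mop D 0 = 0 := by
  funext n
  simp [mop]

lemma mop_monomial (e : ι →₀ ℕ) (a : ℂ) (C : (ι → ℤ) → ℂ) (n : ι → ℤ) :
    mop (MvPolynomial.monomial e a) C n = a * C (n - zexp e) := by
  rw [mop_eq_sum _ C n MvPolynomial.support_monomial_subset]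
  simp

lemma mop_mul (D E : MvPolynomial ι ℂ) (C : (ι → ℤ) → ℂ) : mop (D * E) C = mop D (mop E C) := by
  induction D using MvPolynomial.induction_on' with
  | add p q hp hq => rw [add_mul, mop_add_left, mop_add_left, hp, hq]
  | monomial u a =>
    induction E using MvPolynomial.induction_on' with
    | add p q hp hq => rw [mul_add, mop_add_left, mop_add_left, mop_add_right, hp, hq]
    | monomial w b =>
      funext n
      rw [MvPolynomial.monomial_mul, mop_monomial, mop_monomial, mop_monomial, zexp_add, mul_assoc,
        sub_sub]

lemma mop_comm (D E : MvPolynomial ι ℂ) (C : (ι → ℤ) → ℂ) :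
    mop D (mop E C) = mop E (mop D C) := by
  rw [← mop_mul, mul_comm, mop_mul]

/-- A polynomial seen as a formal distribution. -/
def emb (P : MvPolynomial ι ℂ) : (ι → ℤ) → ℂ := fun n =>
  ∑ d ∈ P.support, if zexp d = n then P.coeff d else 0

lemma emb_eq_mop (P : MvPolynomial ι ℂ) : emb P = mop P (Pi.single 0 1) := by
  funext n
  unfold emb mop
  refine Finset.sum_congr rfl fun d _ => ?_
  by_cases h : zexp d = n
  · subst h; simp
  · have : n - zexp d ≠ 0 := fun h' => h (sub_eq_zero.mp h').symm
    simp [h, this]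

lemma emb_mul (D P : MvPolynomial ι ℂ) : emb (D * P) = mop D (emb P) := by
  rw [emb_eq_mop, mop_mul, ← emb_eq_mop]

lemma emb_add (D P : MvPolynomial ι ℂ) : emb (D + P) = emb D + emb P := by
  simp only [emb_eq_mop, mop_add_left]

lemma emb_zexp (P : MvPolynomial ι ℂ) (d : ι →₀ ℕ) : emb P (zexp d) = P.coeff d := by
  unfold emb
  simp only [zexp_injective.eq_iff]
  rw [Finset.sum_ite_eq' ]
  split_ifs with h
  · rfl
  · exact (MvPolynomial.notMem_support_iff.mp h).symm

lemma emb_injective : Function.Injective (emb (ι := ι)) := by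
  intro P Q h
  ext d
  rw [← emb_zexp, ← emb_zexp, h]

lemma emb_finite (P : MvPolynomial ι ℂ) (n : ι → ℤ) (h : emb P n ≠ 0) :
    ∃ d ∈ P.support, zexp d = n := by
  by_contra! h'
  exact h (Finset.sum_eq_zero fun d hd => if_neg (h' d hd))

lemma emb_sub (D P : MvPolynomial ι ℂ) : emb (D - P) = emb D - emb P := by
  rw [eq_sub_iff_add_eq, ← emb_add, sub_add_cancel]

variable [Fintype ι]

lemma eval_eq_zmon (P : MvPolynomial ι ℂ) (z : ι → ℂ) :
    MvPolynomial.eval z P = ∑ d ∈ P.support, P.coeff d * zmon z (zexp d) := by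
  rw [MvPolynomial.eval_eq']
  refine Finset.sum_congr rfl fun d _ => ?_
  unfold zexp
  rw [zmon_natCast]

/-- A functional equation with polynomial coefficients on a torus translates to coefficients. -/
theorem mop_eq_emb_of_torus (ρ : ι → ℝ) (hρ : ∀ t, 0 < ρ t) (D P : MvPolynomial ι ℂ)
    (C : (ι → ℤ) → ℂ) (F : (ι → ℂ) → ℂ)
    (hF : ∀ z : ι → ℂ, (∀ t, ‖z t‖ = ρ t) → HasSum (fun k => C k * zmon z k) (F z))
    (h : ∀ z : ι → ℂ, (∀ t, ‖z t‖ = ρ t) → F z * MvPolynomial.eval z D = MvPolynomial.eval z P) :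
    mop D C = emb P := by
  funext n
  unfold mop emb
  convert laurent_coeff_relation ρ hρ D.support D.coeff zexp (fun _ => F) (fun _ => C)
    (fun _ _ => hF) P.support P.coeff zexp (fun z hz => ?_) n
  rw [← eval_eq_zmon, ← h z hz, eval_eq_zmon, Finset.mul_sum]
  exact Finset.sum_congr rfl fun _ _ => by ring

end Formal

section RatOn
variable {ι κ : Type}

/-- `f` agrees on `U` with a rational function without poles in `U`. -/
def RatOn (U : Set (ι → ℂ)) (f : (ι → ℂ) → ℂ) : Prop :=
  ∃ D P : MvPolynomial ι ℂ, (∀ x ∈ U, MvPolynomial.eval x D ≠ 0) ∧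
    ∀ x ∈ U, f x * MvPolynomial.eval x D = MvPolynomial.eval x P

lemma RatOn.poly {U : Set (ι → ℂ)} (P : MvPolynomial ι ℂ) :
    RatOn U (fun x => MvPolynomial.eval x P) := ⟨1, P, by simp, by simp⟩

lemma RatOn.const {U : Set (ι → ℂ)} (a : ℂ) : RatOn U (fun _ => a) :=
  ⟨1, MvPolynomial.C a, by simp, by simp⟩

lemma RatOn.add {U : Set (ι → ℂ)} {f g : (ι → ℂ) → ℂ} (hf : RatOn U f) (hg : RatOn U g) :
    RatOn U (fun x => f x + g x) := by
  obtain ⟨D, P, h1, h2⟩ := hf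
  obtain ⟨E, Q, h3, h4⟩ := hg
  refine ⟨D * E, P * E + Q * D, fun x hx => ?_, fun x hx => ?_⟩
  · simpa using ⟨h1 x hx, h3 x hx⟩
  · simp only [map_mul, map_add, ← h2 x hx, ← h4 x hx]; ring

lemma RatOn.mul {U : Set (ι → ℂ)} {f g : (ι → ℂ) → ℂ} (hf : RatOn U f) (hg : RatOn U g) :
    RatOn U (fun x => f x * g x) := by
  obtain ⟨D, P, h1, h2⟩ := hf
  obtain ⟨E, Q, h3, h4⟩ := hg
  refine ⟨D * E, P * Q, fun x hx => ?_, fun x hx => ?_⟩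
  · simpa using ⟨h1 x hx, h3 x hx⟩
  · simp only [map_mul, ← h2 x hx, ← h4 x hx]; ring

lemma RatOn.sub {U : Set (ι → ℂ)} {f g : (ι → ℂ) → ℂ} (hf : RatOn U f) (hg : RatOn U g) :
    RatOn U (fun x => f x - g x) := by
  have := hf.add ((RatOn.const (-1)).mul hg)
  simpa [sub_eq_add_neg] using this

lemma RatOn.sum {α : Type} {U : Set (ι → ℂ)} (s : Finset α) {f : α → (ι → ℂ) → ℂ}
    (hf : ∀ i ∈ s, RatOn U (f i)) : RatOn U (fun x => ∑ i ∈ s, f i x) := by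
  induction s using Finset.induction_on with
  | empty => simpa using RatOn.const 0
  | insert a s ha ih =>
    simp only [Finset.sum_insert ha]
    exact (hf a (by simp)).add (ih fun i hi => hf i (by simp [hi]))

lemma RatOn.congr {U : Set (ι → ℂ)} {f g : (ι → ℂ) → ℂ} (hf : RatOn U f)
    (h : ∀ x ∈ U, g x = f x) : RatOn U g := by
  obtain ⟨D, P, h1, h2⟩ := hf
  exact ⟨D, P, h1, fun x hx => by rw [h x hx, h2 x hx]⟩

lemma RatOn.comp {U : Set (ι → ℂ)} {U' : Set (κ → ℂ)} {f : (ι → ℂ) → ℂ} (hf : RatOn U f)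
    (p : ι → MvPolynomial κ ℂ)
    (hp : ∀ y ∈ U', (fun i => MvPolynomial.eval y (p i)) ∈ U) :
    RatOn U' (fun y => f (fun i => MvPolynomial.eval y (p i))) := by
  obtain ⟨D, P, h1, h2⟩ := hf
  have key : ∀ (Q : MvPolynomial ι ℂ) (y : κ → ℂ), MvPolynomial.eval y (MvPolynomial.bind₁ p Q) =
      MvPolynomial.eval (fun i => MvPolynomial.eval y (p i)) Q := by
    intro Q y
    simp only [← MvPolynomial.coe_aeval_eq_eval, RingHom.coe_coe, MvPolynomial.aeval_bind₁]
  refine ⟨MvPolynomial.bind₁ p D, MvPolynomial.bind₁ p P, fun y hy => ?_, fun y hy => ?_⟩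
  · rw [key]; exact h1 _ (hp y hy)
  · rw [key, key]; exact h2 _ (hp y hy)

lemma infinite_norm_eq {r : ℝ} (hr : 0 < r) : {z : ℂ | ‖z‖ = r}.Infinite := by
  have h1 : Set.InjOn (fun t : ℝ => (r : ℂ) * Complex.exp (t * Complex.I)) (Set.Ioc (-Real.pi) Real.pi) := by
    intro s hs t ht h
    have h2 := mul_left_cancel₀ (by simpa using hr.ne') h
    have := congrArg Complex.arg h2
    rwa [Complex.arg_exp_mul_I, Complex.arg_exp_mul_I, toIocMod_eq_self _ |>.mpr (by constructor <;> linarith [hs.1, hs.2]),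
      toIocMod_eq_self _ |>.mpr (by constructor <;> linarith [ht.1, ht.2])] at this
  refine Set.Infinite.mono ?_ ((Set.Ioc_infinite (by linarith [Real.pi_pos])).image h1)
  rintro _ ⟨t, _, rfl⟩
  simp [Complex.norm_exp_ofReal_mul_I, abs_of_pos hr]

lemma mvPolynomial_eq_of_torus (ρ : ι → ℝ) (hρ : ∀ t, 0 < ρ t) (P Q : MvPolynomial ι ℂ)
    (h : ∀ z : ι → ℂ, (∀ t, ‖z t‖ = ρ t) → MvPolynomial.eval z P = MvPolynomial.eval z Q) :
    P = Q := by
  refine MvPolynomial.funext_set (fun t => {z : ℂ | ‖z‖ = ρ t}) (fun t => infinite_norm_eq (hρ t)) ?_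
  intro z hz
  exact h z fun t => hz t (Set.mem_univ t)

lemma RatOn.eq_of_torus {U : Set (ι → ℂ)} {f g : (ι → ℂ) → ℂ} (hf : RatOn U f) (hg : RatOn U g)
    (ρ : ι → ℝ) (hρ : ∀ t, 0 < ρ t) (hU : ∀ z : ι → ℂ, (∀ t, ‖z t‖ = ρ t) → z ∈ U)
    (h : ∀ z : ι → ℂ, (∀ t, ‖z t‖ = ρ t) → f z = g z) {x : ι → ℂ} (hx : x ∈ U) : f x = g x := by
  obtain ⟨D, P, h1, h2⟩ := hf.sub hg
  have h3 : P = 0 := by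
    refine mvPolynomial_eq_of_torus ρ hρ P 0 fun z hz => ?_
    rw [← h2 z (hU z hz)]; simp [h z hz]
  have h4 := h2 x hx
  rw [h3, map_zero, mul_eq_zero] at h4
  exact sub_eq_zero.mp (h4.resolve_right (h1 x hx))

end RatOn

section Expansion

/-- The inclusion of polynomials into Laurent series. -/
def polyL : Polynomial ℂ →+* LaurentSeries ℂ :=
  (HahnSeries.ofPowerSeries ℤ ℂ).comp Polynomial.coeToPowerSeries.ringHom

lemma polyL_monomial (d : ℕ) (a : ℂ) :
    polyL (Polynomial.monomial d a) = HahnSeries.single (d : ℤ) a := by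
  rw [← Polynomial.C_mul_X_pow_eq_monomial]
  simp [polyL, HahnSeries.C_apply, HahnSeries.single_mul_single]

lemma polyL_injective : Function.Injective polyL := by
  refine (HahnSeries.ofPowerSeries_injective).comp (Polynomial.coe_injective ℂ)

open Filter Topology

/-- The Laurent series `h` is the expansion at `0` of the germ of rational function `F`. -/
def ExpandsTo (F : ℂ → ℂ) (h : LaurentSeries ℂ) : Prop :=
  ∃ D P : Polynomial ℂ, D ≠ 0 ∧ (∀ᶠ b in 𝓝[≠] (0 : ℂ), F b * D.eval b = P.eval b) ∧
    polyL D * h = polyL P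

lemma polynomial_eq_of_eventually {P Q : Polynomial ℂ}
    (h : ∀ᶠ b in 𝓝[≠] (0 : ℂ), P.eval b = Q.eval b) : P = Q := by
  apply Polynomial.eq_of_infinite_eval_eq
  intro hfin
  exact infinite_of_mem_nhds (0 : ℂ) (insert_mem_nhds_iff.mpr h) (hfin.insert 0)

lemma ExpandsTo.unique {F G : ℂ → ℂ} {h g : LaurentSeries ℂ} (hF : ExpandsTo F h)
    (hG : ExpandsTo G g) (hFG : ∀ᶠ b in 𝓝[≠] (0 : ℂ), F b = G b) : h = g := by
  obtain ⟨D, P, hD, h1, h2⟩ := hF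
  obtain ⟨E, Q, hE, h3, h4⟩ := hG
  have h5 : P * E = Q * D := by
    apply polynomial_eq_of_eventually
    filter_upwards [h1, h3, hFG] with b e1 e2 e3
    rw [Polynomial.eval_mul, Polynomial.eval_mul, ← e1, ← e2, e3]; ring
  have h6 : polyL D * polyL E * h = polyL D * polyL E * g := by
    calc _ = polyL (P * E) := by rw [map_mul, ← h2]; ring
      _ = _ := by rw [h5, map_mul, ← h4]; ring
  refine mul_left_cancel₀ (mul_ne_zero ?_ ?_) h6
  · rwa [Ne, ← map_zero polyL, polyL_injective.eq_iff]
  · rwa [Ne, ← map_zero polyL, polyL_injective.eq_iff]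

lemma ExpandsTo.poly (P : Polynomial ℂ) : ExpandsTo (fun b => P.eval b) (polyL P) :=
  ⟨1, P, one_ne_zero, by simp, by simp⟩

lemma ExpandsTo.poly_mul {F : ℂ → ℂ} {h : LaurentSeries ℂ} (hF : ExpandsTo F h)
    (Q : Polynomial ℂ) : ExpandsTo (fun b => Q.eval b * F b) (polyL Q * h) := by
  obtain ⟨D, P, hD, h1, h2⟩ := hF
  refine ⟨D, Q * P, hD, ?_, ?_⟩
  · filter_upwards [h1] with b e1
    rw [Polynomial.eval_mul, ← e1]; ring
  · rw [map_mul, ← h2]; ring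

lemma ExpandsTo.add {F G : ℂ → ℂ} {h g : LaurentSeries ℂ} (hF : ExpandsTo F h)
    (hG : ExpandsTo G g) : ExpandsTo (fun b => F b + G b) (h + g) := by
  obtain ⟨D, P, hD, h1, h2⟩ := hF
  obtain ⟨E, Q, hE, h3, h4⟩ := hG
  refine ⟨D * E, P * E + Q * D, mul_ne_zero hD hE, ?_, ?_⟩
  · filter_upwards [h1, h3] with b e1 e2
    simp only [Polynomial.eval_mul, Polynomial.eval_add, ← e1, ← e2]; ring
  · simp only [map_mul, map_add, ← h2, ← h4]; ring

lemma ExpandsTo.sum {α : Type} (s : Finset α) {F : α → ℂ → ℂ} {h : α → LaurentSeries ℂ}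
    (hF : ∀ i ∈ s, ExpandsTo (F i) (h i)) :
    ExpandsTo (fun b => ∑ i ∈ s, F i b) (∑ i ∈ s, h i) := by
  induction s using Finset.induction_on with
  | empty => simpa using ExpandsTo.poly 0
  | insert a s ha ih =>
    simp only [Finset.sum_insert ha]
    exact (hF a (by simp)).add (ih fun i hi => hF i (by simp [hi]))

lemma ExpandsTo.congr {F G : ℂ → ℂ} {h : LaurentSeries ℂ} (hF : ExpandsTo F h)
    (hFG : ∀ᶠ b in 𝓝[≠] (0 : ℂ), G b = F b) : ExpandsTo G h := by
  obtain ⟨D, P, hD, h1, h2⟩ := hF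
  refine ⟨D, P, hD, ?_, h2⟩
  filter_upwards [h1, hFG] with b e1 e2
  rw [e2, e1]

lemma ExpandsTo.const_mul {F : ℂ → ℂ} {h : LaurentSeries ℂ} (hF : ExpandsTo F h) (a : ℂ) :
    ExpandsTo (fun b => a * F b) (a • h) := by
  have := hF.poly_mul (Polynomial.C a)
  simpa [← Polynomial.monomial_zero_left, polyL_monomial, HahnSeries.single_zero_mul_eq_smul] using this

/-- Comparing coefficients in a relation between expandable germs. -/
lemma ExpandsTo.coeff_relation {α β : Type} (s : Finset α) (a : α → ℂ) (d : α → ℕ)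
    (F : α → ℂ → ℂ) (h : α → LaurentSeries ℂ) (hF : ∀ i ∈ s, ExpandsTo (F i) (h i))
    (s' : Finset β) (c : β → ℂ) (e : β → ℕ)
    (hrel : ∀ᶠ b in 𝓝[≠] (0 : ℂ), ∑ i ∈ s, a i * b ^ d i * F i b = ∑ j ∈ s', c j * b ^ e j)
    (T : ℤ) : ∑ i ∈ s, a i * (h i).coeff (T - d i) = ∑ j ∈ s', if (e j : ℤ) = T then c j else 0 := by
  have h1 := ExpandsTo.sum s fun i hi => (hF i hi).poly_mul (Polynomial.monomial (d i) (a i))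
  have h2 := ExpandsTo.poly (∑ j ∈ s', Polynomial.monomial (e j) (c j))
  have h3 := h1.unique h2 (by
    filter_upwards [hrel] with b hb
    simpa [Polynomial.eval_finsetSum] using hb)
  have h4 := congrArg (fun x : LaurentSeries ℂ => x.coeff T) h3
  simp only [map_sum, polyL_monomial, HahnSeries.coeff_sum] at h4
  convert h4 using 2 with i hi j hj
  · conv_rhs => rw [← sub_add_cancel T (d i : ℤ)]
    rw [HahnSeries.coeff_single_mul_add]
  · rw [HahnSeries.coeff_single]; simp [eq_comm]

end Expansion

section Grading
variable {V W : Type} [AddCommGroup V] [Module ℂ V] [AddCommGroup W] [Module ℂ W]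

/-- The projection onto a homogeneous component. -/
def gproj (A : GRVA V) (k : ℤ) : V →ₗ[ℂ] V :=
  letI := A.decomp
  (A.grading k).subtype ∘ₗ DirectSum.component ℂ ℤ (fun i => A.grading i) k ∘ₗ
    (DirectSum.decomposeLinearEquiv A.grading).toLinearMap

lemma gproj_mem (A : GRVA V) (k : ℤ) (u : V) : gproj A k u ∈ A.grading k := by
  simp [gproj]

lemma gproj_of_mem (A : GRVA V) {k : ℤ} {u : V} (h : u ∈ A.grading k) (j : ℤ) :
    gproj A j u = if j = k then u else 0 := by
  let _ := A.decomp
  change ((DirectSum.decompose A.grading u j : A.grading j) : V) = _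
  split_ifs with hj
  · subst hj; exact DirectSum.decompose_of_mem_same _ h
  · exact DirectSum.decompose_of_mem_ne _ h (Ne.symm hj)

lemma exists_sum_gproj (A : GRVA V) (u : V) : ∃ s : Finset ℤ, u = ∑ k ∈ s, gproj A k u := by
  let _ := A.decomp
  exact ⟨_, (DirectSum.sum_support_decompose A.grading u).symm⟩

lemma ext_gproj (A : GRVA V) {u w : V} (h : ∀ k, gproj A k u = gproj A k w) : u = w := by
  let _ := A.decomp
  apply (DirectSum.decompose A.grading).injective
  refine DFinsupp.ext fun k => Subtype.ext (h k)

lemma gproj_L0 (A : GRVA V) (k : ℤ) (u : V) : gproj A k (A.L0 u) = (k : ℂ) • gproj A k u := by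
  obtain ⟨s, hs⟩ := exists_sum_gproj A u
  have h1 : A.L0 u = ∑ j ∈ s, (j : ℂ) • gproj A j u := by
    conv_lhs => rw [hs]
    rw [map_sum]
    exact Finset.sum_congr rfl fun j _ => A.L0_eq j _ (gproj_mem A j u)
  rw [h1]
  conv_rhs => rw [hs]
  rw [map_sum, map_sum, Finset.smul_sum]
  refine Finset.sum_congr rfl fun j _ => ?_
  rw [map_smul, gproj_of_mem A (gproj_mem A j u)]
  split_ifs with h
  · rw [h]
  · simp

lemma mem_of_L0_eq (A : GRVA V) (c : ℤ) (u : V) (h : A.L0 u = (c : ℂ) • u) : u ∈ A.grading c := by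
  have : u = gproj A c u := by
    apply ext_gproj A
    intro k
    rw [gproj_of_mem A (gproj_mem A c u)]
    split_ifs with hk
    · rw [hk]
    · have h1 := gproj_L0 A k u
      rw [h, map_smul] at h1
      have h2 : ((c : ℂ) - k) • gproj A k u = 0 := by rw [sub_smul, h1, sub_self]
      refine (smul_eq_zero.mp h2).resolve_left ?_
      intro h3
      exact hk (by exact_mod_cast (sub_eq_zero.mp h3).symm)
  rw [this]; exact gproj_mem A c u

lemma Y_mem (A : GRVA V) {a b : ℤ} {u w : V} (hu : u ∈ A.grading a) (hw : w ∈ A.grading b)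
    (k : ℤ) : A.Y u w k ∈ A.grading (a + b - k - 1) := by
  apply mem_of_L0_eq
  rw [A.L0_bracket, A.L0_eq a u hu, A.L0_eq b w hw]
  simp only [map_smul, LinearMap.smul_apply, Pi.smul_apply, ← add_smul]
  congr 1
  push_cast; ring

lemma Lm1_mem_grading (A : GRVA V) {a : ℤ} {u : V} (hu : u ∈ A.grading a) :
    A.Lm1 u ∈ A.grading (a + 1) := by
  rw [A.Lm1_eq]
  have := Y_mem A hu A.vacuum_mem (-2)
  convert this using 2; ring

/-- The operator `u_k`. -/
def modeY (A : GRVA V) (u : V) (k : ℤ) : V →ₗ[ℂ] V := LinearMap.proj k ∘ₗ A.Y u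

@[simp] lemma modeY_apply (A : GRVA V) (u w : V) (k : ℤ) : modeY A u k w = A.Y u w k := rfl

lemma GradedFunctionalZ.comp_mode {A : GRVA V} {f : V →ₗ[ℂ] ℂ}
    (hf : GradedFunctionalZ A.grading f) (u : V) (k : ℤ) :
    GradedFunctionalZ A.grading (f ∘ₗ modeY A u k) := by
  obtain ⟨s, hs⟩ := exists_sum_gproj A u
  refine (Set.Finite.image2 (fun j a => j - a + k + 1) hf s.finite_toSet).subset ?_
  rintro b ⟨w, hw, hne⟩
  rw [LinearMap.comp_apply, modeY_apply, hs] at hne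
  simp only [map_sum, LinearMap.sum_apply, Finset.sum_apply] at hne
  obtain ⟨a, ha, hne⟩ := Finset.exists_ne_zero_of_sum_ne_zero hne
  exact ⟨_, ⟨_, Y_mem A (gproj_mem A a u) hw k, hne⟩, a, ha, by ring⟩

lemma GradedFunctionalZ.comp_Lm1 {A : GRVA V} {f : V →ₗ[ℂ] ℂ}
    (hf : GradedFunctionalZ A.grading f) : GradedFunctionalZ A.grading (f ∘ₗ A.Lm1) := by
  refine (hf.image (fun j => j - 1)).subset ?_
  rintro b ⟨w, hw, hne⟩
  exact ⟨_, ⟨_, Lm1_mem_grading A hw, hne⟩, by ring⟩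

lemma gradedFunctionalZ_comp_gproj (A : GRVA V) (f : V →ₗ[ℂ] ℂ) (k : ℤ) :
    GradedFunctionalZ A.grading (f ∘ₗ gproj A k) := by
  refine (Set.finite_singleton k).subset ?_
  rintro b ⟨w, hw, hne⟩
  by_contra hb
  rw [LinearMap.comp_apply, gproj_of_mem A hw, if_neg (fun h => hb h.symm), map_zero] at hne
  exact hne rfl

lemma pairBarV_eq_sum {A : GRVA V} {f : V →ₗ[ℂ] ℂ} (s : Finset ℤ)
    (hs : ∀ k, ∀ w ∈ A.grading k, f w ≠ 0 → k ∈ s) (ω : VbarT A) :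
    pairBarV f ω = ∑ k ∈ s, f (ω k : V) := by
  refine finsum_eq_sum_of_support_subset _ fun k hk => ?_
  exact hs k _ (ω k).2 hk

lemma GradedFunctionalZ.exists_finset {A : GRVA V} {f : V →ₗ[ℂ] ℂ}
    (hf : GradedFunctionalZ A.grading f) :
    ∃ s : Finset ℤ, ∀ k, ∀ w ∈ A.grading k, f w ≠ 0 → k ∈ s := by
  have h1 : {k : ℤ | ∃ v ∈ A.grading k, f v ≠ 0}.Finite := hf
  exact ⟨h1.toFinset, fun k w hw h => h1.mem_toFinset.mpr ⟨w, hw, h⟩⟩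

lemma pairBarV_comp_gproj {A : GRVA V} (f : V →ₗ[ℂ] ℂ) (k : ℤ) (ω : VbarT A) :
    pairBarV (f ∘ₗ gproj A k) ω = f (ω k : V) := by
  rw [pairBarV_eq_sum {k}]
  · simp [gproj_of_mem A (ω k).2]
  · intro j w hw h
    rw [LinearMap.comp_apply, gproj_of_mem A hw] at h
    by_contra hj
    exact h (by rw [if_neg (fun h => hj (by simp [h])), map_zero])

lemma VbarT_ext {A : GRVA V} {ω ω' : VbarT A}
    (h : ∀ f : V →ₗ[ℂ] ℂ, GradedFunctionalZ A.grading f → pairBarV f ω = pairBarV f ω') :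
    ω = ω' := by
  funext k
  apply Subtype.ext
  rw [← sub_eq_zero, ← Module.forall_dual_apply_eq_zero_iff ℂ]
  intro f
  have := h _ (gradedFunctionalZ_comp_gproj A f k)
  rw [pairBarV_comp_gproj, pairBarV_comp_gproj] at this
  rw [map_sub, this, sub_self]

lemma WbarT_ext {A : GRVA V} {M : GRMod V W A} {ω ω' : WbarT M}
    (h : ∀ f : W →ₗ[ℂ] ℂ, GradedFunctionalC M.grading f → pairBar f ω = pairBar f ω') :
    ω = ω' := by
  let _ := M.decomp
  funext c
  apply Subtype.ext
  rw [← sub_eq_zero, ← Module.forall_dual_apply_eq_zero_iff ℂ]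
  intro f
  let g : W →ₗ[ℂ] ℂ := f ∘ₗ (M.grading c).subtype ∘ₗ
    DirectSum.component ℂ ℂ (fun i => M.grading i) c ∘ₗ
    (DirectSum.decomposeLinearEquiv M.grading).toLinearMap
  have hg : ∀ d, ∀ w ∈ M.grading d, g w = if c = d then f w else 0 := by
    intro d w hw
    change f ((DirectSum.decompose M.grading w c : M.grading c) : W) = _
    split_ifs with hj
    · subst hj; rw [DirectSum.decompose_of_mem_same _ hw]
    · rw [DirectSum.decompose_of_mem_ne _ hw (Ne.symm hj), map_zero]
  have h1 : GradedFunctionalC M.grading g := by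
    refine (Set.finite_singleton c).subset ?_
    rintro b ⟨w, hw, hne⟩
    by_contra hb
    rw [hg b w hw, if_neg (fun h => hb h.symm)] at hne
    exact hne rfl
  have h2 : ∀ ω : WbarT M, pairBar g ω = f (ω c : W) := by
    intro ω
    have : ∀ d, g (ω d : W) = if c = d then f (ω d : W) else 0 := fun d => hg d _ (ω d).2
    unfold pairBar
    rw [finsum_congr this, finsum_eq_single _ c (fun d hd => if_neg (Ne.symm hd)), if_pos rfl]
  have h3 := h g h1
  rw [h2, h2] at h3
  rw [map_sub, h3, sub_self]

end Grading

section Modes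
variable {V : Type} [AddCommGroup V] [Module ℂ V]

/-- Composition of the modes in a list, the head being outermost. -/
def modeList (A : GRVA V) : List (V × ℤ) → V →ₗ[ℂ] V
  | [] => LinearMap.id
  | p :: L => modeY A p.1 p.2 ∘ₗ modeList A L

lemma modeList_append (A : GRVA V) (L L' : List (V × ℤ)) :
    modeList A (L ++ L') = modeList A L ∘ₗ modeList A L' := by
  induction L with
  | nil => simp [modeList]
  | cons p L ih => simp [modeList, ih, LinearMap.comp_assoc]

lemma applyList_eq_modeList (A : GRVA V) {n : ℕ} (v : Fin n → V) (k : Fin n → ℤ)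
    (L : List (Fin n)) (w : V) :
    applyList A.Y v k L w = modeList A (L.map fun t => (v t, k t)) w := by
  induction L with
  | nil => rfl
  | cons t L ih => simp [applyList, modeList, ih]

lemma GradedFunctionalZ.comp_modeList {A : GRVA V} {f : V →ₗ[ℂ] ℂ}
    (hf : GradedFunctionalZ A.grading f) (L : List (V × ℤ)) :
    GradedFunctionalZ A.grading (f ∘ₗ modeList A L) := by
  induction L generalizing f with
  | nil => simpa [modeList] using hf
  | cons p L ih =>
    rw [modeList, ← LinearMap.comp_assoc]
    exact ih (hf.comp_mode p.1 p.2)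

/-- The coefficient of `z ^ n` in `⟨f, Y(v₁, z₁) ⋯ Y(v_l, z_l) 𝟏⟩`. -/
def coefE (A : GRVA V) (f : V →ₗ[ℂ] ℂ) {l : ℕ} (v : Fin l → V) (n : Fin l → ℤ) : ℂ :=
  f (modeList A ((List.finRange l).map fun t => (v t, -n t - 1)) A.vacuum)

/-- The reflection `n ↦ -n - 1` of exponents. -/
def negSub : ℤ ≃ ℤ := (Equiv.neg ℤ).trans (Equiv.subRight 1)

@[simp] lemma negSub_apply (n : ℤ) : negSub n = -n - 1 := rfl

/-- The polynomial `∏ (z_i - z_j) ^ N`. -/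
def diagPoly (l N : ℕ) : MvPolynomial (Fin l) ℂ :=
  ∏ i, ∏ j, if i < j then (MvPolynomial.X i - MvPolynomial.X j) ^ N else 1

lemma eval_diagPoly (l N : ℕ) (x : Fin l → ℂ) : MvPolynomial.eval x (diagPoly l N) =
    ∏ i, ∏ j, if i < j then (x i - x j) ^ N else 1 := by
  simp only [diagPoly, map_prod]
  refine Finset.prod_congr rfl fun i _ => Finset.prod_congr rfl fun j _ => ?_
  split_ifs <;> simp

lemma eval_diagPoly_ne_zero (l N : ℕ) {x : Fin l → ℂ} (hx : Function.Injective x) :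
    MvPolynomial.eval x (diagPoly l N) ≠ 0 := by
  rw [eval_diagPoly]
  refine Finset.prod_ne_zero_iff.mpr fun i _ => Finset.prod_ne_zero_iff.mpr fun j _ => ?_
  split_ifs with h
  · exact pow_ne_zero _ (sub_ne_zero.mpr (hx.ne h.ne))
  · exact one_ne_zero

variable {A : GRVA V} {EV : ∀ l : ℕ, (Fin l → V) → (Fin l → ℂ) → VbarT A}

lemma finRange_isChain {l : ℕ} {z : Fin l → ℂ} (h : StrictAnti fun t => ‖z t‖) :
    (List.finRange l).Chain' (fun s t => ‖z s‖ > ‖z t‖) := by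
  apply List.Pairwise.isChain
  exact (List.pairwise_lt_finRange l).imp fun hab => h hab

lemma EV_spec (hEV : IsEVFam A EV) {l : ℕ} (v : Fin l → V) {f : V →ₗ[ℂ] ℂ}
    (hf : GradedFunctionalZ A.grading f) :
    (∀ z : Fin l → ℂ, (StrictAnti fun t => ‖z t‖) → (∀ t, z t ≠ 0) →
      HasSum (fun n => coefE A f v n * zmon z n) (pairBarV f (EV l v z))) ∧
    ∃ (P : MvPolynomial (Fin l) ℂ) (N : ℕ), ∀ x : Fin l → ℂ, Function.Injective x →
      pairBarV f (EV l v x) * MvPolynomial.eval x (diagPoly l N) = MvPolynomial.eval x P := by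
  obtain ⟨F, ⟨P, N, hP⟩, h1, h2⟩ := hEV l v f hf
  refine ⟨fun z hz hz0 => ?_, P, N, fun x hx => ?_⟩
  · have hinj : Function.Injective z := fun s t hst => hz.injective (by simp [hst])
    rw [h2 z fun s t hst => hinj.ne hst]
    have h3 := h1 z (finRange_isChain hz) hz0
    rw [← (Equiv.piCongrRight fun _ : Fin l => negSub).hasSum_iff] at h3
    convert h3 using 2 with n
    simp only [Function.comp, applyList_eq_modeList, coefE, zmon, Equiv.piCongrRight_apply,
      Pi.map_apply, negSub_apply]
    congr 1
    exact Finset.prod_congr rfl fun t _ => by congr 1; ring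
  · rw [h2 x fun s t hst => hx.ne hst, eval_diagPoly]
    exact hP x fun s t hst => hx.ne hst

lemma exists_strictAnti (l : ℕ) : ∃ ρ : Fin l → ℝ, (∀ t, 0 < ρ t) ∧ StrictAnti ρ := by
  refine ⟨fun t => l - (t : ℕ), fun t => ?_, fun s t h => ?_⟩
  · simp
  · have : ((s : ℕ) : ℝ) < (t : ℕ) := by exact_mod_cast h
    simpa using this

lemma injective_of_norm {ι : Type} {ρ : ι → ℝ} (hρ : Function.Injective ρ) {z : ι → ℂ}
    (hz : ∀ t, ‖z t‖ = ρ t) : Function.Injective z := fun s t hst => hρ (by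
  rw [← hz, ← hz, hst])

lemma ne_zero_of_norm {ι : Type} {ρ : ι → ℝ} (hρ : ∀ t, 0 < ρ t) {z : ι → ℂ}
    (hz : ∀ t, ‖z t‖ = ρ t) (t : ι) : z t ≠ 0 := by
  rw [← norm_pos_iff, hz]; exact hρ t

lemma EV_formal (hEV : IsEVFam A EV) {l : ℕ} (v : Fin l → V) {f : V →ₗ[ℂ] ℂ}
    (hf : GradedFunctionalZ A.grading f) :
    ∃ (P : MvPolynomial (Fin l) ℂ) (N : ℕ), mop (diagPoly l N) (coefE A f v) = emb P ∧
      ∀ x : Fin l → ℂ, Function.Injective x →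
      pairBarV f (EV l v x) * MvPolynomial.eval x (diagPoly l N) = MvPolynomial.eval x P := by
  obtain ⟨h1, P, N, h2⟩ := EV_spec hEV v hf
  obtain ⟨ρ, hρ, hρ'⟩ := exists_strictAnti l
  refine ⟨P, N, ?_, h2⟩
  refine mop_eq_emb_of_torus ρ hρ _ _ _ (fun z => pairBarV f (EV l v z))
    (fun z hz => h1 z (fun s t hst => ?_) (ne_zero_of_norm hρ hz))
    (fun z hz => h2 z (injective_of_norm hρ'.injective hz))
  show ‖z t‖ < ‖z s‖
  rw [hz, hz]; exact hρ' hst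

lemma EV_ratOn (hEV : IsEVFam A EV) {l : ℕ} (v : Fin l → V) {f : V →ₗ[ℂ] ℂ}
    (hf : GradedFunctionalZ A.grading f) :
    RatOn {x | Function.Injective x} (fun x => pairBarV f (EV l v x)) := by
  obtain ⟨-, P, N, h2⟩ := EV_spec hEV v hf
  exact ⟨diagPoly l N, P, fun x hx => eval_diagPoly_ne_zero l N hx, h2⟩

end Modes

section Locality
variable {V : Type} [AddCommGroup V] [Module ℂ V]

/-- Multiplication of a formal distribution by `z_i - z_j`. -/
def delta {ι : Type} (i j : ι) (C : (ι → ℤ) → ℂ) : (ι → ℤ) → ℂ := fun n =>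
  C (n - Pi.single i 1) - C (n - Pi.single j 1)

lemma zexp_single {ι : Type} (i : ι) : zexp (Finsupp.single i 1) = Pi.single i 1 := by
  funext t
  by_cases h : i = t
  · subst h; simp [zexp]
  · simp [zexp, Ne.symm h]

lemma mop_X_sub_X {ι : Type} (i j : ι) (C : (ι → ℤ) → ℂ) :
    mop (MvPolynomial.X i - MvPolynomial.X j) C = delta i j C := by
  have h : ∀ i : ι, ∀ n, mop (MvPolynomial.X i) C n = C (n - Pi.single i 1) := fun i n => by
    rw [MvPolynomial.X, mop_monomial, zexp_single, one_mul]
  have h2 := mop_add_left (MvPolynomial.X i - MvPolynomial.X j) (MvPolynomial.X j) C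
  rw [sub_add_cancel] at h2
  funext n
  have h3 := congrFun h2 n
  rw [Pi.add_apply, h, h] at h3
  rw [delta, h3]
  ring

lemma mop_X_sub_X_pow {ι : Type} (i j : ι) (M : ℕ) (C : (ι → ℤ) → ℂ) :
    mop ((MvPolynomial.X i - MvPolynomial.X j) ^ M) C = (delta i j)^[M] C := by
  induction M generalizing C with
  | zero => funext n; rw [pow_zero, ← MvPolynomial.C_1, MvPolynomial.C_apply, mop_monomial]; simp
  | succ M ih => rw [pow_succ, mop_mul, mop_X_sub_X, ih, Function.iterate_succ_apply]

lemma delta_iterate_eq_zero_mono {ι : Type} {i j : ι} {M : ℕ} {C : (ι → ℤ) → ℂ} {S : Set (ι → ℤ)}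
    (hS : ∀ n ∈ S, n - Pi.single i 1 ∈ S ∧ n - Pi.single j 1 ∈ S)
    (h : ∀ n ∈ S, (delta i j)^[M] C n = 0) {M' : ℕ} (hM : M ≤ M') :
    ∀ n ∈ S, (delta i j)^[M'] C n = 0 := by
  induction M', hM using Nat.le_induction with
  | base => exact h
  | succ M' _ ih =>
    intro n hn
    rw [Function.iterate_succ_apply', delta, ih _ (hS n hn).1, ih _ (hS n hn).2, sub_zero]

lemma two_variable_locality (A : GRVA V) (u₁ u₂ w : V) {f : V →ₗ[ℂ] ℂ}
    (hf : GradedFunctionalZ A.grading f) :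
    ∃ M : ℕ, (delta 0 1)^[M] (fun m : Fin 2 → ℤ =>
      f (A.Y u₁ (A.Y u₂ w (-m 1 - 1)) (-m 0 - 1)) - f (A.Y u₂ (A.Y u₁ w (-m 0 - 1)) (-m 1 - 1))) = 0 := by
  obtain ⟨F, ⟨P, N, hP⟩, h1, h2, -⟩ := A.duality u₁ u₂ w f hf
  refine ⟨N, ?_⟩
  let e : (Fin 2 → ℤ) ≃ ℤ × ℤ := (finTwoArrowEquiv ℤ).trans (negSub.prodCongr negSub)
  set D : MvPolynomial (Fin 2) ℂ := (MvPolynomial.X 0 * MvPolynomial.X 1) ^ N *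
    (MvPolynomial.X 0 - MvPolynomial.X 1) ^ N with hD
  have hFP : ∀ z : Fin 2 → ℂ, z 0 ≠ 0 → z 1 ≠ 0 → z 0 ≠ z 1 →
      F z * MvPolynomial.eval z D = MvPolynomial.eval z P := by
    intro z h0 h1 h01
    rw [← hP z (by simp [Fin.forall_fin_two, h0, h1])
      (by simp [Fin.forall_fin_two, h01, h01.symm])]
    simp [hD, Fin.prod_univ_two, mul_pow]
  have hz2 : ∀ z : Fin 2 → ℂ, ![z 0, z 1] = z := fun z => by
    funext t; fin_cases t <;> rfl
  have hc₁ := mop_eq_emb_of_torus ![2, 1] (by simp [Fin.forall_fin_two]) D P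
    (fun m => f (A.Y u₁ (A.Y u₂ w (-m 1 - 1)) (-m 0 - 1))) F (fun z hz => by
      have e0 := hz 0
      have e1 := hz 1
      simp only [Matrix.cons_val_zero, Matrix.cons_val_one] at e0 e1
      have := h1 (z 0) (z 1) (by rw [e0, e1]; norm_num) (by rw [← norm_pos_iff, e1]; norm_num)
      rw [hz2, ← e.hasSum_iff] at this
      convert this using 2 with m
      simp [e, zmon, Fin.prod_univ_two, mul_assoc]) (fun z hz => by
      have e0 := hz 0
      have e1 := hz 1
      simp only [Matrix.cons_val_zero, Matrix.cons_val_one] at e0 e1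
      refine hFP z (by rw [← norm_pos_iff, e0]; norm_num) (by rw [← norm_pos_iff, e1]; norm_num) ?_
      intro h; rw [h, e1] at e0; norm_num at e0)
  have hc₂ := mop_eq_emb_of_torus ![1, 2] (by simp [Fin.forall_fin_two]) D P
    (fun m => f (A.Y u₂ (A.Y u₁ w (-m 0 - 1)) (-m 1 - 1))) F (fun z hz => by
      have e0 := hz 0
      have e1 := hz 1
      simp only [Matrix.cons_val_zero, Matrix.cons_val_one] at e0 e1
      have := h2 (z 0) (z 1) (by rw [e0, e1]; norm_num) (by rw [← norm_pos_iff, e0]; norm_num)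
      rw [hz2, ← e.hasSum_iff] at this
      convert this using 2 with m
      simp [e, zmon, Fin.prod_univ_two, mul_assoc]) (fun z hz => by
      have e0 := hz 0
      have e1 := hz 1
      simp only [Matrix.cons_val_zero, Matrix.cons_val_one] at e0 e1
      refine hFP z (by rw [← norm_pos_iff, e0]; norm_num) (by rw [← norm_pos_iff, e1]; norm_num) ?_
      intro h; rw [h, e1] at e0; norm_num at e0)
  have h3 := mop_sub_right D (fun m => f (A.Y u₁ (A.Y u₂ w (-m 1 - 1)) (-m 0 - 1)))
    (fun m => f (A.Y u₂ (A.Y u₁ w (-m 0 - 1)) (-m 1 - 1)))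
  rw [hc₁, hc₂, sub_self, hD, mop_mul, mop_X_sub_X_pow] at h3
  have h4 : (MvPolynomial.X 0 * MvPolynomial.X 1 : MvPolynomial (Fin 2) ℂ) ^ N =
      MvPolynomial.monomial (N • (Finsupp.single 0 1 + Finsupp.single 1 1)) 1 := by
    rw [MvPolynomial.X, MvPolynomial.X, MvPolynomial.monomial_mul, MvPolynomial.monomial_pow]
    simp
  rw [h4] at h3
  funext m
  have h5 := congrFun h3 (m + zexp (N • (Finsupp.single 0 1 + Finsupp.single 1 1)))
  rw [mop_monomial, add_sub_cancel_right, one_mul] at h5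
  exact h5

end Locality

section Symmetry
variable {V : Type} [AddCommGroup V] [Module ℂ V]

/-- The multi-indices agreeing with `n` away from `i` and `j`. -/
def slice {ι : Type} (i j : ι) (n : ι → ℤ) : Set (ι → ℤ) := {m | ∀ t, t ≠ i → t ≠ j → m t = n t}

lemma slice_sub {ι : Type} {i j : ι} {n m : ι → ℤ} (hm : m ∈ slice i j n) (k : ι → ℤ) :
    m - k ∈ slice i j (n - k) := fun t h1 h2 => by simp [hm t h1 h2]

lemma slice_sub_single {ι : Type} {i j : ι} {n m : ι → ℤ} (hm : m ∈ slice i j n) :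
    m - Pi.single i 1 ∈ slice i j n ∧ m - Pi.single j 1 ∈ slice i j n :=
  ⟨fun t h1 h2 => by simp [hm t h1 h2, h1], fun t h1 h2 => by simp [hm t h1 h2, h2]⟩

lemma delta_iterate_slice {ι : Type} {i j : ι} (hij : i ≠ j) {n : ι → ℤ} (M : ℕ)
    (C : (ι → ℤ) → ℂ) (c : (Fin 2 → ℤ) → ℂ) (h : ∀ m ∈ slice i j n, C m = c ![m i, m j]) :
    ∀ m ∈ slice i j n, (delta i j)^[M] C m = (delta 0 1)^[M] c ![m i, m j] := by
  induction M generalizing C c with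
  | zero => exact h
  | succ M ih =>
    simp only [Function.iterate_succ_apply]
    refine ih _ _ fun m hm => ?_
    rw [delta, delta, h _ (slice_sub_single hm).1, h _ (slice_sub_single hm).2]
    congr 2 <;> funext t <;> fin_cases t <;> simp [hij, hij.symm]

lemma eq_zero_of_delta_iterate {ι : Type} {i j : ι} (hij : i ≠ j) {n : ι → ℤ} (M : ℕ) (B : ℤ)
    (C : (ι → ℤ) → ℂ) (hB : ∀ m, B < m i → C m = 0)
    (h : ∀ m ∈ slice i j n, (delta i j)^[M] C m = 0) : ∀ m ∈ slice i j n, C m = 0 := by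
  induction M generalizing C B with
  | zero => exact h
  | succ M ih =>
    simp only [Function.iterate_succ_apply] at h
    have h1 := ih (B + 1) (delta i j C) (fun m hm => by
      rw [delta, hB _ (by simp; omega), hB _ (by simp [hij]; omega), sub_zero]) h
    have h2 : ∀ t : ℕ, ∀ m ∈ slice i j n, B < m i + t → C m = 0 := by
      intro t
      induction t with
      | zero => intro m _ hm; exact hB m (by simpa using hm)
      | succ t ih2 =>
        intro m hm hmB
        have hm' : m + Pi.single i 1 ∈ slice i j n := fun s h1 h2 => by simp [hm s h1 h2, h1]
        have h3 := h1 _ hm'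
        rw [delta, add_sub_cancel_right, sub_eq_zero] at h3
        rw [h3]
        refine ih2 _ (slice_sub_single hm').2 ?_
        simp [hij]; push_cast at hmB; omega
    intro m hm
    exact h2 (B - m i + 1).toNat m hm (by omega)

lemma emb_eq_zero_of_large {ι : Type} (P : MvPolynomial ι ℂ) (i : ι) :
    ∃ B : ℤ, ∀ m, B < m i → emb P m = 0 := by
  refine ⟨(P.support.sup fun d => d i : ℕ), fun m hm => ?_⟩
  by_contra h
  obtain ⟨d, hd, rfl⟩ := emb_finite P m h
  have := Finset.le_sup (f := fun d : ι →₀ ℕ => d i) hd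
  simp only [zexp] at hm
  have h2 : ((d i : ℕ) : ℤ) ≤ (P.support.sup fun d => d i : ℕ) := by exact_mod_cast this
  omega

lemma finRange_eq_append {l : ℕ} (i : ℕ) (hi : i + 1 < l) : ∃ L₁ L₂ : List (Fin l),
    List.finRange l = L₁ ++ (⟨i, by omega⟩ :: ⟨i + 1, hi⟩ :: L₂) ∧
    (∀ t ∈ L₁, t ≠ ⟨i, by omega⟩ ∧ t ≠ ⟨i + 1, hi⟩) ∧
    (∀ t ∈ L₂, t ≠ ⟨i, by omega⟩ ∧ t ≠ ⟨i + 1, hi⟩) := by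
  have h : List.finRange l = (List.finRange l).take i ++ (⟨i, by omega⟩ :: ⟨i + 1, hi⟩ ::
      (List.finRange l).drop (i + 2)) := by
    conv_lhs => rw [← List.take_append_drop i (List.finRange l)]
    rw [List.drop_eq_getElem_cons (by simp; omega), List.drop_eq_getElem_cons (by simp; omega)]
    simp
  have hn := List.nodup_finRange l
  rw [h] at hn
  rw [List.nodup_append] at hn
  obtain ⟨-, h2, h3⟩ := hn
  simp only [List.nodup_cons, List.mem_cons, not_or] at h2
  refine ⟨_, _, h, fun t ht => ⟨fun e => h3 t ht _ (by simp) e, fun e => h3 t ht _ (by simp) e⟩,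
    fun t ht => ⟨?_, ?_⟩⟩
  · rintro rfl; exact h2.1.2 ht
  · rintro rfl; exact h2.2.1 ht

lemma coefE_swap_local (A : GRVA V) {f : V →ₗ[ℂ] ℂ} (hf : GradedFunctionalZ A.grading f) {l : ℕ}
    (v : Fin l → V) {i j : Fin l} (hj : (j : ℕ) = i + 1) (n : Fin l → ℤ) :
    ∃ M : ℕ, ∀ m ∈ slice i j n, (delta i j)^[M] (coefE A f v -
      fun m => coefE A f (v ∘ Equiv.swap i j) (m ∘ Equiv.swap i j)) m = 0 := by
  obtain ⟨j, hjl⟩ := j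
  obtain ⟨i, hil⟩ := i
  simp only at hj
  subst hj
  set i' : Fin l := ⟨i, hil⟩ with hi'
  set j' : Fin l := ⟨i + 1, hjl⟩ with hj'
  have hij : i' ≠ j' := by simp [hi', hj']
  obtain ⟨L₁, L₂, hL, hL₁, hL₂⟩ := finRange_eq_append i hjl
  rw [← hj', ← hi'] at hL
  let g : (Fin l → ℤ) → Fin l → V × ℤ := fun m t => (v t, -m t - 1)
  obtain ⟨M, hM⟩ := two_variable_locality A (v i') (v j') (modeList A (L₂.map (g n)) A.vacuum)
    (hf.comp_modeList (L₁.map (g n)))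
  refine ⟨M, fun m hm => ?_⟩
  rw [delta_iterate_slice hij M _ _ _ m hm, hM]
  · rfl
  intro m hm
  have h1 : ∀ L : List (Fin l), (∀ t ∈ L, t ≠ i' ∧ t ≠ j') → L.map (g m) = L.map (g n) ∧
      L.map (fun t => (v (Equiv.swap i' j' t), -m (Equiv.swap i' j' t) - 1)) = L.map (g n) := by
    intro L hL
    refine ⟨List.map_congr_left fun t ht => ?_, List.map_congr_left fun t ht => ?_⟩
    · simp [g, hm t (hL t ht).1 (hL t ht).2]
    · rw [Equiv.swap_apply_of_ne_of_ne (hL t ht).1 (hL t ht).2]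
      simp [g, hm t (hL t ht).1 (hL t ht).2]
  have h2 : coefE A f v m = f (modeList A ((List.finRange l).map (g m)) A.vacuum) := rfl
  rw [Pi.sub_apply, h2, coefE]
  simp only [Function.comp]
  rw [hL, List.map_append, List.map_append, List.map_cons, List.map_cons, List.map_cons,
    List.map_cons, (h1 L₁ hL₁).1, (h1 L₂ hL₂).1, (h1 L₁ hL₁).2, (h1 L₂ hL₂).2, modeList_append,
    modeList_append]
  simp [modeList, g]

variable {A : GRVA V} {EV : ∀ l : ℕ, (Fin l → V) → (Fin l → ℂ) → VbarT A}

lemma zmon_comp_equiv {ι κ : Type} [Fintype ι] [Fintype κ] (σ : ι ≃ κ) (z : κ → ℂ) (n : κ → ℤ) :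
    zmon (z ∘ σ) (n ∘ σ) = zmon z n :=
  Equiv.prod_comp σ fun t => z t ^ n t

lemma EV_formal_perm (hEV : IsEVFam A EV) {l : ℕ} (σ : Equiv.Perm (Fin l)) (v : Fin l → V)
    {f : V →ₗ[ℂ] ℂ} (hf : GradedFunctionalZ A.grading f) :
    ∃ D P : MvPolynomial (Fin l) ℂ,
      mop D (fun n => coefE A f (v ∘ σ) (n ∘ σ)) = emb P ∧
      (∀ x : Fin l → ℂ, Function.Injective x → MvPolynomial.eval x D ≠ 0) ∧
      ∀ x : Fin l → ℂ, Function.Injective x →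
        pairBarV f (EV l (v ∘ σ) (x ∘ σ)) * MvPolynomial.eval x D = MvPolynomial.eval x P := by
  obtain ⟨h1, P, N, h2⟩ := EV_spec hEV (v ∘ σ) hf
  obtain ⟨ρ, hρ, hρ'⟩ := exists_strictAnti l
  have h3 : ∀ x : Fin l → ℂ, Function.Injective x → pairBarV f (EV l (v ∘ σ) (x ∘ σ)) *
      MvPolynomial.eval x (MvPolynomial.rename σ (diagPoly l N)) =
      MvPolynomial.eval x (MvPolynomial.rename σ P) := fun x hx => by
    rw [MvPolynomial.eval_rename, MvPolynomial.eval_rename]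
    exact h2 _ (hx.comp σ.injective)
  refine ⟨MvPolynomial.rename σ (diagPoly l N), MvPolynomial.rename σ P, ?_, fun x hx => ?_, h3⟩
  · refine mop_eq_emb_of_torus (ρ ∘ σ.symm) (fun t => hρ _) _ _ _
      (fun z => pairBarV f (EV l (v ∘ σ) (z ∘ σ))) (fun z hz => ?_)
      (fun z hz => h3 z (injective_of_norm (hρ'.injective.comp σ.symm.injective) hz))
    have hz' : ∀ t, ‖(z ∘ σ) t‖ = ρ t := fun t => by simp [hz]
    have h4 := h1 (z ∘ σ) (fun s t hst => by
      change ‖(z ∘ σ) t‖ < ‖(z ∘ σ) s‖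
      rw [hz', hz']; exact hρ' hst) (ne_zero_of_norm hρ hz')
    rw [← (σ.arrowCongr (Equiv.refl ℤ)).symm.hasSum_iff] at h4
    convert h4 using 2 with n
    have : (σ.arrowCongr (Equiv.refl ℤ)).symm n = n ∘ σ := by
      funext t; simp [Equiv.arrowCongr]
    rw [Function.comp_apply, this, zmon_comp_equiv]
  · rw [MvPolynomial.eval_rename]
    exact eval_diagPoly_ne_zero l N (hx.comp σ.injective)

lemma EV_swap (hEV : IsEVFam A EV) {l : ℕ} {i j : Fin l} (hj : (j : ℕ) = i + 1) (v : Fin l → V)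
    {x : Fin l → ℂ} (hx : Function.Injective x) :
    EV l (v ∘ Equiv.swap i j) (x ∘ Equiv.swap i j) = EV l v x := by
  have hij : i ≠ j := by rintro rfl; omega
  refine VbarT_ext fun f hf => ?_
  obtain ⟨P, N, hP, hP'⟩ := EV_formal hEV v hf
  obtain ⟨D, Q, hQ, hD, hQ'⟩ := EV_formal_perm hEV (Equiv.swap i j) v hf
  set C := coefE A f v
  set C' : (Fin l → ℤ) → ℂ := fun n => coefE A f (v ∘ Equiv.swap i j) (n ∘ Equiv.swap i j)
  have key : D * P - diagPoly l N * Q = 0 := by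
    have h1 : emb (D * P - diagPoly l N * Q) = mop (D * diagPoly l N) (C - C') := by
      rw [emb_sub, emb_mul, emb_mul, ← hP, ← hQ, mop_sub_right, mop_mul, mop_mul, mop_comm D _ C']
    apply emb_injective
    rw [← MvPolynomial.C_0]
    funext n
    obtain ⟨B, hB⟩ := emb_eq_zero_of_large (D * P - diagPoly l N * Q) i
    choose M hM using fun n => coefE_swap_local A hf v hj n
    have h2 := eq_zero_of_delta_iterate hij
      ((D * diagPoly l N).support.sup fun d => M (n - zexp d)) B
      (emb (D * P - diagPoly l N * Q)) hB (n := n) (fun m hm => by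
        rw [h1, ← mop_X_sub_X_pow, mop_comm, mop_X_sub_X_pow]
        refine Finset.sum_eq_zero fun d hd => ?_
        rw [delta_iterate_eq_zero_mono (fun _ h => slice_sub_single h) (hM (n - zexp d))
          (Finset.le_sup (f := fun d => M (n - zexp d)) hd) _ (slice_sub hm _), mul_zero])
      n (fun t _ _ => rfl)
    rw [h2]
    simp [emb]
  have h5 := congrArg (MvPolynomial.eval x) key
  rw [map_sub, map_mul, map_mul, ← hP' x hx, ← hQ' x hx, map_zero, sub_eq_zero] at h5
  refine (mul_right_cancel₀ (mul_ne_zero (hD x hx) (eval_diagPoly_ne_zero l N hx)) ?_).symm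
  linear_combination h5

/-- The rational functions `E(Y(v₁, x₁) ⋯ Y(v_l, x_l) 𝟏)` are symmetric. -/
theorem EV_perm (hEV : IsEVFam A EV) {l : ℕ} (σ : Equiv.Perm (Fin l)) (v : Fin l → V)
    {x : Fin l → ℂ} (hx : Function.Injective x) : EV l (v ∘ σ) (x ∘ σ) = EV l v x := by
  cases l with
  | zero => rw [Subsingleton.elim (v ∘ σ) v, Subsingleton.elim (x ∘ σ) x]
  | succ l =>
    have h : σ ∈ Submonoid.closure
        (Set.range fun i : Fin l => Equiv.swap i.castSucc i.succ) := by
      rw [Equiv.Perm.mclosure_swap_castSucc_succ]; trivial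
    induction h using Submonoid.closure_induction generalizing v x with
    | mem σ hσ =>
      obtain ⟨i, rfl⟩ := hσ
      exact EV_swap hEV (by simp) v hx
    | one => rfl
    | mul σ τ _ _ h1 h2 =>
      rw [← h1 v hx, ← h2 (v ∘ σ) (hx.comp σ.injective)]
      rfl

end Symmetry

section Translation
variable {V : Type} [AddCommGroup V] [Module ℂ V]

/-- The partial derivative of a formal distribution. -/
def fderivC {ι : Type} (i : ι) (C : (ι → ℤ) → ℂ) : (ι → ℤ) → ℂ := fun n =>
  ((n i : ℂ) + 1) * C (n + Pi.single i 1)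

lemma fderivC_mop {ι : Type} (i : ι) (D : MvPolynomial ι ℂ) (C : (ι → ℤ) → ℂ) :
    fderivC i (mop D C) = mop (MvPolynomial.pderiv i D) C + mop D (fderivC i C) := by
  induction D using MvPolynomial.induction_on' with
  | add p q hp hq =>
    rw [map_add, mop_add_left, mop_add_left, mop_add_left, add_add_add_comm, ← hp, ← hq]
    funext n
    simp [fderivC, mul_add]
  | monomial d a =>
    funext n
    rw [MvPolynomial.pderiv_monomial, Pi.add_apply, fderivC, mop_monomial, mop_monomial,
      mop_monomial, fderivC]
    have h2 : n - zexp d + Pi.single i 1 = n + Pi.single i 1 - zexp d := by abel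
    rw [h2]
    rcases Nat.eq_zero_or_pos (d i) with h | h
    · simp [h, zexp]; ring
    · have h3 : zexp (d - Finsupp.single i 1) = zexp d - Pi.single i 1 := by
        rw [← zexp_single, eq_sub_iff_add_eq, ← zexp_add,
          tsub_add_cancel_of_le (Finsupp.single_le_iff.mpr h)]
      rw [h3, show n - (zexp d - Pi.single i 1) = n + Pi.single i 1 - zexp d by abel]
      simp [zexp]; ring

lemma fderivC_emb {ι : Type} (i : ι) (P : MvPolynomial ι ℂ) :
    fderivC i (emb P) = emb (MvPolynomial.pderiv i P) := by
  rw [emb_eq_mop, emb_eq_mop, fderivC_mop]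
  have : fderivC i (Pi.single (0 : ι → ℤ) (1 : ℂ)) = 0 := by
    funext n
    by_cases h : n + Pi.single i 1 = 0
    · have h2 := congrFun h i
      simp only [Pi.add_apply, Pi.single_eq_same, Pi.zero_apply] at h2
      have h3 : (n i : ℂ) + 1 = 0 := by exact_mod_cast h2
      simp [fderivC, h3]
    · simp [fderivC, h]
  rw [this, mop_zero_right, add_zero]

/-- The infinitesimal generator of simultaneous translations. -/
def transDer (ι : Type) [Fintype ι] : Derivation ℂ (MvPolynomial ι ℂ) (MvPolynomial ι ℂ) :=
  ∑ i, MvPolynomial.pderiv i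

lemma transDer_apply {ι : Type} [Fintype ι] (P : MvPolynomial ι ℂ) :
    transDer ι P = ∑ i, MvPolynomial.pderiv i P := by
  have := congrFun (map_sum (Derivation.coeFnAddMonoidHom (R := ℂ) (A := MvPolynomial ι ℂ)
    (M := MvPolynomial ι ℂ)) MvPolynomial.pderiv Finset.univ) P
  rw [Finset.sum_apply] at this
  exact this

lemma transDer_X {ι : Type} [Fintype ι] (i : ι) : transDer ι (MvPolynomial.X i) = 1 := by
  rw [transDer_apply, Finset.sum_eq_single i]
  · simp
  · intro j _ h; exact MvPolynomial.pderiv_X_of_ne h.symm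
  · simp

lemma transDer_diagPoly (l N : ℕ) : transDer (Fin l) (diagPoly l N) = 0 := by
  have hmul : ∀ a b : MvPolynomial (Fin l) ℂ, transDer (Fin l) a = 0 → transDer (Fin l) b = 0 →
      transDer (Fin l) (a * b) = 0 := fun a b ha hb => by simp [Derivation.leibniz, ha, hb]
  refine Finset.prod_induction _ _ hmul (by simp) fun i _ =>
    Finset.prod_induction _ _ hmul (by simp) fun j _ => ?_
  split_ifs
  · simp [Derivation.leibniz_pow, transDer_X]
  · simp

lemma hasDerivAt_eval_sub {ι : Type} [Fintype ι] (P : MvPolynomial ι ℂ) (x : ι → ℂ) (t : ℂ) :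
    HasDerivAt (fun t => MvPolynomial.eval (fun i => x i - t) P)
      (-MvPolynomial.eval (fun i => x i - t) (transDer ι P)) t := by
  induction P using MvPolynomial.induction_on with
  | C a => simpa using hasDerivAt_const t a
  | add p q hp hq =>
    simp only [map_add, neg_add]
    exact hp.add hq
  | mul_X p i hp =>
    have h1 : HasDerivAt (fun t => x i - t) (-1) t := by
      simpa using (hasDerivAt_id t).const_sub (x i)
    have h2 := hp.mul h1
    simp only [map_mul, MvPolynomial.eval_X, Derivation.leibniz, transDer_X]
    refine h2.congr_deriv ?_
    simp; ring

lemma Lm1_modeList (A : GRVA V) {l : ℕ} (v : Fin l → V) (n : Fin l → ℤ) (w : V)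
    (L : List (Fin l)) (hL : L.Nodup) :
    A.Lm1 (modeList A (L.map fun t => (v t, -n t - 1)) w) =
      modeList A (L.map fun t => (v t, -n t - 1)) (A.Lm1 w) + ∑ i ∈ L.toFinset,
        ((n i : ℂ) + 1) • modeList A
          (L.map fun t => (v t, -(n + Pi.single i 1 : Fin l → ℤ) t - 1)) w := by
  induction L with
  | nil => simp [modeList]
  | cons s L ih =>
    obtain ⟨hs, hL⟩ := List.nodup_cons.mp hL
    have hs' : s ∉ L.toFinset := by simpa using hs
    have h1 := A.Lm1_bracket (v s) (modeList A (L.map fun t => (v t, -n t - 1)) w) (-n s - 1)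
    have h2 : L.map (fun t => (v t, -(n + Pi.single s 1 : Fin l → ℤ) t - 1)) =
        L.map fun t => (v t, -n t - 1) := List.map_congr_left fun t ht => by
      have : t ≠ s := by rintro rfl; exact hs ht
      simp [this]
    rw [List.toFinset_cons, Finset.sum_insert hs']
    simp only [List.map_cons, modeList, LinearMap.comp_apply, modeY_apply, h2]
    rw [sub_eq_iff_eq_add] at h1
    rw [h1, ih hL]
    have h3 : ∀ i ∈ L.toFinset, (n + Pi.single i 1 : Fin l → ℤ) s = n s := fun i hi => by
      have : s ≠ i := by rintro rfl; exact hs' hi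
      simp [this]
    rw [map_add, Pi.add_apply, map_sum, Finset.sum_apply, add_left_comm]
    congr 1
    congr 1
    · congr 1
      · push_cast; ring
      · simp; ring_nf
    · refine Finset.sum_congr rfl fun i hi => ?_
      rw [h3 i hi, map_smul, Pi.smul_apply]

lemma coefE_Lm1 (A : GRVA V) (f : V →ₗ[ℂ] ℂ) {l : ℕ} (v : Fin l → V) :
    coefE A (f ∘ₗ A.Lm1) v = ∑ i, fderivC i (coefE A f v) := by
  have h0 : A.Lm1 A.vacuum = 0 := by rw [A.Lm1_eq, A.identity]; simp
  funext n
  rw [coefE, LinearMap.comp_apply, Lm1_modeList A v n _ _ (List.nodup_finRange l), h0,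
    List.toFinset_finRange]
  simp only [map_zero, zero_add, map_sum, map_smul, smul_eq_mul, Finset.sum_apply,
    fderivC, coefE]
  exact Finset.sum_congr rfl fun i _ => by congr!

variable {A : GRVA V} {EV : ∀ l : ℕ, (Fin l → V) → (Fin l → ℂ) → VbarT A}

lemma hasDerivAt_EV_sub (hEV : IsEVFam A EV) {l : ℕ} (v : Fin l → V) {x : Fin l → ℂ}
    (hx : Function.Injective x) {f : V →ₗ[ℂ] ℂ} (hf : GradedFunctionalZ A.grading f) (t : ℂ) :
    HasDerivAt (fun t => pairBarV f (EV l v fun i => x i - t))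
      (-pairBarV (f ∘ₗ A.Lm1) (EV l v fun i => x i - t)) t := by
  obtain ⟨P, N, h1, h2⟩ := EV_formal hEV v hf
  obtain ⟨Q, K, h3, h4⟩ := EV_formal hEV v hf.comp_Lm1
  have hinj : ∀ t, Function.Injective fun i => x i - t := fun t i j h => hx (by simpa using h)
  have h5 : mop (diagPoly l N) (coefE A (f ∘ₗ A.Lm1) v) = emb (transDer (Fin l) P) := by
    have e1 : ∀ i, mop (diagPoly l N) (fderivC i (coefE A f v)) =
        emb (MvPolynomial.pderiv i P) - mop (MvPolynomial.pderiv i (diagPoly l N)) (coefE A f v) :=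
      fun i => by rw [← fderivC_emb, ← h1, fderivC_mop, add_sub_cancel_left]
    have e2 : ∀ (s : Finset (Fin l)), mop (diagPoly l N) (∑ i ∈ s, fderivC i (coefE A f v)) =
        emb (∑ i ∈ s, MvPolynomial.pderiv i P) -
          mop (∑ i ∈ s, MvPolynomial.pderiv i (diagPoly l N)) (coefE A f v) := by
      intro s
      induction s using Finset.induction_on with
      | empty => funext n; simp [mop, emb]
      | insert a s ha ih =>
        simp only [Finset.sum_insert ha, mop_add_right, mop_add_left, emb_add, ih, e1]
        abel
    rw [coefE_Lm1, e2, ← transDer_apply, ← transDer_apply, transDer_diagPoly]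
    funext n; simp [mop]
  have h6 : diagPoly l K * transDer (Fin l) P = diagPoly l N * Q := by
    apply emb_injective
    rw [emb_mul, emb_mul, ← h5, ← h3, mop_comm]
  have hN : ∀ t, MvPolynomial.eval (fun i => x i - t) (diagPoly l N) =
      MvPolynomial.eval x (diagPoly l N) := fun t => by simp [eval_diagPoly]
  have h0 := eval_diagPoly_ne_zero l N hx
  have h7 : ∀ t, pairBarV (f ∘ₗ A.Lm1) (EV l v fun i => x i - t) *
      MvPolynomial.eval x (diagPoly l N) = MvPolynomial.eval (fun i => x i - t) (transDer _ P) := by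
    intro t
    have h8 := congrArg (MvPolynomial.eval fun i => x i - t) h6
    rw [map_mul, map_mul, ← h4 _ (hinj t), hN] at h8
    refine mul_left_cancel₀ (eval_diagPoly_ne_zero l K (hinj t)) ?_
    rw [h8]; ring
  have h9 := (hasDerivAt_eval_sub P x t).div_const (MvPolynomial.eval x (diagPoly l N))
  rw [← h7, neg_div, mul_div_cancel_right₀ _ h0] at h9
  refine h9.congr_of_eventuallyEq (Filter.Eventually.of_forall fun t => ?_)
  simp only
  rw [← h2 _ (hinj t), hN, mul_div_cancel_right₀ _ h0]

lemma GradedFunctionalZ.comp_Lm1_pow {f : V →ₗ[ℂ] ℂ}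
    (hf : GradedFunctionalZ A.grading f) (m : ℕ) :
    GradedFunctionalZ A.grading (f ∘ₗ (A.Lm1 ^ m : V →ₗ[ℂ] V)) := by
  induction m with
  | zero => simpa [Module.End.one_eq_id] using hf
  | succ m ih =>
    have := ih.comp_Lm1
    rwa [LinearMap.comp_assoc, ← Module.End.mul_eq_comp, ← pow_succ] at this

lemma Lm1_pow_mem_grading (A : GRVA V) {a : ℤ} {u : V} (hu : u ∈ A.grading a) (m : ℕ) :
    (A.Lm1 ^ m) u ∈ A.grading (a + m) := by
  induction m with
  | zero => simpa using hu
  | succ m ih =>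
    rw [pow_succ', Module.End.mul_apply]
    convert Lm1_mem_grading A ih using 2
    push_cast; ring

lemma linearMap_ext_grading (A : GRVA V) {f g : V →ₗ[ℂ] ℂ}
    (h : ∀ k, ∀ u ∈ A.grading k, f u = g u) : f = g := by
  ext u
  obtain ⟨s, hs⟩ := exists_sum_gproj A u
  rw [hs, map_sum, map_sum]
  exact Finset.sum_congr rfl fun k _ => h k _ (gproj_mem A k u)

lemma exists_comp_Lm1_pow_eq_zero {f : V →ₗ[ℂ] ℂ} (hf : GradedFunctionalZ A.grading f) :
    ∃ M : ℕ, f ∘ₗ (A.Lm1 ^ M : V →ₗ[ℂ] V) = 0 := by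
  obtain ⟨s, hs⟩ := hf.exists_finset
  obtain ⟨N, hN⟩ := A.lower_bounded
  obtain ⟨B, hB⟩ := s.bddAbove
  refine ⟨(B - N + 1).toNat, linearMap_ext_grading A fun k u hu => ?_⟩
  rw [LinearMap.comp_apply, LinearMap.zero_apply]
  by_contra h
  have h1 := hB (hs _ _ (Lm1_pow_mem_grading A hu _) h)
  have h2 : k < N := by omega
  rw [hN k h2, Submodule.mem_bot] at hu
  rw [hu, map_zero, map_zero] at h
  exact h rfl

lemma pairBarV_zero (ω : VbarT A) : pairBarV 0 ω = 0 := by simp [pairBarV]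

/-- The products of vertex operators satisfy `E(x) = exp(c L(-1)) E(x - c)`. -/
theorem EV_translate (hEV : IsEVFam A EV) {f : V →ₗ[ℂ] ℂ} (hf : GradedFunctionalZ A.grading f) :
    ∃ M : ℕ, ∀ (l : ℕ) (v : Fin l → V) (x : Fin l → ℂ), Function.Injective x → ∀ c : ℂ,
      pairBarV f (EV l v x) = ∑ m ∈ Finset.range M, (c ^ m * ((m.factorial : ℂ))⁻¹) *
        pairBarV (f ∘ₗ (A.Lm1 ^ m : V →ₗ[ℂ] V)) (EV l v fun i => x i - c) := by
  obtain ⟨M, hM⟩ := exists_comp_Lm1_pow_eq_zero hf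
  have hM' : ∀ m, M ≤ m → f ∘ₗ (A.Lm1 ^ m : V →ₗ[ℂ] V) = 0 := fun m hm => by
    obtain ⟨d, rfl⟩ := Nat.exists_eq_add_of_le hm
    rw [pow_add, Module.End.mul_eq_comp, ← LinearMap.comp_assoc, hM, LinearMap.zero_comp]
  refine ⟨M + 1, fun l v x hx c => ?_⟩
  let G : ℕ → ℂ → ℂ := fun m t => pairBarV (f ∘ₗ (A.Lm1 ^ m : V →ₗ[ℂ] V)) (EV l v fun i => x i - t)
  have hG : ∀ m t, HasDerivAt (G m) (-G (m + 1) t) t := fun m t => by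
    have := hasDerivAt_EV_sub hEV v hx (hf.comp_Lm1_pow m) t
    rwa [LinearMap.comp_assoc, ← Module.End.mul_eq_comp, ← pow_succ] at this
  have hS : ∀ K t, HasDerivAt (fun t => ∑ m ∈ Finset.range (K + 1),
      (t ^ m * ((m.factorial : ℂ))⁻¹) * G m t)
      (-(t ^ K * ((K.factorial : ℂ))⁻¹ * G (K + 1) t)) t := by
    intro K
    induction K with
    | zero => intro t; simpa using hG 0 t
    | succ K ih =>
      intro t
      simp only [Finset.sum_range_succ _ (K + 1)]
      have h1 := (ih t).add ((((hasDerivAt_pow (K + 1) t).mul_const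
        (((K + 1).factorial : ℂ))⁻¹)).mul (hG (K + 1) t))
      refine h1.congr_deriv ?_
      have h2 : ((K + 1).factorial : ℂ)⁻¹ * ((K : ℂ) + 1) = ((K.factorial : ℂ))⁻¹ := by
        have : ((K : ℂ) + 1) ≠ 0 := by exact_mod_cast Nat.succ_ne_zero K
        rw [Nat.factorial_succ]; push_cast; field_simp
      rw [← h2]; push_cast [Nat.add_sub_cancel]; ring
  have hd : ∀ t, HasDerivAt (fun t => ∑ m ∈ Finset.range (M + 1),
      (t ^ m * ((m.factorial : ℂ))⁻¹) * G m t) 0 t := fun t => by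
    have h2 : G (M + 1) t = 0 := by
      change pairBarV _ _ = _
      rw [hM' (M + 1) (by omega), pairBarV_zero]
    have h1 := hS M t
    rwa [h2, mul_zero, neg_zero] at h1
  have hc := is_const_of_deriv_eq_zero (fun t => (hd t).differentiableAt) (fun t => (hd t).deriv) 0 c
  rw [← hc, Finset.sum_range_succ']
  simp [G, Module.End.one_eq_id]

end Translation

section Append
variable {V : Type} [AddCommGroup V] [Module ℂ V]

/-- The coefficients of `Y(u₁, y₁) ⋯ Y(u_k, y_k) 𝟏`. -/
def modeVec (A : GRVA V) {k : ℕ} (u : Fin k → V) (κ : Fin k → ℤ) : V :=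
  modeList A ((List.finRange k).map fun t => (u t, -κ t - 1)) A.vacuum

lemma modeVec_mem (A : GRVA V) {k : ℕ} {u : Fin k → V} {w : Fin k → ℤ}
    (hu : ∀ t, u t ∈ A.grading (w t)) (κ : Fin k → ℤ) :
    modeVec A u κ ∈ A.grading (∑ t, w t + ∑ t, κ t) := by
  have key : ∀ L : List (Fin k), modeList A (L.map fun t => (u t, -κ t - 1)) A.vacuum ∈
      A.grading ((L.map w).sum + (L.map κ).sum) := by
    intro L
    induction L with
    | nil => simpa [modeList] using A.vacuum_mem
    | cons t L ih =>
      have := Y_mem A (hu t) ih (-κ t - 1)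
      simp only [List.map_cons, modeList, LinearMap.comp_apply, modeY_apply, List.sum_cons]
      convert this using 2
      ring
  rw [Fin.sum_univ_def, Fin.sum_univ_def]
  exact key _

lemma coefE_eq_modeVec (A : GRVA V) (f : V →ₗ[ℂ] ℂ) {k : ℕ} (u : Fin k → V) (κ : Fin k → ℤ) :
    coefE A f u κ = f (modeVec A u κ) := rfl

lemma coefE_append (A : GRVA V) (f : V →ₗ[ℂ] ℂ) {l k : ℕ} (v : Fin l → V) (u : Fin k → V)
    (n : Fin l → ℤ) (κ : Fin k → ℤ) :
    coefE A f (Fin.append v u) (Fin.append n κ) =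
      f (modeList A ((List.finRange l).map fun t => (v t, -n t - 1)) (modeVec A u κ)) := by
  rw [coefE, modeVec, ← LinearMap.comp_apply (modeList A _), ← modeList_append]
  congr 2
  rw [← List.ofFn_eq_map, ← List.ofFn_eq_map, ← List.ofFn_eq_map, List.ofFn_add]
  congr 3
  · funext t
    change ((Fin.append v u (Fin.castAdd k t), -Fin.append n κ (Fin.castAdd k t) - 1) : V × ℤ) = _
    simp
  · funext t
    simp

lemma zmon_append {l k : ℕ} (x : Fin l → ℂ) (y : Fin k → ℂ) (n : Fin l → ℤ) (κ : Fin k → ℤ) :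
    zmon (Fin.append x y) (Fin.append n κ) = zmon x n * zmon y κ := by
  simp [zmon, Fin.prod_univ_add]

/-- Restriction of a polynomial to the hyperplane where the last variable vanishes. -/
def restrictLast {l : ℕ} (D : MvPolynomial (Fin (l + 1)) ℂ) : MvPolynomial (Fin l) ℂ :=
  MvPolynomial.bind₁ (Fin.append MvPolynomial.X fun _ : Fin 1 => 0) D

lemma eval_restrictLast {l : ℕ} (D : MvPolynomial (Fin (l + 1)) ℂ) (x : Fin l → ℂ) :
    MvPolynomial.eval x (restrictLast D) = MvPolynomial.eval (Fin.append x fun _ : Fin 1 => 0) D := by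
  rw [restrictLast, MvPolynomial.eval, MvPolynomial.eval₂Hom_bind₁, MvPolynomial.eval]
  congr 2
  funext i
  refine Fin.addCases (fun i => ?_) (fun i => ?_) i <;> simp

lemma mop_restrictLast {l : ℕ} (D : MvPolynomial (Fin (l + 1)) ℂ) (C : (Fin (l + 1) → ℤ) → ℂ)
    (hC : ∀ n, n (Fin.last l) < 0 → C n = 0) (n : Fin l → ℤ) :
    mop (restrictLast D) (fun n => C (Fin.append n fun _ : Fin 1 => 0)) n =
      mop D C (Fin.append n fun _ : Fin 1 => 0) := by
  induction D using MvPolynomial.induction_on' with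
  | add p q hp hq =>
    have : restrictLast (p + q) = restrictLast p + restrictLast q := by simp [restrictLast]
    rw [this, mop_add_left, mop_add_left, Pi.add_apply, Pi.add_apply, hp, hq]
  | monomial d a =>
    rw [mop_monomial]
    by_cases hd : d (Fin.last l) = 0
    · have h1 : restrictLast (MvPolynomial.monomial d a) = MvPolynomial.monomial
          (Finsupp.equivFunOnFinite.symm fun i => d (Fin.castAdd 1 i)) a := by
        rw [restrictLast, MvPolynomial.bind₁_monomial, MvPolynomial.monomial_eq]
        congr 1
        rw [Finsupp.prod_fintype _ _ (by simp)]
        rw [Finset.prod_subset (Finset.subset_univ _) (by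
          intro i _ hi
          rw [Finsupp.mem_support_iff, not_not] at hi
          rw [hi, pow_zero])]
        rw [Fin.prod_univ_add]
        simp [show (Fin.natAdd l (0 : Fin 1)) = Fin.last l from rfl, hd]
      rw [h1, mop_monomial]
      congr 2
      funext i
      refine Fin.addCases (fun i => ?_) (fun i => ?_) i
      · simp [zexp]
      · have : Fin.natAdd l i = Fin.last l := by
          rw [Subsingleton.elim i 0]; rfl
        simp only [Pi.sub_apply, Fin.append_right, zexp]
        rw [this, hd]; simp
    · have h1 : restrictLast (MvPolynomial.monomial d a) = 0 := by
        rw [restrictLast, MvPolynomial.bind₁_monomial]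
        rw [Finset.prod_eq_zero (i := Fin.last l) (by simpa using hd), mul_zero]
        rw [show Fin.last l = Fin.natAdd l (0 : Fin 1) from rfl, Fin.append_right, zero_pow]
        exact hd
      rw [h1, hC]
      · simp [mop]
      · simp only [Pi.sub_apply, zexp]
        rw [show Fin.last l = Fin.natAdd l (0 : Fin 1) from rfl, Fin.append_right]
        change (0 : ℤ) - (d (Fin.last l) : ℤ) < 0
        omega

lemma hasSum_mop {ι : Type} [Fintype ι] {C : (ι → ℤ) → ℂ} {z : ι → ℂ} {S : ℂ}
    (hz : ∀ t, z t ≠ 0) (h : HasSum (fun n => C n * zmon z n) S) (D : MvPolynomial ι ℂ) :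
    HasSum (fun n => mop D C n * zmon z n) (MvPolynomial.eval z D * S) := by
  rw [eval_eq_zmon, Finset.sum_mul]
  simp only [mop, Finset.sum_mul]
  refine hasSum_sum fun d _ => ?_
  have := h.mul_left (D.coeff d * zmon z (zexp d))
  rw [← (Equiv.subRight (zexp d)).hasSum_iff] at this
  refine this.congr_fun fun n => ?_
  have h2 : zmon z n = zmon z (n - zexp d) * zmon z (zexp d) := by
    rw [← zmon_add z hz, sub_add_cancel]
  simp only [Function.comp, Equiv.subRight_apply]
  rw [h2]; ring

lemma hasSum_emb {ι : Type} [Fintype ι] {z : ι → ℂ} (hz : ∀ t, z t ≠ 0) (P : MvPolynomial ι ℂ) :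
    HasSum (fun n => emb P n * zmon z n) (MvPolynomial.eval z P) := by
  rw [emb_eq_mop, ← mul_one (MvPolynomial.eval z P)]
  refine hasSum_mop hz ?_ P
  have h := hasSum_single (f := fun n => (Pi.single 0 1 : (ι → ℤ) → ℂ) n * zmon z n) 0
    fun n hn => by rw [Pi.single_eq_of_ne hn, zero_mul]
  rw [Pi.single_eq_same, one_mul, show zmon z 0 = 1 by simp [zmon]] at h
  refine h.congr_fun fun n => ?_
  congr!

lemma exists_pos_lt_norm {l : ℕ} {x : Fin l → ℂ} (hx0 : ∀ t, x t ≠ 0) :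
    ∃ ε : ℝ, 0 < ε ∧ ∀ t, ε < ‖x t‖ := by
  induction l with
  | zero => exact ⟨1, one_pos, fun t => t.elim0⟩
  | succ l ih =>
    obtain ⟨ε, h1, h2⟩ := ih (x := fun t => x t.succ) fun t => hx0 _
    have h3 : 0 < ‖x 0‖ := norm_pos_iff.mpr (hx0 0)
    refine ⟨min ε (‖x 0‖ / 2), by positivity, Fin.cases ?_ fun t => ?_⟩
    · exact (min_le_right _ _).trans_lt (by linarith)
    · exact (min_le_left _ _).trans_lt (h2 t)

lemma strictAnti_norm_append {l k : ℕ} {x : Fin l → ℂ} {y : Fin k → ℂ}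
    (hx : StrictAnti fun t => ‖x t‖) (hy : StrictAnti fun t => ‖y t‖)
    (hxy : ∀ i j, ‖y j‖ < ‖x i‖) : StrictAnti fun t => ‖Fin.append x y t‖ := by
  intro s t
  refine Fin.addCases (fun s => ?_) (fun s => ?_) s <;>
    refine Fin.addCases (fun t => ?_) (fun t => ?_) t <;> intro hst <;>
    simp only [Fin.append_left, Fin.append_right]
  · exact hx hst
  · exact hxy _ _
  · have := Fin.lt_def.mp hst
    simp only [Fin.val_natAdd, Fin.val_castAdd] at this
    omega
  · have := Fin.lt_def.mp hst
    simp only [Fin.val_natAdd] at this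
    exact hy (Fin.lt_def.mpr (by omega))

lemma append_ne_zero {l k : ℕ} {x : Fin l → ℂ} {y : Fin k → ℂ} (hx : ∀ t, x t ≠ 0)
    (hy : ∀ t, y t ≠ 0) (t : Fin (l + k)) : Fin.append x y t ≠ 0 := by
  refine Fin.addCases (fun t => ?_) (fun t => ?_) t
  · simpa using hx t
  · simpa using hy t

lemma injective_of_strictAnti_norm {ι : Type} [LinearOrder ι] {x : ι → ℂ} (hx : StrictAnti fun t => ‖x t‖) :
    Function.Injective x := fun s t hst => hx.injective (by simp [hst])

lemma injective_append_zero {l : ℕ} {x : Fin l → ℂ} (hx : Function.Injective x)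
    (hx0 : ∀ t, x t ≠ 0) : Function.Injective (Fin.append x fun _ : Fin 1 => (0 : ℂ)) :=
  Fin.append_injective_iff.mpr ⟨hx, Function.injective_of_subsingleton _, fun i _ => hx0 i⟩

variable {A : GRVA V} {EV : ∀ l : ℕ, (Fin l → V) → (Fin l → ℂ) → VbarT A}

lemma EV_creation (hEV : IsEVFam A EV) {l : ℕ} (v : Fin l → V) (e : V) {f : V →ₗ[ℂ] ℂ}
    (hf : GradedFunctionalZ A.grading f) {x : Fin l → ℂ} (hx : StrictAnti fun t => ‖x t‖)
    (hx0 : ∀ t, x t ≠ 0) :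
    HasSum (fun n => f (modeList A ((List.finRange l).map fun t => (v t, -n t - 1)) e) * zmon x n)
      (pairBarV f (EV (l + 1) (Fin.append v fun _ : Fin 1 => e)
        (Fin.append x fun _ : Fin 1 => 0))) := by
  obtain ⟨P, N, h1, h2⟩ := EV_formal hEV (Fin.append v fun _ : Fin 1 => e) hf
  set C := coefE A f (Fin.append v fun _ : Fin 1 => e) with hCdef
  have hC : ∀ n : Fin (l + 1) → ℤ, n (Fin.last l) < 0 → C n = 0 := by
    intro n hn
    rw [← Fin.append_castAdd_natAdd (f := n), hCdef, coefE_append]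
    have : modeVec A (fun _ : Fin 1 => e) (fun i => n (Fin.natAdd l i)) = 0 := by
      have h0 : n (Fin.natAdd l 0) < 0 := hn
      simp only [modeVec, List.finRange_succ, List.finRange_zero, List.map_nil, List.map_cons,
        modeList, LinearMap.comp_apply, LinearMap.id_apply, modeY_apply]
      exact A.creation _ _ (by omega)
    rw [this, map_zero, map_zero]
  have hC0 : (fun n => C (Fin.append n fun _ : Fin 1 => 0)) = fun n =>
      f (modeList A ((List.finRange l).map fun t => (v t, -n t - 1)) e) := by
    funext n
    rw [hCdef, coefE_append]
    congr 2
    simp only [modeVec, List.finRange_succ, List.finRange_zero, List.map_nil, List.map_cons,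
      modeList, LinearMap.comp_apply, LinearMap.id_apply, modeY_apply]
    simpa using A.creation_lim e
  have h3 : mop (restrictLast (diagPoly (l + 1) N)) (fun n => C (Fin.append n fun _ : Fin 1 => 0)) =
      emb (restrictLast P) := by
    funext n
    rw [mop_restrictLast _ _ hC, h1, emb_eq_mop, emb_eq_mop]
    refine Eq.trans (mop_restrictLast _ _ (fun n hn => ?_) n).symm ?_
    · dsimp only [Pi.single, Function.update]
      rw [dif_neg]
      · rfl
      · rintro rfl; simp at hn
    congr 1
    funext m
    simp only [Pi.single, Function.update, eq_rec_constant, Pi.zero_apply, dite_eq_ite]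
    congr 1
    refine propext ⟨fun h => ?_, fun h => ?_⟩
    · funext i; simpa using congrFun h (Fin.castAdd 1 i)
    · subst h
      funext i
      refine Fin.addCases (fun t => ?_) (fun t => ?_) i <;> simp
  obtain ⟨ε, hε, hε'⟩ := exists_pos_lt_norm hx0
  have hs : Summable fun n => C (Fin.append n fun _ : Fin 1 => 0) * zmon x n := by
    have h4 := ((EV_spec hEV (Fin.append v fun _ : Fin 1 => e) hf).1
      (Fin.append x fun _ : Fin 1 => (ε : ℂ))
      (strictAnti_norm_append hx (fun s t h => absurd h (by simp [Subsingleton.elim s t]))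
        fun i _ => by simpa [abs_of_pos hε] using hε' i)
      (append_ne_zero hx0 fun _ => by simpa using hε.ne')).summable
    have h5 := h4.comp_injective (i := fun n : Fin l → ℤ => Fin.append n fun _ : Fin 1 => (0 : ℤ))
      (fun a b h => by
        funext i; simpa using congrFun h (Fin.castAdd 1 i))
    refine h5.congr fun n => ?_
    simp only [Function.comp, zmon_append]
    simp [zmon, hCdef]
  have h6 := hasSum_mop hx0 hs.hasSum (restrictLast (diagPoly (l + 1) N))
  rw [h3] at h6
  have h7 := h6.unique (hasSum_emb hx0 _)
  have hinj := injective_append_zero (injective_of_strictAnti_norm hx) hx0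
  rw [eval_restrictLast, eval_restrictLast, ← h2 _ hinj, mul_comm] at h7
  have h8 := mul_right_cancel₀ (eval_diagPoly_ne_zero _ _ hinj) h7
  rw [← h8]
  exact hs.hasSum.congr_fun fun n => by rw [← congrFun hC0 n]

/-- Evaluating the last argument at the origin, as a linear functional of the last vector. -/
lemma exists_lastFunctional (hEV : IsEVFam A EV) {l : ℕ} (v : Fin l → V) {f : V →ₗ[ℂ] ℂ}
    (hf : GradedFunctionalZ A.grading f) {x : Fin l → ℂ} (hx : Function.Injective x)
    (hx0 : ∀ t, x t ≠ 0) : ∃ g : V →ₗ[ℂ] ℂ, ∀ e, g e =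
      pairBarV f (EV (l + 1) (Fin.append v fun _ : Fin 1 => e)
        (Fin.append x fun _ : Fin 1 => 0)) := by
  obtain ⟨ρ, hρ, hρ'⟩ := exists_strictAnti l
  have hr : ∀ e, RatOn {x : Fin l → ℂ | Function.Injective x ∧ ∀ t, x t ≠ 0} fun x =>
      pairBarV f (EV (l + 1) (Fin.append v fun _ : Fin 1 => e)
        (Fin.append x fun _ : Fin 1 => 0)) := fun e => by
    have key : ∀ y : Fin l → ℂ, (fun i => MvPolynomial.eval y ((Fin.append MvPolynomial.X
        fun _ : Fin 1 => 0 : Fin (l + 1) → MvPolynomial (Fin l) ℂ) i)) =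
        Fin.append y fun _ : Fin 1 => 0 := fun y => by
      funext i
      refine Fin.addCases (fun t => ?_) (fun t => ?_) i <;> simp
    refine ((EV_ratOn hEV (Fin.append v fun _ : Fin 1 => e) hf).comp
      (Fin.append MvPolynomial.X fun _ : Fin 1 => 0) (fun y hy => ?_)).congr fun y hy => ?_
    · rw [key]; exact injective_append_zero hy.1 hy.2
    · rw [key]
  have hU : ∀ z : Fin l → ℂ, (∀ t, ‖z t‖ = ρ t) →
      z ∈ {x : Fin l → ℂ | Function.Injective x ∧ ∀ t, x t ≠ 0} := fun z hz =>
    ⟨injective_of_norm hρ'.injective hz, ne_zero_of_norm hρ hz⟩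
  have hanti : ∀ z : Fin l → ℂ, (∀ t, ‖z t‖ = ρ t) → StrictAnti fun t => ‖z t‖ := fun z hz s t h => by
    simpa [hz] using hρ' h
  refine ⟨⟨⟨fun e => pairBarV f (EV (l + 1) (Fin.append v fun _ : Fin 1 => e)
        (Fin.append x fun _ : Fin 1 => 0)), fun e e' => ?_⟩, fun c e => ?_⟩, fun e => rfl⟩
  · refine (hr (e + e')).eq_of_torus ((hr e).add (hr e')) ρ hρ hU (fun z hz => ?_) ⟨hx, hx0⟩
    refine (EV_creation hEV v _ hf (hanti z hz) (ne_zero_of_norm hρ hz)).unique ?_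
    refine ((EV_creation hEV v e hf (hanti z hz) (ne_zero_of_norm hρ hz)).add
      (EV_creation hEV v e' hf (hanti z hz) (ne_zero_of_norm hρ hz))).congr_fun fun n => ?_
    rw [map_add, map_add, add_mul]
  · refine (hr (c • e)).eq_of_torus ((RatOn.const c).mul (hr e)) ρ hρ hU (fun z hz => ?_) ⟨hx, hx0⟩
    refine (EV_creation hEV v _ hf (hanti z hz) (ne_zero_of_norm hρ hz)).unique ?_
    refine ((EV_creation hEV v e hf (hanti z hz) (ne_zero_of_norm hρ hz)).mul_left c).congr_fun
      fun n => ?_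
    rw [map_smul, map_smul, smul_eq_mul, mul_assoc]

end Append

section Expand
variable {V : Type} [AddCommGroup V] [Module ℂ V]
variable {A : GRVA V} {EV : ∀ l : ℕ, (Fin l → V) → (Fin l → ℂ) → VbarT A}

lemma eq_of_forall_functional {u w : V} (h : ∀ g : V →ₗ[ℂ] ℂ, g u = g w) : u = w := by
  rw [← sub_eq_zero, ← Module.forall_dual_apply_eq_zero_iff ℂ]
  intro g
  rw [map_sub, h g, sub_self]

lemma zmon_mul_left {ι : Type} [Fintype ι] {b : ℂ} (hb : b ≠ 0) (y : ι → ℂ) (κ : ι → ℤ) :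
    zmon (fun t => b * y t) κ = b ^ (∑ t, κ t) * zmon y κ := by
  simp only [zmon, mul_zpow, Finset.prod_mul_distrib]
  congr 1
  have : ∀ s : Finset ι, ∏ t ∈ s, b ^ κ t = b ^ ∑ t ∈ s, κ t := fun s => by
    induction s using Finset.induction_on with
    | empty => simp
    | insert a s ha ih => rw [Finset.prod_insert ha, Finset.sum_insert ha, ih, zpow_add₀ hb]
  exact this _

lemma coefE_comp_gproj {k : ℕ} {u : Fin k → V} {w : Fin k → ℤ}
    (hu : ∀ t, u t ∈ A.grading (w t)) (g : V →ₗ[ℂ] ℂ) (r : ℤ) (κ : Fin k → ℤ) :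
    coefE A (g ∘ₗ gproj A r) u κ = if ∑ t, κ t = r - ∑ t, w t then g (modeVec A u κ) else 0 := by
  rw [coefE_eq_modeVec, LinearMap.comp_apply, gproj_of_mem A (modeVec_mem A hu κ)]
  by_cases h : ∑ t, κ t = r - ∑ t, w t
  · rw [if_pos h, if_pos (by rw [h]; ring)]
  · rw [if_neg h, if_neg (fun h' => h (by rw [h']; ring)), map_zero]

/-- Homogeneity of the components of products of vertex operators. -/
theorem EV_mul_left (hEV : IsEVFam A EV) {k : ℕ} {u : Fin k → V} {w : Fin k → ℤ}
    (hu : ∀ t, u t ∈ A.grading (w t)) {y : Fin k → ℂ} (hy : Function.Injective y) {b : ℂ}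
    (hb : b ≠ 0) (r : ℤ) :
    (EV k u (fun t => b * y t) r : V) = b ^ (r - ∑ t, w t) • (EV k u y r : V) := by
  refine eq_of_forall_functional fun g => ?_
  rw [map_smul, ← pairBarV_comp_gproj, ← pairBarV_comp_gproj, smul_eq_mul]
  have hf := gradedFunctionalZ_comp_gproj A g r
  obtain ⟨ρ, hρ, hρ'⟩ := exists_strictAnti k
  have h1 : RatOn {y : Fin k → ℂ | Function.Injective y} fun y =>
      pairBarV (g ∘ₗ gproj A r) (EV k u fun t => b * y t) := by
    refine ((EV_ratOn hEV u hf).comp (fun t => MvPolynomial.C b * MvPolynomial.X t)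
      fun y hy => ?_).congr fun y hy => by simp
    intro s t hst
    simp only [map_mul, MvPolynomial.eval_C, MvPolynomial.eval_X] at hst
    exact hy (mul_left_cancel₀ hb hst)
  refine h1.eq_of_torus ((RatOn.const _).mul (EV_ratOn hEV u hf)) ρ hρ
    (fun z hz => injective_of_norm hρ'.injective hz) (fun z hz => ?_) hy
  have hz0 := ne_zero_of_norm hρ hz
  have hanti : StrictAnti fun t => ‖z t‖ := fun s t h => by simpa [hz] using hρ' h
  refine ((EV_spec hEV u hf).1 (fun t => b * z t) (fun s t h => ?_)
    (fun t => mul_ne_zero hb (hz0 t))).unique ?_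
  · simp only [norm_mul]
    exact mul_lt_mul_of_pos_left (hanti h) (norm_pos_iff.mpr hb)
  · refine (((EV_spec hEV u hf).1 z hanti hz0).mul_left (b ^ (r - ∑ t, w t))).congr_fun fun κ => ?_
    rw [coefE_comp_gproj hu, zmon_mul_left hb]
    split_ifs with h
    · rw [h]; ring
    · ring

lemma hasSum_of_fibers {κ : Type} {a : κ → ℂ} {S : ℂ} (φ : κ → ℤ) (h : HasSum a S) {H : ℤ → ℂ}
    (hH : ∀ T, HasSum (fun k => if φ k = T then a k else 0) (H T)) : HasSum H S := by
  have h1 : HasSum (fun p : ℤ × κ => if φ p.2 = p.1 then a p.2 else 0) S := by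
    have hinj : Function.Injective fun k => (φ k, k) := fun k k' h => (Prod.ext_iff.mp h).2
    rw [← hinj.hasSum_iff]
    · simpa [Function.comp_def] using h
    · rintro ⟨T, k⟩ hk
      rw [if_neg]
      intro h
      exact hk ⟨k, Prod.ext h rfl⟩
  exact h1.prod_fiberwise hH

/-- The configurations of the first `l` points away from the origin, and of the last `k` points. -/
def splitConf (l k : ℕ) : Set (Fin (l + k) → ℂ) :=
  {z | (Function.Injective fun i => z (Fin.castAdd k i)) ∧ (∀ i, z (Fin.castAdd k i) ≠ 0) ∧
    Function.Injective fun j => z (Fin.natAdd l j)}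

lemma EV_iterate_ratOn (hEV : IsEVFam A EV) {l k : ℕ} (v : Fin l → V) (u : Fin k → V)
    {f : V →ₗ[ℂ] ℂ} (hf : GradedFunctionalZ A.grading f) (r : ℤ) :
    RatOn (splitConf l k) fun z => pairBarV f (EV (l + 1)
      (Fin.append v fun _ : Fin 1 => (EV k u (fun j => z (Fin.natAdd l j)) r : V))
      (Fin.append (fun i => z (Fin.castAdd k i)) fun _ : Fin 1 => 0)) := by
  have := A.finiteDim r
  let B := Module.finBasis ℂ (A.grading r)
  let pr : V →ₗ[ℂ] A.grading r := LinearMap.codRestrict (A.grading r) (gproj A r) (gproj_mem A r)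
  have h1 : ∀ j, RatOn (splitConf l k) fun z =>
      pairBarV ((B.coord j ∘ₗ pr) ∘ₗ gproj A r) (EV k u fun j => z (Fin.natAdd l j)) := fun j => by
    refine ((EV_ratOn hEV u (gradedFunctionalZ_comp_gproj A (B.coord j ∘ₗ pr) r)).comp
      (fun j => MvPolynomial.X (Fin.natAdd l j)) fun z hz => ?_).congr fun z hz => by simp
    simpa using hz.2.2
  have h2 : ∀ e, RatOn (splitConf l k) fun z => pairBarV f (EV (l + 1)
      (Fin.append v fun _ : Fin 1 => e)
      (Fin.append (fun i => z (Fin.castAdd k i)) fun _ : Fin 1 => 0)) := fun e => by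
    have key : ∀ z : Fin (l + k) → ℂ, (fun i => MvPolynomial.eval z
        ((Fin.append (fun i => MvPolynomial.X (Fin.castAdd k i))
        fun _ : Fin 1 => 0 : Fin (l + 1) → MvPolynomial (Fin (l + k)) ℂ) i)) =
        Fin.append (fun i => z (Fin.castAdd k i)) fun _ : Fin 1 => 0 := fun z => by
      funext i
      refine Fin.addCases (fun t => ?_) (fun t => ?_) i <;> simp
    refine ((EV_ratOn hEV (Fin.append v fun _ : Fin 1 => e) hf).comp
      (Fin.append (fun i => MvPolynomial.X (Fin.castAdd k i)) fun _ : Fin 1 => 0)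
      (fun z hz => ?_)).congr fun z hz => ?_
    · rw [key]; exact injective_append_zero hz.1 hz.2.1
    · rw [key]
  refine (RatOn.sum Finset.univ fun j _ => (h1 j).mul (h2 (B j))).congr fun z hz => ?_
  obtain ⟨g, hg⟩ := exists_lastFunctional hEV v hf hz.1 hz.2.1
  simp only [← hg, pairBarV_comp_gproj]
  set ω := EV k u fun j => z (Fin.natAdd l j)
  have h3 : pr (ω r : V) = ω r := by
    apply Subtype.ext
    change gproj A r _ = _
    rw [gproj_of_mem A (ω r).2, if_pos rfl]
  have h4 := congrArg (fun s : A.grading r => g s) (B.sum_repr (ω r))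
  simp only [Submodule.coe_sum, Submodule.coe_smul, map_sum, map_smul, smul_eq_mul] at h4
  rw [← h4]
  simp [h3]

end Expand

section Expand0
variable {V : Type} [AddCommGroup V] [Module ℂ V]
variable {A : GRVA V} {EV : ∀ l : ℕ, (Fin l → V) → (Fin l → ℂ) → VbarT A}

/-- Products of vertex operators expanded in the homogeneous components of the product of the
last `k` operators. -/
lemma EV_iterate_hasSum (hEV : IsEVFam A EV) {l k : ℕ} (v : Fin l → V) {u : Fin k → V}
    {w : Fin k → ℤ} (hu : ∀ t, u t ∈ A.grading (w t)) {f : V →ₗ[ℂ] ℂ}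
    (hf : GradedFunctionalZ A.grading f) {x : Fin l → ℂ} (hx : StrictAnti fun t => ‖x t‖)
    (hx0 : ∀ t, x t ≠ 0) {y : Fin k → ℂ} (hy : StrictAnti fun t => ‖y t‖) (hy0 : ∀ t, y t ≠ 0)
    (hxy : ∀ i j, ‖y j‖ < ‖x i‖) {b : ℂ} (hb : ‖b‖ = 1) :
    HasSum (fun T : ℤ => pairBarV f (EV (l + 1)
        (Fin.append v fun _ : Fin 1 => (EV k u y (T + ∑ t, w t) : V))
        (Fin.append x fun _ : Fin 1 => 0)) * b ^ T)
      (pairBarV f (EV (l + k) (Fin.append v u) (Fin.append x fun t => b * y t))) := by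
  have hb0 : b ≠ 0 := fun h => by simp [h] at hb
  have hby : StrictAnti fun t => ‖b * y t‖ := by simpa [hb] using hy
  have hby0 : ∀ t, b * y t ≠ 0 := fun t => mul_ne_zero hb0 (hy0 t)
  obtain ⟨g, hg⟩ := exists_lastFunctional hEV v hf (injective_of_strictAnti_norm hx) hx0
  have h0 := (EV_spec hEV (Fin.append v u) hf).1 (Fin.append x fun t => b * y t)
    (strictAnti_norm_append hx hby fun i j => by simpa [hb] using hxy i j)
    (append_ne_zero hx0 hby0)
  rw [← (Fin.appendEquiv (α := ℤ) l k).hasSum_iff,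
    ← (Equiv.prodComm (Fin k → ℤ) (Fin l → ℤ)).hasSum_iff] at h0
  have h2 := h0.prod_fiberwise (g := fun κ => g (modeVec A u κ) * zmon (fun t => b * y t) κ)
    fun κ => by
      rw [hg]
      refine ((EV_creation hEV v (modeVec A u κ) hf hx hx0).mul_right
        (zmon (fun t => b * y t) κ)).congr_fun fun n => ?_
      change coefE A f (Fin.append v u) (Fin.append n κ) * zmon _ (Fin.append n κ) = _
      rw [coefE_append, zmon_append]
      ring
  refine hasSum_of_fibers (fun κ : Fin k → ℤ => ∑ t, κ t) h2 fun T => ?_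
  have h3 := (EV_spec hEV u (gradedFunctionalZ_comp_gproj A g (T + ∑ t, w t))).1 _ hby hby0
  rw [pairBarV_comp_gproj, EV_mul_left hEV hu (injective_of_strictAnti_norm hy) hb0, map_smul,
    hg, smul_eq_mul, mul_comm, add_sub_cancel_right] at h3
  refine h3.congr_fun fun κ => ?_
  rw [coefE_comp_gproj hu, add_sub_cancel_right]
  split_ifs with h
  · rfl
  · rw [zero_mul]


/-- Total degree of an exponent in the last `k` variables. -/
def lastDegree (l : ℕ) {k : ℕ} (d : Fin (l + k) →₀ ℕ) : ℕ := ∑ j : Fin k, d (Fin.natAdd l j)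

lemma prod_append_mul_pow {l k : ℕ} (x : Fin l → ℂ) (y : Fin k → ℂ) (b : ℂ)
    (d : Fin (l + k) →₀ ℕ) : ∏ t, (Fin.append x fun t => b * y t) t ^ d t =
      b ^ lastDegree l d * ∏ t, Fin.append x y t ^ d t := by
  simp only [Fin.prod_univ_add, Fin.append_left, Fin.append_right, mul_pow,
    Finset.prod_mul_distrib, lastDegree, Finset.prod_pow_eq_pow_sum]
  ring

lemma append_castAdd_natAdd {l k : ℕ} (z : Fin (l + k) → ℂ) :
    Fin.append (fun i => z (Fin.castAdd k i)) (fun j => z (Fin.natAdd l j)) = z :=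
  Fin.append_castAdd_natAdd

lemma EV_iterate_relation (hEV : IsEVFam A EV) {l k : ℕ} (v : Fin l → V) {u : Fin k → V}
    {w : Fin k → ℤ} (hu : ∀ t, u t ∈ A.grading (w t)) {f : V →ₗ[ℂ] ℂ}
    (hf : GradedFunctionalZ A.grading f) (D P : MvPolynomial (Fin (l + k)) ℂ)
    (h : ∀ x, Function.Injective x →
      pairBarV f (EV (l + k) (Fin.append v u) x) * MvPolynomial.eval x D = MvPolynomial.eval x P)
    {z : Fin (l + k) → ℂ} (hz : z ∈ splitConf l k) (T : ℤ) :
    ∑ d ∈ D.support, D.coeff d * (∏ t, z t ^ d t) * pairBarV f (EV (l + 1)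
        (Fin.append v fun _ : Fin 1 =>
          (EV k u (fun j => z (Fin.natAdd l j)) (T - lastDegree l d + ∑ t, w t) : V))
        (Fin.append (fun i => z (Fin.castAdd k i)) fun _ : Fin 1 => 0)) =
      ∑ d ∈ P.support, if (lastDegree l d : ℤ) = T then P.coeff d * ∏ t, z t ^ d t else 0 := by
  obtain ⟨ρ, hρ, hρ'⟩ := exists_strictAnti (l + k)
  have hmon : ∀ (a : ℂ) (d : Fin (l + k) →₀ ℕ), RatOn (splitConf l k) fun z => a * ∏ t, z t ^ d t :=
    fun a d => (RatOn.poly (MvPolynomial.monomial d a)).congr fun z _ => by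
      simp [MvPolynomial.eval_monomial, Finsupp.prod_fintype]
  have h1 : RatOn (splitConf l k) fun z => ∑ d ∈ D.support, D.coeff d * (∏ t, z t ^ d t) *
      pairBarV f (EV (l + 1) (Fin.append v fun _ : Fin 1 =>
          (EV k u (fun j => z (Fin.natAdd l j)) (T - lastDegree l d + ∑ t, w t) : V))
        (Fin.append (fun i => z (Fin.castAdd k i)) fun _ : Fin 1 => 0)) :=
    RatOn.sum _ fun d _ => (hmon _ d).mul (EV_iterate_ratOn hEV v u hf _)
  have h2 : RatOn (splitConf l k) fun z => ∑ d ∈ P.support,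
      if (lastDegree l d : ℤ) = T then P.coeff d * ∏ t, z t ^ d t else 0 := by
    refine RatOn.sum _ fun d _ => ?_
    split_ifs
    · exact hmon _ d
    · exact RatOn.const 0
  refine h1.eq_of_torus h2 ρ hρ (fun z hz => ?_) (fun z hz => ?_) hz
  · have hinj := injective_of_norm hρ'.injective hz
    exact ⟨fun i j hij => Fin.castAdd_injective _ _ (hinj hij),
      fun i => ne_zero_of_norm hρ hz _, fun i j hij => Fin.natAdd_injective _ _ (hinj hij)⟩
  have hz0 := ne_zero_of_norm hρ hz
  have hanti : StrictAnti fun t => ‖z t‖ := fun s t hst => by simpa [hz] using hρ' hst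
  have hx : StrictAnti fun i => ‖z (Fin.castAdd k i)‖ := fun i j hij => hanti (Fin.lt_def.mpr hij)
  have hy : StrictAnti fun j => ‖z (Fin.natAdd l j)‖ := fun i j hij => hanti (by simpa using hij)
  have hxy : ∀ i j, ‖z (Fin.natAdd l j)‖ < ‖z (Fin.castAdd k i)‖ := fun i j =>
    hanti (by rw [Fin.lt_def]; simp; omega)
  have key := laurent_coeff_relation (ι := Unit) (fun _ => 1) (fun _ => one_pos) D.support
    (fun d => D.coeff d * ∏ t, z t ^ d t) (fun d _ => (lastDegree l d : ℤ))
    (fun _ b => pairBarV f (EV (l + k) (Fin.append v u)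
      (Fin.append (fun i => z (Fin.castAdd k i)) fun j => b () * z (Fin.natAdd l j))))
    (fun _ T => pairBarV f (EV (l + 1) (Fin.append v fun _ : Fin 1 =>
          (EV k u (fun j => z (Fin.natAdd l j)) (T () + ∑ t, w t) : V))
        (Fin.append (fun i => z (Fin.castAdd k i)) fun _ : Fin 1 => 0)))
    (fun d _ b hb => by
      have := EV_iterate_hasSum hEV v hu hf hx (fun i => hz0 _) hy (fun j => hz0 _) hxy (hb ())
      rw [← (Equiv.funUnique Unit ℤ).hasSum_iff] at this
      refine this.congr_fun fun T => ?_
      simp [zmon])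
    P.support (fun d => P.coeff d * ∏ t, z t ^ d t) (fun d _ => (lastDegree l d : ℤ))
    (fun b hb => ?_) (fun _ => T)
  · simpa [funext_iff] using key
  · have hb0 : b () ≠ 0 := fun h => by simpa [h] using hb ()
    have hinj : Function.Injective
        (Fin.append (fun i => z (Fin.castAdd k i)) fun j => b () * z (Fin.natAdd l j)) := by
      refine injective_of_strictAnti_norm (strictAnti_norm_append hx ?_ ?_)
      · simpa [hb ()] using hy
      · intro i j
        simpa [hb ()] using hxy i j
    have h3 := h _ hinj
    rw [MvPolynomial.eval_eq', MvPolynomial.eval_eq', Finset.mul_sum] at h3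
    simp only [prod_append_mul_pow, append_castAdd_natAdd] at h3
    calc _ = _ := Finset.sum_congr rfl fun d _ => ?_
      _ = _ := h3
      _ = _ := Finset.sum_congr rfl fun d _ => ?_
    · simp [zmon]; ring
    · simp [zmon]; ring

lemma VbarT_eq_zero_of_lt (A : GRVA V) : ∃ N : ℤ, ∀ (ω : VbarT A) (k : ℤ), k < N → (ω k : V) = 0 := by
  obtain ⟨N, hN⟩ := A.lower_bounded
  exact ⟨N, fun ω k hk => by simpa [hN k hk] using (ω k).2⟩

lemma injective_append_mul_eventually {l k : ℕ} {x : Fin l → ℂ} (hx : Function.Injective x)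
    (hx0 : ∀ t, x t ≠ 0) {y : Fin k → ℂ} (hy : Function.Injective y) :
    ∀ᶠ b in nhdsWithin (0 : ℂ) {0}ᶜ, Function.Injective (Fin.append x fun t => b * y t) := by
  have h1 : ∀ᶠ b in nhdsWithin (0 : ℂ) {0}ᶜ, ∀ i j, x i ≠ b * y j := by
    rw [Filter.eventually_all]
    intro i
    rw [Filter.eventually_all]
    intro j
    refine Filter.Eventually.filter_mono nhdsWithin_le_nhds ?_
    have hc : ContinuousAt (fun b : ℂ => b * y j) 0 := by fun_prop
    have := hc.eventually_ne (y := x i) (by simpa using (hx0 i).symm)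
    exact this.mono fun b hb => hb.symm
  filter_upwards [h1, self_mem_nhdsWithin] with b hb hb0
  exact Fin.append_injective_iff.mpr ⟨hx, fun s t hst => hy (mul_left_cancel₀ hb0 hst), hb⟩

theorem EV_expand_zero (hEV : IsEVFam A EV) {l k : ℕ} (v : Fin l → V) {u : Fin k → V}
    {w : Fin k → ℤ} (hu : ∀ t, u t ∈ A.grading (w t)) {f : V →ₗ[ℂ] ℂ}
    (hf : GradedFunctionalZ A.grading f) {x : Fin l → ℂ} (hx : Function.Injective x)
    (hx0 : ∀ t, x t ≠ 0) {y : Fin k → ℂ} (hy : Function.Injective y) :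
    ∃ h : LaurentSeries ℂ, (∀ T, h.coeff T = pairBarV f (EV (l + 1)
        (Fin.append v fun _ : Fin 1 => (EV k u y (T + ∑ t, w t) : V))
        (Fin.append x fun _ : Fin 1 => 0))) ∧
      ExpandsTo (fun b => pairBarV f (EV (l + k) (Fin.append v u)
        (Fin.append x fun t => b * y t))) h := by
  obtain ⟨g, hg⟩ := exists_lastFunctional hEV v hf hx hx0
  obtain ⟨N₀, hN₀⟩ := VbarT_eq_zero_of_lt A
  have hbdd : BddBelow (Function.support fun T : ℤ => g (EV k u y (T + ∑ t, w t) : V)) :=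
    ⟨N₀ - ∑ t, w t, fun T hT => by
      by_contra h
      exact hT (by simp only; rw [hN₀ _ _ (by linarith), map_zero])⟩
  refine ⟨HahnSeries.ofSuppBddBelow _ hbdd, fun T => by
    rw [HahnSeries.coeff_ofSuppBddBelow, hg], ?_⟩
  obtain ⟨P, N, hP⟩ := (EV_spec hEV (Fin.append v u) hf).2
  set D := diagPoly (l + k) N with hD
  have hconf : Fin.append x y ∈ splitConf l k := by
    refine ⟨?_, ?_, ?_⟩ <;> simpa [Fin.append_left, Fin.append_right]
  have heval : ∀ (Q : MvPolynomial (Fin (l + k)) ℂ) (b : ℂ), (∑ d ∈ Q.support,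
      Polynomial.monomial (lastDegree l d) (Q.coeff d * ∏ t, Fin.append x y t ^ d t)).eval b =
      MvPolynomial.eval (Fin.append x fun t => b * y t) Q := fun Q b => by
    rw [MvPolynomial.eval_eq', Polynomial.eval_finsetSum]
    refine Finset.sum_congr rfl fun d _ => ?_
    rw [prod_append_mul_pow, Polynomial.eval_monomial]
    ring
  refine ⟨∑ d ∈ D.support, Polynomial.monomial (lastDegree l d)
      (D.coeff d * ∏ t, Fin.append x y t ^ d t),
    ∑ d ∈ P.support, Polynomial.monomial (lastDegree l d)
      (P.coeff d * ∏ t, Fin.append x y t ^ d t), ?_, ?_, ?_⟩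
  · intro h0
    obtain ⟨b, hb⟩ := (injective_append_mul_eventually hx hx0 hy).exists
    have h1 := heval D b
    rw [h0, Polynomial.eval_zero] at h1
    exact eval_diagPoly_ne_zero _ N hb h1.symm
  · filter_upwards [injective_append_mul_eventually hx hx0 hy] with b hb
    rw [heval, heval, hP _ hb]
  · ext T
    have h1 := EV_iterate_relation hEV v hu hf D P hP hconf T
    simp only [Fin.append_left, Fin.append_right] at h1
    simp only [map_sum, polyL_monomial, Finset.sum_mul, HahnSeries.coeff_sum]
    calc _ = _ := Finset.sum_congr rfl fun d _ => ?_
      _ = _ := h1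
      _ = _ := Finset.sum_congr rfl fun d _ => ?_
    · have := HahnSeries.coeff_single_mul_add (r := D.coeff d * ∏ t, Fin.append x y t ^ d t)
        (x := HahnSeries.ofSuppBddBelow _ hbdd) (a := T - lastDegree l d) (b := (lastDegree l d : ℤ))
      rw [sub_add_cancel] at this
      rw [this, HahnSeries.coeff_ofSuppBddBelow, hg]
    · rw [HahnSeries.coeff_single]
      simp [eq_comm]

end Expand0

section Expand
variable {V : Type} [AddCommGroup V] [Module ℂ V]
variable {A : GRVA V} {EV : ∀ l : ℕ, (Fin l → V) → (Fin l → ℂ) → VbarT A}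

/-- A cluster of `k` points shrinking to the point `c` is expanded in the homogeneous components
of the product of the corresponding `k` operators. -/
theorem EV_expand (hEV : IsEVFam A EV) {l k : ℕ} (v : Fin l → V) {u : Fin k → V}
    {w : Fin k → ℤ} (hu : ∀ t, u t ∈ A.grading (w t)) {f : V →ₗ[ℂ] ℂ}
    (hf : GradedFunctionalZ A.grading f) {x : Fin l → ℂ} (hx : Function.Injective x) {c : ℂ}
    (hxc : ∀ t, x t ≠ c) {y : Fin k → ℂ} (hy : Function.Injective y) :
    ∃ h : LaurentSeries ℂ, (∀ T, h.coeff T = pairBarV f (EV (l + 1)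
        (Fin.append v fun _ : Fin 1 => (EV k u y (T + ∑ t, w t) : V))
        (Fin.append x fun _ : Fin 1 => c))) ∧
      ExpandsTo (fun b => pairBarV f (EV (l + k) (Fin.append v u)
        (Fin.append x fun t => c + b * y t))) h := by
  obtain ⟨M, hM⟩ := EV_translate hEV hf
  have hx' : Function.Injective fun i => x i - c := fun i j hij => hx (sub_left_injective hij)
  have hx0 : ∀ i, x i - c ≠ 0 := fun i => sub_ne_zero.mpr (hxc i)
  have h1 := fun m : ℕ => EV_expand_zero hEV v hu (hf.comp_Lm1_pow m) hx' hx0 hy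
  choose h hh hE using h1
  refine ⟨∑ m ∈ Finset.range M, (c ^ m * ((m.factorial : ℂ))⁻¹) • h m, fun T => ?_,
    (ExpandsTo.sum _ fun m _ => (hE m).const_mul _).congr ?_⟩
  · have hinj : Function.Injective (Fin.append x fun _ : Fin 1 => c) :=
      Fin.append_injective_iff.mpr ⟨hx, Function.injective_of_subsingleton _, fun i _ => hxc i⟩
    rw [hM _ _ _ hinj c, HahnSeries.coeff_sum]
    refine Finset.sum_congr rfl fun m _ => ?_
    rw [HahnSeries.coeff_smul, hh, smul_eq_mul]
    congr 4
    funext i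
    refine Fin.addCases (fun t => ?_) (fun t => ?_) i <;> simp
  · filter_upwards [injective_append_mul_eventually hx' hx0 hy] with b hb
    have key : (fun i => Fin.append x (fun t => c + b * y t) i - c) =
        Fin.append (fun i => x i - c) fun t => b * y t := by
      funext i
      refine Fin.addCases (fun t => ?_) (fun t => ?_) i <;> simp
    have hinj : Function.Injective (Fin.append x fun t => c + b * y t) := fun i j hij => by
      rw [← key] at hb
      exact hb (by simp only [hij])
    rw [hM _ _ _ hinj c, key]

variable {ι : Type}

/-- Products of vertex operators indexed by a finite set. -/
def EF (EV : ∀ l : ℕ, (Fin l → V) → (Fin l → ℂ) → VbarT A) (S : Finset ι) (v : ι → V)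
    (x : ι → ℂ) : VbarT A :=
  EV S.card (fun i => v (S.equivFin.symm i)) fun i => x (S.equivFin.symm i)

lemma EF_eq (hEV : IsEVFam A EV) {S : Finset ι} {k : ℕ} {e : Fin k → ι}
    (he : Function.Injective e) (hS : ∀ τ, τ ∈ S ↔ ∃ i, e i = τ) (v : ι → V) {x : ι → ℂ}
    (hx : Set.InjOn x S) : EF EV S v x = EV k (v ∘ e) (x ∘ e) := by
  let E : Fin k ≃ S := Equiv.ofBijective (fun i => ⟨e i, (hS _).mpr ⟨i, rfl⟩⟩)
    ⟨fun i j hij => he (congrArg Subtype.val hij), fun τ => by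
      obtain ⟨i, hi⟩ := (hS τ).mp τ.2
      exact ⟨i, Subtype.ext hi⟩⟩
  have hk : k = S.card := by simpa using Fintype.card_congr E
  subst hk
  have h1 := EV_perm hEV (E.trans S.equivFin) (fun i => v (S.equivFin.symm i))
    (x := fun i => x (S.equivFin.symm i)) (fun i j hij => by
      have := hx (S.equivFin.symm i).2 (S.equivFin.symm j).2 hij
      exact S.equivFin.symm.injective (Subtype.ext this))
  rw [EF, ← h1]
  congr 1 <;> funext i <;> simp only [Function.comp_apply, Equiv.trans_apply, Equiv.symm_apply_apply] <;> rfl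

lemma EF_congr {S : Finset ι} {v v' : ι → V} {x x' : ι → ℂ} (hv : ∀ τ ∈ S, v τ = v' τ)
    (hx : ∀ τ ∈ S, x τ = x' τ) : EF EV S v x = EF EV S v' x' := by
  rw [EF, EF]
  congr 1 <;> funext i
  · exact hv _ (S.equivFin.symm i).2
  · exact hx _ (S.equivFin.symm i).2

theorem EF_expand (hEV : IsEVFam A EV) {R B : Finset ι} (hRB : Disjoint R B) {b₀ : ι} (hb₀ : b₀ ∈ B)
    {v : ι → V} {w : ι → ℤ} (hv : ∀ τ ∈ B, v τ ∈ A.grading (w τ)) {f : V →ₗ[ℂ] ℂ}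
    (hf : GradedFunctionalZ A.grading f) {x : ι → ℂ} (hx : Set.InjOn x R) {c : ℂ}
    (hxc : ∀ τ ∈ R, x τ ≠ c) {y : ι → ℂ} (hy : Set.InjOn y B) :
    ∃ h : LaurentSeries ℂ, (∀ T, h.coeff T = pairBarV f (EF EV (insert b₀ R)
        (Function.update v b₀ (EF EV B v y (T + ∑ τ ∈ B, w τ) : V)) (Function.update x b₀ c))) ∧
      ExpandsTo (fun b => pairBarV f (EF EV (R ∪ B) v fun τ => if τ ∈ B then c + b * y τ else x τ))
        h := by
  have hbR : b₀ ∉ R := fun h => Finset.disjoint_left.mp hRB h hb₀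
  let eR : Fin R.card → ι := fun i => R.equivFin.symm i
  let eB : Fin B.card → ι := fun i => B.equivFin.symm i
  have heR : Function.Injective eR := Subtype.val_injective.comp R.equivFin.symm.injective
  have heB : Function.Injective eB := Subtype.val_injective.comp B.equivFin.symm.injective
  have hR : ∀ i, eR i ∈ R := fun i => (R.equivFin.symm i).2
  have hB : ∀ i, eB i ∈ B := fun i => (B.equivFin.symm i).2
  have hR' : ∀ τ ∈ R, ∃ i, eR i = τ := fun τ hτ => ⟨R.equivFin ⟨τ, hτ⟩, by simp [eR]⟩
  have hB' : ∀ τ ∈ B, ∃ i, eB i = τ := fun τ hτ => ⟨B.equivFin ⟨τ, hτ⟩, by simp [eB]⟩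
  have hx1 : Function.Injective fun i => x (eR i) := fun i j hij => heR (hx (hR i) (hR j) hij)
  have hy1 : Function.Injective fun i => y (eB i) := fun i j hij => heB (hy (hB i) (hB j) hij)
  have hxc1 : ∀ i, x (eR i) ≠ c := fun i => hxc _ (hR i)
  obtain ⟨h, hh, hE⟩ := EV_expand hEV (fun i => v (eR i)) (u := fun i => v (eB i))
    (w := fun i => w (eB i)) (fun i => hv _ (hB i)) hf hx1 hxc1 hy1
  have hw : ∑ i, w (eB i) = ∑ τ ∈ B, w τ := by
    rw [← Finset.sum_coe_sort B]
    exact Equiv.sum_comp B.equivFin.symm fun τ : B => w τ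
  refine ⟨h, fun T => ?_, hE.congr ?_⟩
  · rw [hh, hw]
    have he : Function.Injective (Fin.append eR fun _ : Fin 1 => b₀) :=
      Fin.append_injective_iff.mpr ⟨heR, Function.injective_of_subsingleton _,
        fun i _ h => hbR (h ▸ hR i)⟩
    rw [EF_eq hEV (e := Fin.append eR fun _ : Fin 1 => b₀) he]
    · have hne : ∀ i, eR i ≠ b₀ := fun i h => hbR (h ▸ hR i)
      have hEF : EF EV B v y = EV B.card (fun i => v (eB i)) fun i => y (eB i) := rfl
      congr 2 <;> funext i <;> refine Fin.addCases (fun t => ?_) (fun t => ?_) i <;>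
        simp [hne, hEF]
    · intro τ
      rw [Finset.mem_insert]
      constructor
      · rintro (rfl | hτ)
        · exact ⟨Fin.natAdd _ 0, by simp⟩
        · obtain ⟨i, hi⟩ := hR' τ hτ
          exact ⟨Fin.castAdd _ i, by simp [hi]⟩
      · rintro ⟨i, rfl⟩
        refine Fin.addCases (fun t => ?_) (fun t => ?_) i
        · simp [hR]
        · simp
    · have hne : ∀ τ ∈ R, τ ≠ b₀ := fun τ hτ h => hbR (h ▸ hτ)
      intro τ hτ σ hσ hτσ
      rw [Finset.coe_insert, Set.mem_insert_iff] at hτ hσ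
      rcases hτ with rfl | hτ <;> rcases hσ with rfl | hσ
      · rfl
      · rw [Function.update_self, Function.update_of_ne (hne _ hσ)] at hτσ
        exact absurd hτσ.symm (hxc _ hσ)
      · rw [Function.update_self, Function.update_of_ne (hne _ hτ)] at hτσ
        exact absurd hτσ (hxc _ hτ)
      · rw [Function.update_of_ne (hne _ hσ), Function.update_of_ne (hne _ hτ)] at hτσ
        exact hx hτ hσ hτσ
  · have hx0 : ∀ i, x (eR i) - c ≠ 0 := fun i => sub_ne_zero.mpr (hxc1 i)
    filter_upwards [injective_append_mul_eventually (x := fun i => x (eR i) - c)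
      (fun i j hij => hx1 (sub_left_injective hij)) hx0 hy1] with b hb
    have he : Function.Injective (Fin.append eR eB) :=
      Fin.append_injective_iff.mpr ⟨heR, heB,
        fun i j h => Finset.disjoint_left.mp hRB (hR i) (h ▸ hB j)⟩
    have hnB : ∀ i, eR i ∉ B := fun i => Finset.disjoint_left.mp hRB (hR i)
    have hmem : ∀ τ, τ ∈ R ∪ B ↔ ∃ i, Fin.append eR eB i = τ := fun τ => by
      rw [Finset.mem_union]
      constructor
      · rintro (hτ | hτ)
        · obtain ⟨i, hi⟩ := hR' τ hτ
          exact ⟨Fin.castAdd _ i, by simp [hi]⟩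
        · obtain ⟨i, hi⟩ := hB' τ hτ
          exact ⟨Fin.natAdd _ i, by simp [hi]⟩
      · rintro ⟨i, rfl⟩
        refine Fin.addCases (fun t => ?_) (fun t => ?_) i
        · simp [hR]
        · simp [hB]
    have hcomp : (fun τ => if τ ∈ B then c + b * y τ else x τ) ∘ Fin.append eR eB =
        Fin.append (fun i => x (eR i)) fun i => c + b * y (eB i) := by
      funext i
      refine Fin.addCases (fun t => ?_) (fun t => ?_) i
      · simp [hnB]
      · simp [hB]
    rw [EF_eq hEV (e := Fin.append eR eB) he hmem, hcomp]
    · congr 2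
      funext i
      refine Fin.addCases (fun t => ?_) (fun t => ?_) i <;> simp
    · intro τ hτ σ hσ hτσ
      obtain ⟨i, rfl⟩ := (hmem τ).mp hτ
      obtain ⟨j, rfl⟩ := (hmem σ).mp hσ
      have h1 : Fin.append (fun i => x (eR i)) (fun i => c + b * y (eB i)) i =
        Fin.append (fun i => x (eR i)) (fun i => c + b * y (eB i)) j := by
          rw [← hcomp]; exact hτσ
      have key : (fun i => Fin.append (fun i => x (eR i)) (fun i => c + b * y (eB i)) i - c) =
          Fin.append (fun i => x (eR i) - c) fun i => b * y (eB i) := by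
        funext i
        refine Fin.addCases (fun t => ?_) (fun t => ?_) i <;> simp
      rw [← key] at hb
      rw [hb (a₁ := i) (a₂ := j) (by simp only [h1])]

end Expand

section Scaling
variable {V : Type} [AddCommGroup V] [Module ℂ V]
variable {A : GRVA V} {EV : ∀ l : ℕ, (Fin l → V) → (Fin l → ℂ) → VbarT A}

lemma EF_mul_left (hEV : IsEVFam A EV) {ι : Type} {S : Finset ι} {v : ι → V} {w : ι → ℤ}
    (hv : ∀ τ ∈ S, v τ ∈ A.grading (w τ)) {y : ι → ℂ} (hy : Set.InjOn y S) {b : ℂ} (hb : b ≠ 0)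
    (r : ℤ) : (EF EV S v (fun τ => b * y τ) r : V) =
      b ^ (r - ∑ τ ∈ S, w τ) • (EF EV S v y r : V) := by
  have hw : ∑ i, w (S.equivFin.symm i) = ∑ τ ∈ S, w τ := by
    rw [← Finset.sum_coe_sort S]
    exact Equiv.sum_comp S.equivFin.symm fun τ : S => w τ
  rw [← hw]
  refine EV_mul_left hEV (fun t => hv _ (S.equivFin.symm t).2) (fun i j hij => ?_) hb r
  exact S.equivFin.symm.injective
    (Subtype.ext (hy (S.equivFin.symm i).2 (S.equivFin.symm j).2 hij))

lemma EF_image (hEV : IsEVFam A EV) {ι κ : Type} {S : Finset κ} {T : Finset ι} {g : κ → ι}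
    (hg : Function.Injective g) (hT : ∀ τ, τ ∈ T ↔ ∃ σ ∈ S, g σ = τ) (v : ι → V) {x : ι → ℂ}
    (hx : Set.InjOn x T) : EF EV T v x = EF EV S (v ∘ g) (x ∘ g) := by
  rw [EF_eq hEV (e := fun i : Fin S.card => g (S.equivFin.symm i))
    (hg.comp (Subtype.val_injective.comp S.equivFin.symm.injective)) _ v hx]
  · rfl
  · intro τ
    rw [hT]
    constructor
    · rintro ⟨σ, hσ, rfl⟩
      exact ⟨S.equivFin ⟨σ, hσ⟩, by simp⟩
    · rintro ⟨i, rfl⟩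
      exact ⟨_, (S.equivFin.symm i).2, rfl⟩

variable {I K : Type} [Fintype K]

/-- The fibre of a map between finite types. -/
def fib (par : K → I) (i : I) : Finset K := Finset.univ.filter fun τ => par τ = i

@[simp] lemma mem_fib {par : K → I} {i : I} {τ : K} : τ ∈ fib par i ↔ par τ = i := by simp [fib]

variable [Fintype I]

/-- Scaling every cluster of points turns a sum over homogeneous components into a Laurent
series in the scaling parameters. -/
lemma hasSum_scaled (hEV : IsEVFam A EV) (par : K → I) (φ : MultilinearMap ℂ (fun _ : I => V) ℂ)
    {v : K → V} {w : K → ℤ} (hv : ∀ τ, v τ ∈ A.grading (w τ)) {y : K → ℂ}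
    (hy : ∀ τ σ, par τ = par σ → y τ = y σ → τ = σ) {a : I → ℂ} (ha : ∀ i, a i ≠ 0) {F : ℂ}
    (h : HasSum (fun r : I → ℤ =>
      φ fun i => (EF EV (fib par i) v (fun τ => a (par τ) * y τ) (r i) : V)) F) :
    HasSum (fun r : I → ℤ =>
      φ (fun i => (EF EV (fib par i) v y (r i + ∑ τ ∈ fib par i, w τ) : V)) * zmon a r) F := by
  rw [← (Equiv.addRight fun i => ∑ τ ∈ fib par i, w τ).hasSum_iff] at h
  refine h.congr_fun fun r => ?_
  have key : ∀ i, (EF EV (fib par i) v (fun τ => a (par τ) * y τ)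
      (r i + ∑ τ ∈ fib par i, w τ) : V) =
      a i ^ r i • (EF EV (fib par i) v y (r i + ∑ τ ∈ fib par i, w τ) : V) := fun i => by
    rw [EF_congr (x' := fun τ => a i * y τ) (fun _ _ => rfl)
      (fun τ hτ => by rw [mem_fib.mp hτ]), EF_mul_left hEV (fun τ _ => hv τ) _ (ha i),
      add_sub_cancel_right]
    intro τ hτ σ hσ
    exact hy τ σ ((mem_fib.mp hτ).trans (mem_fib.mp hσ).symm)
  simp only [Function.comp_apply, Equiv.coe_addRight, Pi.add_apply, key]
  rw [MultilinearMap.map_smul_univ, smul_eq_mul, mul_comm]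
  rfl

end Scaling

section Partial
variable {V : Type} [AddCommGroup V] [Module ℂ V]
variable {A : GRVA V} {EV : ∀ l : ℕ, (Fin l → V) → (Fin l → ℂ) → VbarT A}
variable {I J K : Type}

variable [Fintype K] in
/-- The points of the `i`-th block that remain after replacing the clusters in `J₀` by their
representatives. -/
def partSet (jK : K → J) (iJ : J → I) (rep : J → K) (J₀ : Finset J) (i : I) : Finset K :=
  Finset.univ.filter fun τ => iJ (jK τ) = i ∧ (jK τ ∈ J₀ → τ = rep (jK τ))

variable [Fintype K] in
/-- The vectors after replacing the clusters in `J₀` by homogeneous components of products. -/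
def partVec (EV : ∀ l : ℕ, (Fin l → V) → (Fin l → ℂ) → VbarT A) (jK : K → J) (v : K → V)
    (w : K → ℤ) (y : K → ℂ) (J₀ : Finset J) (s : J → ℤ) (τ : K) : V :=
  if jK τ ∈ J₀ then
    (EF EV (fib jK (jK τ)) v y (s (jK τ) + ∑ σ ∈ fib jK (jK τ), w σ) : V)
  else v τ

/-- The positions after replacing the clusters in `J₀` by their centers. -/
def partPt (jK : K → J) (y : K → ℂ) (c : J → ℂ) (J₀ : Finset J) (b : J → ℂ) (τ : K) : ℂ :=
  if jK τ ∈ J₀ then c (jK τ) else c (jK τ) + b (jK τ) * y τ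

lemma partPt_eq_imp {jK : K → J} {y : K → ℂ} {c : J → ℂ}
    (hc : ∀ j j', j ≠ j' → 1 ≤ ‖c j - c j'‖) {b : J → ℂ} (hb : ∀ τ, ‖b (jK τ) * y τ‖ < 1 / 4)
    {J₀ : Finset J} {τ σ : K} (h : partPt jK y c J₀ b τ = partPt jK y c J₀ b σ) :
    jK τ = jK σ := by
  by_contra hne
  have key : ∀ τ, ‖partPt jK y c J₀ b τ - c (jK τ)‖ < 1 / 4 := fun τ => by
    unfold partPt
    split_ifs
    · simp
    · simpa using hb τ
  have h1 := hc _ _ hne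
  have h2 : c (jK τ) - c (jK σ) = (partPt jK y c J₀ b σ - c (jK σ)) -
    (partPt jK y c J₀ b τ - c (jK τ)) := by rw [h]; ring
  have h3 := norm_sub_le (partPt jK y c J₀ b σ - c (jK σ)) (partPt jK y c J₀ b τ - c (jK τ))
  rw [← h2] at h3
  linarith [key τ, key σ]

lemma partPt_injOn {jK : K → J} {rep : J → K} {y : K → ℂ}
    (hy : ∀ τ σ, jK τ = jK σ → y τ = y σ → τ = σ) {c : J → ℂ}
    (hc : ∀ j j', j ≠ j' → 1 ≤ ‖c j - c j'‖) {b : J → ℂ} (hb : ∀ τ, ‖b (jK τ) * y τ‖ < 1 / 4)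
    (hb0 : ∀ j, b j ≠ 0) {J₀ : Finset J} :
    Set.InjOn (partPt jK y c J₀ b) {τ | jK τ ∈ J₀ → τ = rep (jK τ)} := by
  intro τ hτ σ hσ h
  have hj := partPt_eq_imp hc hb h
  by_cases hJ : jK τ ∈ J₀
  · rw [hτ hJ, hσ (hj ▸ hJ), hj]
  · refine hy τ σ hj ?_
    rw [partPt, partPt, if_neg hJ, if_neg (hj ▸ hJ), hj] at h
    exact mul_left_cancel₀ (hb0 _) (add_left_cancel h)

variable [Fintype K]

/-- The value of `φ` after replacing the clusters in `J₀` by homogeneous components. -/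
def partVal (EV : ∀ l : ℕ, (Fin l → V) → (Fin l → ℂ) → VbarT A) (jK : K → J) (iJ : J → I)
    (rep : J → K) (φ : MultilinearMap ℂ (fun _ : I => V) ℂ) (v : K → V) (w : K → ℤ) (y : K → ℂ)
    (c : J → ℂ) (J₀ : Finset J) (r : I → ℤ) (s : J → ℤ) (b : J → ℂ) : ℂ :=
  φ fun i => (EF EV (partSet jK iJ rep J₀ i) (partVec EV jK v w y J₀ s) (partPt jK y c J₀ b)
    (r i + ∑ τ ∈ fib (iJ ∘ jK) i, w τ) : V)

lemma partVal_expand (hEV : IsEVFam A EV) {jK : K → J} (iJ : J → I) {rep : J → K}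
    (hrep : ∀ j, jK (rep j) = j) (φ : MultilinearMap ℂ (fun _ : I => V) ℂ) {v : K → V} {w : K → ℤ}
    (hv : ∀ τ, v τ ∈ A.grading (w τ)) {y : K → ℂ}
    (hy : ∀ τ σ, jK τ = jK σ → y τ = y σ → τ = σ) {c : J → ℂ}
    (hc : ∀ j j', j ≠ j' → 1 ≤ ‖c j - c j'‖) {b : J → ℂ} (hb : ∀ τ, ‖b (jK τ) * y τ‖ < 1 / 4)
    (hb0 : ∀ j, b j ≠ 0) {J₀ : Finset J} {j₀ : J} (hj₀ : j₀ ∉ J₀) (r : I → ℤ) (s : J → ℤ) :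
    ∃ h : LaurentSeries ℂ, (∀ T, h.coeff T =
        partVal EV jK iJ rep φ v w y c (insert j₀ J₀) r (Function.update s j₀ T) b) ∧
      ExpandsTo (fun b' => partVal EV jK iJ rep φ v w y c J₀ r s (Function.update b j₀ b')) h := by
  set base : I → V := fun i => (EF EV (partSet jK iJ rep J₀ i) (partVec EV jK v w y J₀ s)
    (partPt jK y c J₀ b) (r i + ∑ τ ∈ fib (iJ ∘ jK) i, w τ) : V) with hbase
  set W := r (iJ j₀) + ∑ τ ∈ fib (iJ ∘ jK) (iJ j₀), w τ with hW
  have hRB : Disjoint (partSet jK iJ rep J₀ (iJ j₀) \ fib jK j₀) (fib jK j₀) :=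
    Finset.sdiff_disjoint
  have hbrep : rep j₀ ∈ fib jK j₀ := by simp [hrep]
  have hvJ : ∀ τ ∈ fib jK j₀, partVec EV jK v w y J₀ s τ = v τ := fun τ hτ => by
    rw [partVec, if_neg]
    rwa [mem_fib.mp hτ]
  obtain ⟨h, hh, hE⟩ := EF_expand hEV hRB hbrep (v := partVec EV jK v w y J₀ s) (w := w)
    (fun τ hτ => by rw [hvJ τ hτ]; exact hv τ)
    (gradedFunctionalZ_comp_gproj A (φ.toLinearMap base (iJ j₀)) W)
    (x := partPt jK y c J₀ b) (c := c j₀) (y := y)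
    (fun τ hτ σ hσ hτσ => by
      simp only [partSet, Finset.coe_sdiff, Set.mem_sdiff, Finset.mem_coe, Finset.mem_filter] at hτ hσ
      exact partPt_injOn (rep := rep) hy hc hb hb0 hτ.1.2.2 hσ.1.2.2 hτσ)
    (fun τ hτ h => by
      have h1 : partPt jK y c J₀ b τ = partPt jK y c (insert j₀ J₀) b (rep j₀) := by
        rw [h, partPt, if_pos (by simp [hrep]), hrep]
      have hne : jK τ ≠ j₀ := by
        intro h'
        simp [h'] at hτ
      have h2 : partPt jK y c J₀ b τ = partPt jK y c (insert j₀ J₀) b τ := by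
        simp [partPt, hne]
      rw [h2] at h1
      exact hne ((partPt_eq_imp hc hb h1).trans (hrep _)))
    (fun τ hτ σ hσ h => hy τ σ (by
      rw [mem_fib.mp hτ, mem_fib.mp hσ]) h)
  have hother : ∀ i, i ≠ iJ j₀ → ∀ τ, iJ (jK τ) = i → jK τ ≠ j₀ := fun i hi τ hτ h =>
    hi (by rw [← hτ, h])
  refine ⟨h, fun T => ?_, hE.congr (Filter.Eventually.of_forall fun b' => ?_)⟩
  · rw [hh, pairBarV_comp_gproj, MultilinearMap.toLinearMap_apply, partVal]
    congr 1
    funext i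
    by_cases hi : i = iJ j₀
    · subst hi
      rw [Function.update_self, ← hW]
      have hset : insert (rep j₀) (partSet jK iJ rep J₀ (iJ j₀) \ fib jK j₀) =
          partSet jK iJ rep (insert j₀ J₀) (iJ j₀) := by
        ext τ
        simp only [partSet, Finset.mem_insert, Finset.mem_sdiff, Finset.mem_filter,
          Finset.mem_univ, true_and, mem_fib]
        constructor
        · rintro (rfl | ⟨⟨h1, h2⟩, h3⟩)
          · simp [hrep]
          · exact ⟨h1, fun h => h2 (h.resolve_left h3)⟩
        · rintro ⟨h1, h2⟩
          by_cases h3 : jK τ = j₀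
          · left
            rw [h2 (Or.inl h3), h3]
          · exact Or.inr ⟨⟨h1, fun h => h2 (Or.inr h)⟩, h3⟩
      rw [hset]
      refine congrArg (fun ω : VbarT A => (ω W : V)) (EF_congr (fun τ hτ => ?_) fun τ hτ => ?_)
      all_goals
        simp only [partSet, Finset.mem_insert, Finset.mem_filter, Finset.mem_univ, true_and] at hτ
        by_cases h3 : jK τ = j₀
      · have : τ = rep j₀ := by rw [hτ.2 (Or.inl h3), h3]
        subst this
        rw [Function.update_self, partVec, if_pos (by simp [hrep]), hrep, Function.update_self]
        rw [EF_congr hvJ fun _ _ => rfl]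
      · have : τ ≠ rep j₀ := fun h => h3 (by rw [h, hrep])
        rw [Function.update_of_ne this, partVec, partVec, Function.update_of_ne h3]
        simp only [Finset.mem_insert, h3, false_or]
      · have : τ = rep j₀ := by rw [hτ.2 (Or.inl h3), h3]
        subst this
        rw [Function.update_self, partPt, if_pos (by simp [hrep]), hrep]
      · have : τ ≠ rep j₀ := fun h => h3 (by rw [h, hrep])
        simp [Function.update_of_ne this, partPt, h3]
    · rw [Function.update_of_ne hi, hbase]
      have hset : partSet jK iJ rep J₀ i = partSet jK iJ rep (insert j₀ J₀) i := by
        ext τ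
        simp only [partSet, Finset.mem_filter, Finset.mem_univ, true_and, Finset.mem_insert]
        refine and_congr_right fun h => ?_
        simp [hother i hi τ h]
      rw [← hset]
      refine congrArg (fun ω : VbarT A => (ω _ : V)) (EF_congr (fun τ hτ => ?_) fun τ hτ => ?_)
      all_goals
        simp only [partSet, Finset.mem_filter, Finset.mem_univ, true_and] at hτ
        have h3 := hother i hi τ hτ.1
      · rw [partVec, partVec, Function.update_of_ne h3]
        simp only [Finset.mem_insert, h3, false_or]
      · simp [partPt, h3]
  · rw [pairBarV_comp_gproj, MultilinearMap.toLinearMap_apply, partVal]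
    congr 1
    funext i
    by_cases hi : i = iJ j₀
    · subst hi
      rw [Function.update_self, ← hW]
      have hset : partSet jK iJ rep J₀ (iJ j₀) \ fib jK j₀ ∪ fib jK j₀ =
          partSet jK iJ rep J₀ (iJ j₀) := by
        refine Finset.sdiff_union_of_subset fun τ hτ => ?_
        rw [mem_fib] at hτ
        simp [partSet, hτ, hj₀]
      rw [hset]
      refine congrArg (fun ω : VbarT A => (ω _ : V)) (EF_congr (fun _ _ => rfl) fun τ hτ => ?_)
      by_cases h3 : jK τ = j₀
      · simp [partPt, h3, hj₀]
      · simp [partPt, h3]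
    · rw [Function.update_of_ne hi, hbase]
      refine congrArg (fun ω : VbarT A => (ω _ : V)) (EF_congr (fun _ _ => rfl) fun τ hτ => ?_)
      simp only [partSet, Finset.mem_filter, Finset.mem_univ, true_and] at hτ
      simp [partPt, hother i hi τ hτ.1]

end Partial

section Coefficients
open Filter Topology
variable {I J : Type} [Fintype I] [Fintype J]

lemma zmon_sumElim (a : I → ℂ) (b : J → ℂ) (k : I ⊕ J → ℤ) :
    zmon (Sum.elim a b) k = zmon a (fun i => k (Sum.inl i)) * zmon b (fun j => k (Sum.inr j)) := by
  simp [zmon]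

lemma sum_ite_zexp (P : MvPolynomial (I ⊕ J) ℂ) (d : I ⊕ J →₀ ℕ) :
    (∑ d' ∈ P.support, if (fun i => zexp d' (Sum.inl i)) = (fun i => zexp d (Sum.inl i)) ∧
      (fun j => zexp d' (Sum.inr j)) = (fun j => zexp d (Sum.inr j)) then P.coeff d' else 0) =
      P.coeff d := by
  have key : ∀ d' : I ⊕ J →₀ ℕ, ((fun i => zexp d' (Sum.inl i)) = (fun i => zexp d (Sum.inl i)) ∧
      (fun j => zexp d' (Sum.inr j)) = (fun j => zexp d (Sum.inr j))) ↔ d' = d := fun d' => by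
    constructor
    · rintro ⟨h1, h2⟩
      refine zexp_injective (funext fun t => ?_)
      cases t with
      | inl i => exact congrFun h1 i
      | inr j => exact congrFun h2 j
    · rintro rfl
      exact ⟨rfl, rfl⟩
  simp only [key]
  rw [Finset.sum_ite_eq']
  split_ifs with h
  · rfl
  · exact (MvPolynomial.notMem_support_iff.mp h).symm

/-- Coefficient relation for an iterated Laurent expansion on a product of tori. -/
lemma iterated_coeff_relation {ρ : I → ℝ} (hρ : ∀ i, 0 < ρ i) {ρ' : J → ℝ} (hρ' : ∀ j, 0 < ρ' j)
    {C : (I → ℤ) → (J → ℤ) → ℂ} {G : (I → ℂ) → (J → ℤ) → ℂ} {F : (I → ℂ) → (J → ℂ) → ℂ}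
    (hG : ∀ a, (∀ i, ‖a i‖ = ρ i) → ∀ s, HasSum (fun r => C r s * zmon a r) (G a s))
    (hF : ∀ a b, (∀ i, ‖a i‖ = ρ i) → (∀ j, ‖b j‖ = ρ' j) →
      HasSum (fun s => G a s * zmon b s) (F a b))
    {D P : MvPolynomial (I ⊕ J) ℂ}
    (hrel : ∀ a b, (∀ i, ‖a i‖ = ρ i) → (∀ j, ‖b j‖ = ρ' j) →
      F a b * MvPolynomial.eval (Sum.elim a b) D = MvPolynomial.eval (Sum.elim a b) P)
    (r : I → ℤ) (s : J → ℤ) :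
    ∑ d ∈ D.support, D.coeff d *
        C (r - fun i => zexp d (Sum.inl i)) (s - fun j => zexp d (Sum.inr j)) =
      ∑ d ∈ P.support, if (fun i => zexp d (Sum.inl i)) = r ∧
        (fun j => zexp d (Sum.inr j)) = s then P.coeff d else 0 := by
  have h1 : ∀ a, (∀ i, ‖a i‖ = ρ i) →
      ∑ d ∈ D.support, D.coeff d * zmon a (fun i => zexp d (Sum.inl i)) *
        G a (s - fun j => zexp d (Sum.inr j)) =
      ∑ d ∈ P.support, if (fun j => zexp d (Sum.inr j)) = s then
        P.coeff d * zmon a (fun i => zexp d (Sum.inl i)) else 0 := fun a ha =>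
    laurent_coeff_relation ρ' hρ' D.support
      (fun d => D.coeff d * zmon a (fun i => zexp d (Sum.inl i)))
      (fun d j => zexp d (Sum.inr j)) (fun _ b => F a b) (fun _ => G a)
      (fun d _ b hb => hF a b ha hb) P.support
      (fun d => P.coeff d * zmon a (fun i => zexp d (Sum.inl i))) (fun d j => zexp d (Sum.inr j))
      (fun b hb => by
        have := hrel a b ha hb
        rw [eval_eq_zmon, eval_eq_zmon, Finset.mul_sum] at this
        simp only [zmon_sumElim] at this
        refine Eq.trans (Finset.sum_congr rfl fun d _ => ?_)
          (this.trans (Finset.sum_congr rfl fun d _ => ?_)) <;> ring) s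
  have h2 := laurent_coeff_relation ρ hρ D.support (fun d => D.coeff d)
      (fun d i => zexp d (Sum.inl i)) (fun d a => G a (s - fun j => zexp d (Sum.inr j)))
      (fun d r => C r (s - fun j => zexp d (Sum.inr j))) (fun d _ a ha => hG a ha _) P.support
      (fun d => if (fun j => zexp d (Sum.inr j)) = s then P.coeff d else 0)
      (fun d i => zexp d (Sum.inl i)) (fun a ha => (h1 a ha).trans
        (Finset.sum_congr rfl fun d _ => by split_ifs <;> simp)) r
  refine h2.trans (Finset.sum_congr rfl fun d _ => ?_)
  rw [ite_and]

/-- Coefficient relation for a Laurent expansion on a torus followed by successive one-variable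
expansions. -/
lemma successive_coeff_relation {ρ : I → ℝ} (hρ : ∀ i, 0 < ρ i) {β : ℝ} (hβ : 0 < β)
    {Val : Finset J → (I → ℤ) → (J → ℤ) → (J → ℂ) → ℂ} {F : (I → ℂ) → (J → ℂ) → ℂ}
    (hbase : ∀ a b, (∀ i, ‖a i‖ = ρ i) → (∀ j, b j ≠ 0 ∧ ‖b j‖ < β) → ∀ s,
      HasSum (fun r => Val ∅ r s b * zmon a r) (F a b))
    (hexp : ∀ (J₀ : Finset J) (j₀ : J), j₀ ∉ J₀ → ∀ b, (∀ j, b j ≠ 0 ∧ ‖b j‖ < β) → ∀ r s,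
      ∃ h : LaurentSeries ℂ,
        (∀ T, h.coeff T = Val (insert j₀ J₀) r (Function.update s j₀ T) b) ∧
        ExpandsTo (fun b' => Val J₀ r s (Function.update b j₀ b')) h)
    {D P : MvPolynomial (I ⊕ J) ℂ}
    (hrel : ∀ a b, (∀ i, ‖a i‖ = ρ i) → (∀ j, b j ≠ 0 ∧ ‖b j‖ < β) →
      F a b * MvPolynomial.eval (Sum.elim a b) D = MvPolynomial.eval (Sum.elim a b) P)
    (r : I → ℤ) (s : J → ℤ) {b : J → ℂ} (hb : ∀ j, b j ≠ 0 ∧ ‖b j‖ < β) :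
    ∑ d ∈ D.support, D.coeff d * Val Finset.univ
        (r - fun i => zexp d (Sum.inl i)) (s - fun j => zexp d (Sum.inr j)) b =
      ∑ d ∈ P.support, if (fun i => zexp d (Sum.inl i)) = r ∧
        (fun j => zexp d (Sum.inr j)) = s then P.coeff d else 0 := by
  have claim : ∀ (J₀ : Finset J) (r : I → ℤ) (s : J → ℤ) (b : J → ℂ),
      (∀ j, b j ≠ 0 ∧ ‖b j‖ < β) →
      ∑ d ∈ D.support, (D.coeff d * ∏ j ∈ J₀ᶜ, b j ^ d (Sum.inr j)) *
        Val J₀ (r - fun i => zexp d (Sum.inl i)) (s - fun j => zexp d (Sum.inr j)) b =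
      ∑ d ∈ P.support, if (fun i => zexp d (Sum.inl i)) = r ∧ ∀ j ∈ J₀, zexp d (Sum.inr j) = s j
        then P.coeff d * ∏ j ∈ J₀ᶜ, b j ^ d (Sum.inr j) else 0 := by
    intro J₀
    induction J₀ using Finset.induction_on with
    | empty =>
      intro r s b hb
      have hz : ∀ d : I ⊕ J →₀ ℕ, ∏ j ∈ (∅ : Finset J)ᶜ, b j ^ d (Sum.inr j) =
          zmon b (fun j => zexp d (Sum.inr j)) := fun d => by simp [zmon, zexp]
      have := laurent_coeff_relation ρ hρ D.support
        (fun d => D.coeff d * ∏ j ∈ (∅ : Finset J)ᶜ, b j ^ d (Sum.inr j))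
        (fun d i => zexp d (Sum.inl i)) (fun _ a => F a b)
        (fun d r => Val ∅ r (s - fun j => zexp d (Sum.inr j)) b)
        (fun d _ a ha => hbase a b ha hb _) P.support
        (fun d => P.coeff d * ∏ j ∈ (∅ : Finset J)ᶜ, b j ^ d (Sum.inr j))
        (fun d i => zexp d (Sum.inl i))
        (fun a ha => by
          have := hrel a b ha hb
          rw [eval_eq_zmon, eval_eq_zmon, Finset.mul_sum] at this
          simp only [zmon_sumElim] at this
          simp only [hz]
          refine Eq.trans (Finset.sum_congr rfl fun d _ => ?_)
            (this.trans (Finset.sum_congr rfl fun d _ => ?_)) <;> ring) r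
      simpa using this
    | insert j₀ J₀ hj₀ ih =>
      intro r s b hb
      choose h hh hE using fun d : I ⊕ J →₀ ℕ => hexp J₀ j₀ hj₀ b hb
        (r - fun i => zexp d (Sum.inl i)) (s - fun j => zexp d (Sum.inr j))
      have hcompl : (J₀ᶜ : Finset J) = insert j₀ (insert j₀ J₀)ᶜ := by
        ext j
        simp only [Finset.mem_compl, Finset.mem_insert]
        by_cases hj : j = j₀
        · simp [hj, hj₀]
        · simp [hj]
      have hprod : ∀ (d : I ⊕ J →₀ ℕ) (b' : ℂ),
          ∏ j ∈ J₀ᶜ, Function.update b j₀ b' j ^ d (Sum.inr j) =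
            b' ^ d (Sum.inr j₀) * ∏ j ∈ (insert j₀ J₀)ᶜ, b j ^ d (Sum.inr j) := fun d b' => by
        rw [hcompl, Finset.prod_insert (by simp), Function.update_self]
        congr 1
        refine Finset.prod_congr rfl fun j hj => ?_
        rw [Function.update_of_ne]
        rintro rfl
        simp at hj
      have := ExpandsTo.coeff_relation D.support
        (fun d => D.coeff d * ∏ j ∈ (insert j₀ J₀)ᶜ, b j ^ d (Sum.inr j))
        (fun d => d (Sum.inr j₀)) _ h (fun d _ => hE d) P.support
        (fun d => if (fun i => zexp d (Sum.inl i)) = r ∧ ∀ j ∈ J₀, zexp d (Sum.inr j) = s j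
          then P.coeff d * ∏ j ∈ (insert j₀ J₀)ᶜ, b j ^ d (Sum.inr j) else 0)
        (fun d => d (Sum.inr j₀))
        (by
          have hnear : ∀ᶠ b' : ℂ in 𝓝[≠] 0, ‖b'‖ < β :=
            ((continuous_norm.tendsto' (0 : ℂ) 0 norm_zero).mono_left nhdsWithin_le_nhds).eventually
              (gt_mem_nhds hβ)
          filter_upwards [hnear, self_mem_nhdsWithin] with b' h1 h2
          have := ih r s (Function.update b j₀ b') (fun j => by
            by_cases hj : j = j₀
            · subst hj
              rw [Function.update_self]
              exact ⟨h2, h1⟩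
            · rw [Function.update_of_ne hj]
              exact hb j)
          simp only [hprod] at this
          refine Eq.trans (Finset.sum_congr rfl fun d _ => ?_)
            (this.trans (Finset.sum_congr rfl fun d _ => ?_))
          · ring
          · split_ifs <;> ring) (s j₀)
      refine Eq.trans (Finset.sum_congr rfl fun d _ => ?_)
        (this.trans (Finset.sum_congr rfl fun d _ => ?_))
      · rw [hh]
        congr 2
        symm
        exact Function.update_eq_self j₀ (s - fun j => zexp d (Sum.inr j))
      · rw [← ite_and]
        congr 1
        simp only [Finset.forall_mem_insert, eq_iff_iff, zexp]
        tauto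
  have := claim Finset.univ r s b hb
  simpa [funext_iff] using this

end Coefficients

section Composition
variable {V : Type} [AddCommGroup V] [Module ℂ V]
variable {A : GRVA V} {EV : ∀ l : ℕ, (Fin l → V) → (Fin l → ℂ) → VbarT A}
variable {I J K : Type} [Fintype K]

/-- `F` is the sum of the composition series of `φ` with products of vertex operators, the
operators at `τ` with `par τ = i` being inserted in the slot `i`. -/
def IsCompAt (EV : ∀ l : ℕ, (Fin l → V) → (Fin l → ℂ) → VbarT A) (par : K → I)
    (φ : (I → ℂ) → MultilinearMap ℂ (fun _ : I => V) ℂ) (v : K → V) (F : (K → ℂ) → ℂ) : Prop :=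
  ∀ (X : I → ℂ) (u : K → ℂ), Function.Injective X →
    Function.Injective (fun τ => X (par τ) + u τ) →
    (∀ τ σ, par τ ≠ par σ → ‖u τ‖ + ‖u σ‖ < ‖X (par τ) - X (par σ)‖) →
    HasSum (fun r : I → ℤ => φ X fun i => (EF EV (fib par i) v u (r i) : V))
      (F fun τ => X (par τ) + u τ)

lemma norm_add_lt_of_separated {ι : Type} {ζ : ι → ℂ} (hζ : ∀ i j, i ≠ j → 1 ≤ ‖ζ i - ζ j‖)
    {i j : ι} (hij : i ≠ j) {u u' : ℂ} (hu : ‖u‖ < 1 / 4) (hu' : ‖u'‖ < 1 / 4) :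
    ‖u‖ + ‖u'‖ < ‖ζ i - ζ j‖ := by
  linarith [hζ i j hij]

lemma eq_of_add_eq_of_separated {ι : Type} {ζ : ι → ℂ} (hζ : ∀ i j, i ≠ j → 1 ≤ ‖ζ i - ζ j‖)
    {i j : ι} {u u' : ℂ} (hu : ‖u‖ < 1 / 4) (hu' : ‖u'‖ < 1 / 4) (h : ζ i + u = ζ j + u') :
    i = j := by
  by_contra hij
  have h1 := norm_add_lt_of_separated hζ hij hu hu'
  have h2 : ζ i - ζ j = u' - u := by linear_combination h
  rw [h2] at h1
  linarith [norm_sub_le u' u]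

lemma injective_of_separated {ι : Type} {ζ : ι → ℂ} (hζ : ∀ i j, i ≠ j → 1 ≤ ‖ζ i - ζ j‖) :
    Function.Injective ζ := fun i j h => by
  by_contra hij
  have := hζ i j hij
  rw [h, sub_self, norm_zero] at this
  linarith

lemma partVal_empty (EV : ∀ l : ℕ, (Fin l → V) → (Fin l → ℂ) → VbarT A) (jK : K → J)
    (iJ : J → I) (rep : J → K) (φ : MultilinearMap ℂ (fun _ : I => V) ℂ) (v : K → V) (w : K → ℤ)
    (y : K → ℂ) (c : J → ℂ) (r : I → ℤ) (s : J → ℤ) (b : J → ℂ) :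
    partVal EV jK iJ rep φ v w y c ∅ r s b = φ fun i => (EF EV (fib (iJ ∘ jK) i) v
      (fun τ => c (jK τ) + b (jK τ) * y τ) (r i + ∑ τ ∈ fib (iJ ∘ jK) i, w τ) : V) := by
  have h1 : ∀ i, partSet jK iJ rep ∅ i = fib (iJ ∘ jK) i := fun i => by
    ext τ
    simp [partSet]
  have h2 : partVec EV jK v w y ∅ s = v := by
    funext τ
    simp [partVec]
  have h3 : partPt jK y c ∅ b = fun τ => c (jK τ) + b (jK τ) * y τ := by
    funext τ
    simp [partPt]
  simp only [partVal, h1, h2, h3]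

lemma partVal_univ [Fintype J] (hEV : IsEVFam A EV) {jK : K → J} (iJ : J → I) {rep : J → K}
    (hrep : ∀ j, jK (rep j) = j) (φ : MultilinearMap ℂ (fun _ : I => V) ℂ) (v : K → V) (w : K → ℤ)
    (y : K → ℂ) {c : J → ℂ} (hc : Function.Injective c) (r : I → ℤ) (s : J → ℤ) (b : J → ℂ) :
    partVal EV jK iJ rep φ v w y c Finset.univ r s b = φ fun i => (EF EV (fib iJ i)
      (fun j => (EF EV (fib jK j) v y (s j + ∑ σ ∈ fib jK j, w σ) : V)) c
      (r i + ∑ τ ∈ fib (iJ ∘ jK) i, w τ) : V) := by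
  rw [partVal]
  congr 1
  funext i
  rw [EF_image hEV (S := fib iJ i) (Function.LeftInverse.injective hrep)]
  · refine congrArg (fun ω : VbarT A => (ω _ : V)) (EF_congr (fun j _ => ?_) fun j _ => ?_)
    · rw [Function.comp_apply, partVec, if_pos (Finset.mem_univ _), hrep]
    · rw [Function.comp_apply, partPt, if_pos (Finset.mem_univ _), hrep]
  · intro τ
    simp only [partSet, Finset.mem_filter, Finset.mem_univ, true_and, true_imp_iff, mem_fib]
    constructor
    · rintro ⟨h1, h2⟩
      exact ⟨jK τ, h1, h2.symm⟩
    · rintro ⟨j, h1, rfl⟩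
      rw [hrep]
      exact ⟨h1, rfl⟩
  · intro τ hτ σ hσ h
    simp only [partSet, Finset.coe_filter, Finset.mem_univ, true_and, true_imp_iff,
      Set.mem_ofPred_eq] at hτ hσ
    simp only [partPt, Finset.mem_univ, if_true] at h
    rw [hτ.2, hσ.2, hc h]

variable [Fintype I] [Fintype J]

lemma zpow_sum₀ {ι : Type} {x : ℂ} (hx : x ≠ 0) (t : Finset ι) (k : ι → ℤ) :
    x ^ ∑ j ∈ t, k j = ∏ j ∈ t, x ^ k j := by
  induction t using Finset.induction_on with
  | empty => simp
  | insert j t hj ih => rw [Finset.sum_insert hj, Finset.prod_insert hj, zpow_add₀ hx, ih]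

/-- Expansion, in the scaling parameters of the clusters, of an iterated composition. -/
lemma IsCompAt.hasSum_iterated (hEV : IsEVFam A EV) {jK : K → J} {iJ : J → I}
    {φ : (I → ℂ) → MultilinearMap ℂ (fun _ : I => V) ℂ}
    {ψ : (J → ℂ) → MultilinearMap ℂ (fun _ : J => V) ℂ} {w : K → ℤ}
    (H1 : ∀ v', IsCompAt EV iJ φ v' fun X => ψ X v') {v : K → V} {y : K → ℂ}
    {ζ : I → ℂ} (hζ : Function.Injective ζ) {c : J → ℂ} (hc : Function.Injective c)
    {a : I → ℂ} (ha : ∀ i, a i ≠ 0)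
    (hinj : Function.Injective fun j => ζ (iJ j) + a (iJ j) * c j)
    (hnorm : ∀ j j', iJ j ≠ iJ j' →
      ‖a (iJ j) * c j‖ + ‖a (iJ j') * c j'‖ < ‖ζ (iJ j) - ζ (iJ j')‖) (s : J → ℤ) :
    HasSum (fun r : I → ℤ => φ ζ (fun i => (EF EV (fib iJ i)
      (fun j => (EF EV (fib jK j) v y (s j + ∑ σ ∈ fib jK j, w σ) : V)) c
      (r i + ∑ τ ∈ fib (iJ ∘ jK) i, w τ) : V)) * zmon a r)
      (ψ (fun j => ζ (iJ j) + a (iJ j) * c j)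
        (fun j => (EF EV (fib jK j) v y (s j + ∑ σ ∈ fib jK j, w σ) : V)) *
        zmon (fun j => a (iJ j)) s) := by
  have h := hasSum_scaled hEV iJ (φ ζ) (w := fun j => s j + ∑ σ ∈ fib jK j, w σ)
    (v := fun j => (EF EV (fib jK j) v y (s j + ∑ σ ∈ fib jK j, w σ) : V)) (y := c)
    (fun j => Subtype.property _) (fun j j' _ h => hc h) ha
    (H1 _ ζ (fun j => a (iJ j) * c j) hζ hinj hnorm)
  have h' := h.mul_right (zmon (fun j => a (iJ j)) s)
  rw [← (Equiv.subRight fun i => ∑ j ∈ fib iJ i, s j).hasSum_iff] at h'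
  refine h'.congr_fun fun r => ?_
  have hz : zmon (fun j => a (iJ j)) s = zmon a fun i => ∑ j ∈ fib iJ i, s j := by
    simp only [zmon]
    rw [← Finset.prod_fiberwise_of_maps_to (t := Finset.univ) (g := iJ) fun _ _ => Finset.mem_univ _]
    refine Finset.prod_congr rfl fun i _ => ?_
    rw [zpow_sum₀ (ha i)]
    refine Finset.prod_congr rfl fun j hj => ?_
    rw [(Finset.mem_filter.mp hj).2]
  have hw : ∀ i, ∑ j ∈ fib iJ i, ∑ σ ∈ fib jK j, w σ = ∑ τ ∈ fib (iJ ∘ jK) i, w τ := fun i => by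
    rw [← Finset.sum_fiberwise_of_maps_to (s := fib (iJ ∘ jK) i) (t := fib iJ i) (g := jK)
      fun τ hτ => by simpa using hτ]
    refine Finset.sum_congr rfl fun j hj => Finset.sum_congr ?_ fun _ _ => rfl
    ext τ
    rw [mem_fib] at hj
    simp only [mem_fib, Finset.mem_filter, Function.comp_apply]
    exact ⟨fun h => ⟨by rw [h, hj], h⟩, fun h => h.2⟩
  rw [Function.comp_apply, hz, mul_assoc, ← zmon_add a ha]
  congr 2
  · funext i
    refine congrArg (fun n => (EF EV (fib iJ i) (fun j => (EF EV (fib jK j) v y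
      (s j + ∑ σ ∈ fib jK j, w σ) : V)) c n : V)) ?_
    simp only [Finset.sum_add_distrib, hw, Equiv.subRight_apply, Pi.sub_apply]
    ring
  · funext i
    simp

end Composition

section Associativity
variable {V : Type} [AddCommGroup V] [Module ℂ V]
variable {A : GRVA V} {EV : ∀ l : ℕ, (Fin l → V) → (Fin l → ℂ) → VbarT A}
variable {I J K : Type} [Fintype K] [Fintype I] [Fintype J]

lemma exists_pos_mul_norm_lt {ι : Type} [Fintype ι] (c : ι → ℂ) :
    ∃ α : ℝ, 0 < α ∧ ∀ j, α * (‖c j‖ + 1 / 4) < 1 / 4 := by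
  have h0 : 0 ≤ ∑ j, ‖c j‖ := Finset.sum_nonneg fun j _ => norm_nonneg _
  refine ⟨1 / (8 * (1 + ∑ j, ‖c j‖)), by positivity, fun j => ?_⟩
  have h1 : ‖c j‖ ≤ ∑ j, ‖c j‖ :=
    Finset.single_le_sum (f := fun j => ‖c j‖) (fun j _ => norm_nonneg _) (Finset.mem_univ j)
  rw [div_mul_eq_mul_div, div_lt_div_iff₀ (by positivity) (by norm_num)]
  linarith

lemma IsCompAt.comp_eq_of_homogeneous (hEV : IsEVFam A EV) {jK : K → J} {iJ : J → I} {rep : J → K}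
    (hrep : ∀ j, jK (rep j) = j) {φ : (I → ℂ) → MultilinearMap ℂ (fun _ : I => V) ℂ}
    {ψ : (J → ℂ) → MultilinearMap ℂ (fun _ : J => V) ℂ}
    (H1 : ∀ v', IsCompAt EV iJ φ v' fun X => ψ X v') {v : K → V} {w : K → ℤ}
    (hv : ∀ τ, v τ ∈ A.grading (w τ)) {F₂ F₃ : (K → ℂ) → ℂ}
    (H2 : IsCompAt EV jK ψ v F₂) (H3 : IsCompAt EV (iJ ∘ jK) φ v F₃)
    (hF₂ : RatOn {x | Function.Injective x} F₂) (hF₃ : RatOn {x | Function.Injective x} F₃)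
    {ζ : I → ℂ} (hζ : ∀ i i', i ≠ i' → 1 ≤ ‖ζ i - ζ i'‖)
    {c : J → ℂ} (hc : ∀ j j', j ≠ j' → 1 ≤ ‖c j - c j'‖)
    {z : K → ℂ} (hz : Function.Injective z) : F₂ z = F₃ z := by
  set y : K → ℂ := fun τ => z τ - ζ (iJ (jK τ)) - c (jK τ) with hy_def
  have hy : ∀ τ σ, jK τ = jK σ → y τ = y σ → τ = σ := fun τ σ h1 h2 => hz (by
    simp only [hy_def, h1] at h2
    linear_combination h2)
  obtain ⟨α, hα, hαc⟩ := exists_pos_mul_norm_lt c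
  obtain ⟨β, hβ, hβy⟩ := exists_pos_mul_norm_lt y
  set x : (I → ℂ) → (J → ℂ) → K → ℂ := fun a b τ =>
    ζ (iJ (jK τ)) + a (iJ (jK τ)) * (c (jK τ) + b (jK τ) * y τ) with hx_def
  have hζi := injective_of_separated hζ
  have hci := injective_of_separated hc
  have hby : ∀ b : J → ℂ, (∀ j, b j ≠ 0 ∧ ‖b j‖ < β) → ∀ τ, ‖b (jK τ) * y τ‖ < 1 / 4 :=
    fun b hb τ => by
      rw [norm_mul]
      have h1 : ‖b (jK τ)‖ * ‖y τ‖ ≤ β * ‖y τ‖ :=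
        mul_le_mul_of_nonneg_right (hb _).2.le (norm_nonneg _)
      linarith [hβy τ]
  have hac : ∀ a : I → ℂ, (∀ i, ‖a i‖ = α) → ∀ j, ‖a (iJ j) * c j‖ < 1 / 4 := fun a ha j => by
    rw [norm_mul, ha]
    linarith [hαc j]
  have hacb : ∀ (a : I → ℂ) (b : J → ℂ), (∀ i, ‖a i‖ = α) → (∀ j, b j ≠ 0 ∧ ‖b j‖ < β) →
      ∀ τ, ‖a (iJ (jK τ)) * c (jK τ)‖ + ‖a (iJ (jK τ)) * (b (jK τ) * y τ)‖ < 1 / 4 :=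
    fun a b ha hb τ => by
      rw [norm_mul, norm_mul (a _) (b _ * _), ha, ← mul_add]
      exact (mul_lt_mul_of_pos_left (add_lt_add_right (hby b hb τ) _) hα).trans (hαc _)
  have hq : ∀ (a : I → ℂ) (b : J → ℂ), (∀ i, ‖a i‖ = α) → (∀ j, b j ≠ 0 ∧ ‖b j‖ < β) →
      ∀ τ, ‖a (iJ (jK τ)) * (c (jK τ) + b (jK τ) * y τ)‖ < 1 / 4 := fun a b ha hb τ => by
    rw [mul_add]
    exact (norm_add_le _ _).trans_lt (hacb a b ha hb τ)
  have ha0 : ∀ a : I → ℂ, (∀ i, ‖a i‖ = α) → ∀ i, a i ≠ 0 := fun a ha i =>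
    norm_pos_iff.mp (by rw [ha]; exact hα)
  have hptinj : ∀ b : J → ℂ, (∀ j, b j ≠ 0 ∧ ‖b j‖ < β) → ∀ τ σ,
      c (jK τ) + b (jK τ) * y τ = c (jK σ) + b (jK σ) * y σ → τ = σ := fun b hb τ σ h => by
    have hj := eq_of_add_eq_of_separated hc (hby b hb τ) (hby b hb σ) h
    rw [hj] at h
    exact hy τ σ hj (mul_left_cancel₀ (hb _).1 (add_left_cancel h))
  have hxinj : ∀ (a : I → ℂ) (b : J → ℂ), (∀ i, ‖a i‖ = α) → (∀ j, b j ≠ 0 ∧ ‖b j‖ < β) →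
      Function.Injective (x a b) := fun a b ha hb τ σ h => by
    have hi := eq_of_add_eq_of_separated hζ (hq a b ha hb τ) (hq a b ha hb σ) h
    simp only [hx_def, hi] at h
    exact hptinj b hb τ σ (mul_left_cancel₀ (ha0 a ha _) (add_left_cancel h))
  have hXinj : ∀ a : I → ℂ, (∀ i, ‖a i‖ = α) →
      Function.Injective fun j => ζ (iJ j) + a (iJ j) * c j := fun a ha j j' h => by
    have hi := eq_of_add_eq_of_separated hζ (hac a ha j) (hac a ha j') h
    simp only [hi] at h
    exact hci (mul_left_cancel₀ (ha0 a ha _) (add_left_cancel h))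
  let p : K → MvPolynomial (I ⊕ J) ℂ := fun τ => MvPolynomial.C (ζ (iJ (jK τ))) +
    MvPolynomial.X (Sum.inl (iJ (jK τ))) * (MvPolynomial.C (c (jK τ)) +
      MvPolynomial.X (Sum.inr (jK τ)) * MvPolynomial.C (y τ))
  have hp : ∀ a b, (fun τ => MvPolynomial.eval (Sum.elim a b) (p τ)) = x a b := fun a b => by
    funext τ
    simp [p, hx_def]
  have hU : ∀ g ∈ {g : I ⊕ J → ℂ | Function.Injective fun τ => MvPolynomial.eval g (p τ)},
      (fun τ => MvPolynomial.eval g (p τ)) ∈ {x : K → ℂ | Function.Injective x} := fun g hg => hg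
  obtain ⟨D₂, P₂, hD₂, hP₂⟩ := hF₂.comp p hU
  obtain ⟨D₃, P₃, hD₃, hP₃⟩ := hF₃.comp p hU
  have hmem : ∀ a b, Function.Injective (x a b) → Sum.elim a b ∈
      {g : I ⊕ J → ℂ | Function.Injective fun τ => MvPolynomial.eval g (p τ)} := fun a b h => by
    show Function.Injective _
    rw [hp]
    exact h
  have hrel₂ : ∀ a b, Function.Injective (x a b) →
      F₂ (x a b) * MvPolynomial.eval (Sum.elim a b) (D₂ * D₃) =
        MvPolynomial.eval (Sum.elim a b) (P₂ * D₃) := fun a b h => by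
    have := hP₂ _ (hmem a b h)
    beta_reduce at this
    rw [hp] at this
    rw [map_mul, map_mul, ← this]
    ring
  have hrel₃ : ∀ a b, Function.Injective (x a b) →
      F₃ (x a b) * MvPolynomial.eval (Sum.elim a b) (D₂ * D₃) =
        MvPolynomial.eval (Sum.elim a b) (P₃ * D₂) := fun a b h => by
    have := hP₃ _ (hmem a b h)
    beta_reduce at this
    rw [hp] at this
    rw [map_mul, map_mul, ← this]
    ring
  have hbΩ : ∀ b : J → ℂ, (∀ j, ‖b j‖ = β / 2) → ∀ j, b j ≠ 0 ∧ ‖b j‖ < β := fun b hb j =>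
    ⟨norm_pos_iff.mp (by rw [hb]; positivity), by rw [hb]; linarith⟩
  set C : (I → ℤ) → (J → ℤ) → ℂ := fun r s => φ ζ fun i => (EF EV (fib iJ i)
      (fun j => (EF EV (fib jK j) v y (s j + ∑ σ ∈ fib jK j, w σ) : V)) c
      (r i + ∑ τ ∈ fib (iJ ∘ jK) i, w τ) : V) with hC
  have hR₂ := fun r s => iterated_coeff_relation (ρ := fun _ => α) (fun _ => hα)
    (ρ' := fun _ => β / 2) (fun _ => by positivity) (C := C) (F := fun a b => F₂ (x a b))
    (fun a ha s => IsCompAt.hasSum_iterated hEV H1 (v := v) (w := w) (y := y) hζi hci (ha0 a ha) (hXinj a ha)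
      (fun j j' h => norm_add_lt_of_separated hζ h (hac a ha j) (hac a ha j')) s)
    (fun a b ha hb' => by
      have hb := hbΩ b hb'
      have hX : (fun τ => (ζ (iJ (jK τ)) + a (iJ (jK τ)) * c (jK τ)) +
          a (iJ (jK τ)) * b (jK τ) * y τ) = x a b := by
        funext τ
        simp only [hx_def]
        ring
      have h := H2 (fun j => ζ (iJ j) + a (iJ j) * c j)
        (fun τ => a (iJ (jK τ)) * b (jK τ) * y τ) (hXinj a ha)
        (by rw [hX]; exact hxinj a b ha hb) (fun τ σ hτσ => by
          have hτ := hacb a b ha hb τ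
          have hσ := hacb a b ha hb σ
          rw [mul_assoc, mul_assoc]
          by_cases hi : iJ (jK τ) = iJ (jK σ)
          · have h1 := hc _ _ hτσ
            have h2 : ζ (iJ (jK τ)) + a (iJ (jK τ)) * c (jK τ) -
                (ζ (iJ (jK σ)) + a (iJ (jK σ)) * c (jK σ)) =
                a (iJ (jK τ)) * (c (jK τ) - c (jK σ)) := by
              rw [hi]
              ring
            rw [h2, norm_mul (a _) (b (jK τ) * y τ), norm_mul (a _) (b (jK σ) * y σ),
              norm_mul (a _) (c _ - c _)]
            simp only [ha]
            nlinarith [hby b hb τ, hby b hb σ]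
          · have h1 := hζ _ _ hi
            have h2 : ζ (iJ (jK τ)) - ζ (iJ (jK σ)) =
                (ζ (iJ (jK τ)) + a (iJ (jK τ)) * c (jK τ) -
                (ζ (iJ (jK σ)) + a (iJ (jK σ)) * c (jK σ))) +
                (a (iJ (jK σ)) * c (jK σ) - a (iJ (jK τ)) * c (jK τ)) := by ring
            rw [h2] at h1
            have h3 := norm_add_le (ζ (iJ (jK τ)) + a (iJ (jK τ)) * c (jK τ) -
                (ζ (iJ (jK σ)) + a (iJ (jK σ)) * c (jK σ)))
                (a (iJ (jK σ)) * c (jK σ) - a (iJ (jK τ)) * c (jK τ))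
            have h4 := norm_sub_le (a (iJ (jK σ)) * c (jK σ)) (a (iJ (jK τ)) * c (jK τ))
            linarith)
      rw [hX] at h
      have h' := hasSum_scaled hEV jK _ hv hy (a := fun j => a (iJ j) * b j)
        (fun j => mul_ne_zero (ha0 a ha _) (hb j).1) h
      refine h'.congr_fun fun s => ?_
      rw [mul_assoc]
      congr 1
      simp [zmon, mul_zpow, Finset.prod_mul_distrib])
    (fun a b ha hb => hrel₂ a b (hxinj a b ha (hbΩ b hb))) r s
  set b₀ : J → ℂ := fun _ => ((β / 2 : ℝ) : ℂ)
  have hb₀ : ∀ j, b₀ j ≠ 0 ∧ ‖b₀ j‖ < β := hbΩ b₀ fun j => by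
    simp only [b₀, Complex.norm_real, Real.norm_eq_abs]
    exact abs_of_pos (by positivity)
  have hR₃ := fun r s => successive_coeff_relation (ρ := fun _ => α) (fun _ => hα) hβ
    (Val := partVal EV jK iJ rep (φ ζ) v w y c) (F := fun a b => F₃ (x a b))
    (fun a b ha hb s => by
      have h := H3 ζ (fun τ => a (iJ (jK τ)) * (c (jK τ) + b (jK τ) * y τ)) hζi
        (hxinj a b ha hb) (fun τ σ h =>
          norm_add_lt_of_separated hζ h (hq a b ha hb τ) (hq a b ha hb σ))
      simp only [partVal_empty]
      exact hasSum_scaled hEV (iJ ∘ jK) (φ ζ) hv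
        (y := fun τ => c (jK τ) + b (jK τ) * y τ) (fun τ σ _ h => hptinj b hb τ σ h) (ha0 a ha) h)
    (fun J₀ j₀ hj₀ b hb r s => partVal_expand hEV iJ hrep (φ ζ) hv hy hc (hby b hb)
      (fun j => (hb j).1) hj₀ r s)
    (fun a b ha hb => hrel₃ a b (hxinj a b ha hb)) r s hb₀
  have hPP : P₂ * D₃ = P₃ * D₂ := by
    ext d
    rw [← sum_ite_zexp, ← sum_ite_zexp (P₃ * D₂), ← hR₂, ← hR₃]
    simp only [partVal_univ hEV iJ hrep _ _ _ _ hci, hC]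
  have hx1 : x 1 1 = z := by
    funext τ
    simp only [hx_def, hy_def, Pi.one_apply]
    ring
  have hinj1 : Function.Injective (x 1 1) := by
    rw [hx1]
    exact hz
  have hfin := (hrel₂ 1 1 hinj1).trans ((congrArg _ hPP).trans (hrel₃ 1 1 hinj1).symm)
  rw [hx1] at hfin
  refine mul_right_cancel₀ ?_ hfin
  rw [map_mul]
  exact mul_ne_zero (hD₂ _ (hmem 1 1 hinj1)) (hD₃ _ (hmem 1 1 hinj1))

end Associativity

section Blocks
variable {n m : ℕ}

lemma blockStart_add_le (l : Fin n → ℕ) {i j : Fin n} (hij : i < j) :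
    blockStart l i + l i ≤ blockStart l j := by
  have hi : i ∉ Finset.univ.filter (fun k => k < i) := by simp
  rw [blockStart, add_comm, ← Finset.sum_insert (f := l) hi]
  refine Finset.sum_le_sum_of_subset fun k hk => ?_
  simp only [Finset.mem_insert, Finset.mem_filter, Finset.mem_univ, true_and] at hk ⊢
  rcases hk with rfl | hk
  · exact hij
  · exact hk.trans hij

lemma blockEmb_bijective (l : Fin n → ℕ) (hsum : ∑ i, l i = m) :
    Function.Bijective fun x : Σ i, Fin (l i) => blockEmb l hsum x.1 x.2 := by
  rw [Fintype.bijective_iff_injective_and_card]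
  constructor
  · rintro ⟨i, a⟩ ⟨j, b⟩ h
    have h' : blockStart l i + (a : ℕ) = blockStart l j + (b : ℕ) := congrArg Fin.val h
    rcases lt_trichotomy i j with hij | rfl | hij
    · have := blockStart_add_le l hij
      omega
    · obtain rfl : a = b := Fin.ext (by omega)
      rfl
    · have := blockStart_add_le l hij
      omega
  · simp [hsum]

/-- The block containing a position. -/
def blockPar (l : Fin n → ℕ) (hsum : ∑ i, l i = m) (τ : Fin m) : Fin n :=
  ((Equiv.ofBijective _ (blockEmb_bijective l hsum)).symm τ).1

lemma blockPar_blockEmb (l : Fin n → ℕ) (hsum : ∑ i, l i = m) (i : Fin n) (a : Fin (l i)) :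
    blockPar l hsum (blockEmb l hsum i a) = i := by
  have := (Equiv.ofBijective _ (blockEmb_bijective l hsum)).symm_apply_apply ⟨i, a⟩
  exact congrArg Sigma.fst this

lemma exists_blockEmb_eq (l : Fin n → ℕ) (hsum : ∑ i, l i = m) (τ : Fin m) :
    ∃ a, blockEmb l hsum (blockPar l hsum τ) a = τ :=
  ⟨_, (Equiv.ofBijective _ (blockEmb_bijective l hsum)).apply_symm_apply τ⟩

lemma blockPar_eq_iff (l : Fin n → ℕ) (hsum : ∑ i, l i = m) {τ : Fin m} {i : Fin n} :
    blockPar l hsum τ = i ↔ ∃ a, blockEmb l hsum i a = τ := by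
  constructor
  · rintro rfl
    exact exists_blockEmb_eq l hsum τ
  · rintro ⟨a, rfl⟩
    exact blockPar_blockEmb l hsum i a

lemma blockEmb_injective (l : Fin n → ℕ) (hsum : ∑ i, l i = m) (i : Fin n) :
    Function.Injective (blockEmb l hsum i) := fun a b h => by
  have h' : blockStart l i + (a : ℕ) = blockStart l i + (b : ℕ) := congrArg Fin.val h
  exact Fin.ext (by omega)

lemma blockPar_eq_of_le_of_lt (l : Fin n → ℕ) (hsum : ∑ i, l i = m) {τ : Fin m} {i : Fin n}
    (h1 : blockStart l i ≤ τ) (h2 : (τ : ℕ) < blockStart l i + l i) : blockPar l hsum τ = i :=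
  (blockPar_eq_iff l hsum).mpr ⟨⟨τ - blockStart l i, by omega⟩, Fin.ext (by
    simp only [blockEmb]
    omega)⟩

lemma lt_of_blockPar_lt (l : Fin n → ℕ) (hsum : ∑ i, l i = m) {τ σ : Fin m}
    (h : blockPar l hsum τ < blockPar l hsum σ) : τ < σ := by
  obtain ⟨a, ha⟩ := exists_blockEmb_eq l hsum τ
  obtain ⟨b, hb⟩ := exists_blockEmb_eq l hsum σ
  have h1 : blockStart l (blockPar l hsum τ) + (a : ℕ) = τ := congrArg Fin.val ha
  have h2 : blockStart l (blockPar l hsum σ) + (b : ℕ) = σ := congrArg Fin.val hb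
  have := blockStart_add_le l h
  have := a.2
  rw [Fin.lt_def]
  omega

lemma blockPar_comp {k : ℕ} (l : Fin n → ℕ) (hsum : ∑ i, l i = m) (kk : Fin m → ℕ)
    (hksum : ∑ i, kk i = k)
    (hcomb : ∑ i : Fin n, (∑ t : Fin (l i), kk (blockEmb l hsum i t)) = k) :
    blockPar (fun i => ∑ t : Fin (l i), kk (blockEmb l hsum i t)) hcomb =
      blockPar l hsum ∘ blockPar kk hksum := by
  have hK : ∀ i, ∑ t : Fin (l i), kk (blockEmb l hsum i t) =
      ∑ j ∈ Finset.univ.filter (fun j => blockPar l hsum j = i), kk j := fun i => by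
    refine Finset.sum_bij (fun t _ => blockEmb l hsum i t)
      (fun t _ => by simp [blockPar_blockEmb])
      (fun t _ t' _ h => blockEmb_injective l hsum i h) (fun j hj => ?_) fun _ _ => rfl
    obtain ⟨t, ht⟩ := (blockPar_eq_iff l hsum).mp (Finset.mem_filter.mp hj).2
    exact ⟨t, Finset.mem_univ _, ht⟩
  have hstart : ∀ i, blockStart (fun i => ∑ t : Fin (l i), kk (blockEmb l hsum i t)) i =
      ∑ j ∈ Finset.univ.filter (fun j => blockPar l hsum j < i), kk j := fun i => by
    rw [blockStart, ← Finset.sum_fiberwise_of_maps_to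
      (t := Finset.univ.filter fun i' => i' < i) (g := blockPar l hsum) (by simp)]
    refine Finset.sum_congr rfl fun i' hi' => ?_
    rw [hK, Finset.filter_filter]
    refine Finset.sum_congr (Finset.filter_congr fun j _ => ?_) fun _ _ => rfl
    have := (Finset.mem_filter.mp hi').2
    constructor
    · rintro rfl
      exact ⟨this, rfl⟩
    · exact fun h => h.2
  funext τ
  obtain ⟨j, hj⟩ : ∃ j, blockPar kk hksum τ = j := ⟨_, rfl⟩
  obtain ⟨a, ha⟩ := (blockPar_eq_iff kk hksum).mp hj
  have h1 : blockStart kk j + (a : ℕ) = τ := congrArg Fin.val ha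
  have h2 := a.2
  rw [Function.comp_apply, hj]
  refine blockPar_eq_of_le_of_lt _ hcomb ?_ ?_
  · rw [hstart]
    refine le_trans ?_ (h1 ▸ Nat.le_add_right _ _)
    refine Finset.sum_le_sum_of_subset fun j' hj' => ?_
    simp only [Finset.mem_filter, Finset.mem_univ, true_and] at hj' ⊢
    exact lt_of_blockPar_lt l hsum hj'
  · rw [hstart]
    rw [hK]
    refine lt_of_lt_of_le (b := blockStart kk j + kk j) (by omega) ?_
    have hj : j ∉ Finset.univ.filter (fun k => k < j) := by simp
    rw [blockStart, add_comm, ← Finset.sum_insert (f := kk) hj, ← Finset.sum_union]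
    · refine Finset.sum_le_sum_of_subset fun j' hj' => ?_
      simp only [Finset.mem_insert, Finset.mem_union, Finset.mem_filter, Finset.mem_univ, true_and]
        at hj' ⊢
      rw [← le_iff_lt_or_eq]
      by_contra hlt
      have := lt_of_blockPar_lt l hsum (not_le.mp hlt)
      rcases hj' with rfl | hj'
      · exact lt_irrefl _ this
      · exact lt_asymm this hj'
    · rw [Finset.disjoint_left]
      intro j' h3 h4
      exact (Finset.mem_filter.mp h3).2.ne (Finset.mem_filter.mp h4).2

end Blocks

section Pairing
variable {V W : Type} [AddCommGroup V] [Module ℂ V] [AddCommGroup W] [Module ℂ W]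
variable {A : GRVA V} {M : GRMod V W A}
variable {EV : ∀ l : ℕ, (Fin l → V) → (Fin l → ℂ) → VbarT A}

lemma GradedFunctionalC.support_finite {w' : W →ₗ[ℂ] ℂ} (hw' : GradedFunctionalC M.grading w')
    (ω : WbarT M) : (Function.support fun c => w' (ω c : W)).Finite :=
  Set.Finite.subset hw' fun c hc => ⟨ω c, (ω c).2, hc⟩

/-- The pairing with an element of the graded dual as a linear map. -/
def pairBarLin (M : GRMod V W A) {w' : W →ₗ[ℂ] ℂ} (hw' : GradedFunctionalC M.grading w') :
    WbarT M →ₗ[ℂ] ℂ where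
  toFun := pairBar w'
  map_add' ω ω' := by
    simp only [pairBar, Pi.add_apply, Submodule.coe_add, map_add]
    exact finsum_add_distrib (hw'.support_finite ω) (hw'.support_finite ω')
  map_smul' a ω := by
    simp only [pairBar, Pi.smul_apply, Submodule.coe_smul, map_smul, RingHom.id_apply]
    exact (smul_finsum a _).symm

/-- The matrix coefficients of a cochain at a fixed configuration, as a multilinear form. -/
def cochainForm {n : ℕ} (Φ : Cochain M n) {w' : W →ₗ[ℂ] ℂ} (hw' : GradedFunctionalC M.grading w')
    (X : Fin n → ℂ) : MultilinearMap ℂ (fun _ : Fin n => V) ℂ :=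
  (pairBarLin M hw' ∘ₗ LinearMap.proj X).compMultilinearMap Φ

lemma IsCompE.isCompAt (hEV : IsEVFam A EV) {n m : ℕ} {Φ : Cochain M n} {l : Fin n → ℕ}
    {hsum : ∑ i, l i = m} {Ψ : Cochain M m} (h : IsCompE EV Φ m l hsum Ψ) {w' : W →ₗ[ℂ] ℂ}
    (hw' : GradedFunctionalC M.grading w') (v : Fin m → V) :
    IsCompAt EV (blockPar l hsum) (cochainForm Φ hw') v fun z => cochainForm Ψ hw' z v := by
  intro X u hX hz hnorm
  have key := (h v w' hw').2 X (fun τ => X (blockPar l hsum τ) + u τ) (fun i j hij => hX.ne hij)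
    (fun i j hij => hz.ne hij) (fun i j hij a b => by
      have := hnorm (blockEmb l hsum i a) (blockEmb l hsum j b)
        (by rwa [blockPar_blockEmb, blockPar_blockEmb])
      simpa only [blockPar_blockEmb, add_sub_cancel_left] using this)
  refine key.congr_fun fun r => ?_
  show pairBar w' (Φ _ X) = pairBar w' (Φ _ X)
  refine congrArg (fun V' : Fin n → V => pairBar w' (Φ V' X)) (funext fun i => ?_)
  rw [EF_eq hEV (blockEmb_injective l hsum i)
    (fun τ => by rw [mem_fib]; exact blockPar_eq_iff l hsum)]
  · refine congrArg (fun x => (EV (l i) (v ∘ blockEmb l hsum i) x (r i) : V)) ?_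
    funext a
    simp [blockPar_blockEmb]
  · intro τ hτ σ hσ hu
    refine hz ?_
    simp only [Finset.mem_coe, mem_fib] at hτ hσ
    simp only [hτ, hσ, hu]

lemma RatDiag.ratOn {n : ℕ} {f : (Fin n → ℂ) → ℂ} (hf : RatDiag n f) :
    RatOn {x | Function.Injective x} f := by
  obtain ⟨P, N, h⟩ := hf
  exact ⟨diagPoly n N, P, fun x hx => eval_diagPoly_ne_zero n N hx, fun x hx => by
    rw [eval_diagPoly]
    exact h x fun i j hij => hx.ne hij⟩

lemma one_le_norm_natCast_sub {n : ℕ} (i j : Fin n) (h : i ≠ j) :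
    1 ≤ ‖((i : ℕ) : ℂ) - ((j : ℕ) : ℂ)‖ := by
  have h1 : ((i : ℕ) : ℂ) - ((j : ℕ) : ℂ) = (((i : ℕ) - (j : ℕ) : ℤ) : ℂ) := by push_cast; rfl
  rw [h1, Complex.norm_intCast]
  have h2 : ((i : ℕ) - (j : ℕ) : ℤ) ≠ 0 := by
    have := Fin.val_ne_of_ne h
    omega
  exact_mod_cast Int.one_le_abs h2

lemma multilinear_eq_of_homogeneous {K : Type} [Fintype K]
    {f g : MultilinearMap ℂ (fun _ : K => V) ℂ}
    (h : ∀ (v : K → V) (w : K → ℤ), (∀ τ, v τ ∈ A.grading (w τ)) → f v = g v) : f = g := by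
  ext v
  choose S hS using fun τ => exists_sum_gproj A (v τ)
  have hv : v = fun τ => ∑ k ∈ S τ, gproj A k (v τ) := funext hS
  rw [hv, MultilinearMap.map_sum_finset, MultilinearMap.map_sum_finset]
  exact Finset.sum_congr rfl fun r _ => h _ r fun τ => gproj_mem A _ _

end Pairing

/-- Proposition 3.8, conclusion 2: associativity of
compositions with products of vertex operators acting on the vacuum:
`(Φ ∘ (E^{(l₁)}_{V;𝟏} ⊗ ⋯ ⊗ E^{(lₙ)}_{V;𝟏})) ∘ (E^{(k₁)}_{V;𝟏} ⊗ ⋯ ⊗ E^{(k_{p+n})}_{V;𝟏})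
 = Φ ∘ (E^{(k₁+⋯+k_{l₁})}_{V;𝟏} ⊗ ⋯ ⊗ E^{(k_{l₁+⋯+l_{n-1}+1}+⋯+k_{p+n})}_{V;𝟏})`
(as `W̄`-valued rational functions, i.e. on the configuration space). -/
theorem compE_associativity
    (A : GRVA V) (M : GRMod V W A)
    (EV : ∀ l : ℕ, (Fin l → V) → (Fin l → ℂ) → VbarT A) (hEV : IsEVFam A EV)
    (EW : ∀ m : ℕ, (Fin m → V) → W → (Fin m → ℂ) → WbarT M) (hEW : IsEWFam M EW)
    (n m p q : ℕ) (hp : 1 ≤ p) (hq : 1 ≤ q) (hpq : p + q ≤ m)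
    (Φ : Cochain M n) (hrat : TakesRatValues Φ) (hcomp : Composable EV EW m Φ)
    (l : Fin n → ℕ) (hl : ∀ i, 0 < l i) (hsum : ∑ i, l i = p + n)
    (kk : Fin (p + n) → ℕ) (hkk : ∀ i, 0 < kk i) (hksum : ∑ i, kk i = q + p + n)
    (Ψ₁ : Cochain M (p + n)) (h₁ : IsCompE EV Φ (p + n) l hsum Ψ₁)
    (Ψ₂ : Cochain M (q + p + n)) (h₂ : IsCompE EV Ψ₁ (q + p + n) kk hksum Ψ₂)
    (hcomb : ∑ i : Fin n, (∑ t : Fin (l i), kk (blockEmb l hsum i t)) = q + p + n)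
    (Ψ₃ : Cochain M (q + p + n))
    (h₃ : IsCompE EV Φ (q + p + n)
      (fun i => ∑ t : Fin (l i), kk (blockEmb l hsum i t)) hcomb Ψ₃)
    (v : Fin (q + p + n) → V) (z : Fin (q + p + n) → ℂ)
    (hdist : ∀ s t, s ≠ t → z s ≠ z t) :
    Ψ₂ v z = Ψ₃ v z := by
  refine WbarT_ext fun w' hw' => ?_
  suffices h : cochainForm Ψ₂ hw' z = cochainForm Ψ₃ hw' z from
    congrArg (fun f : MultilinearMap ℂ (fun _ : Fin (q + p + n) => V) ℂ => f v) h
  refine multilinear_eq_of_homogeneous (A := A) fun v w hv => ?_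
  have h3 := h₃.isCompAt hEV hw' v
  rw [blockPar_comp l hsum kk hksum hcomb] at h3
  exact IsCompAt.comp_eq_of_homogeneous hEV (rep := fun j => blockEmb kk hksum j ⟨0, hkk j⟩)
    (fun j => blockPar_blockEmb kk hksum j _) (fun v' => h₁.isCompAt hEV hw' v') hv
    (h₂.isCompAt hEV hw' v) h3 (h₂ v w' hw').1.ratOn (h₃ v w' hw').1.ratOn
    (ζ := fun i => ((i : ℕ) : ℂ)) one_le_norm_natCast_sub
    (c := fun j => ((j : ℕ) : ℂ)) one_le_norm_natCast_sub
    (fun s t h => by_contra fun hne => hdist s t hne h)
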